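/- There is a fixed ε > 0 such that if n = 2k+1 and p > 1 − ε, then H_k(n,p) satisfies EKR almost surely (as k → ∞). -/

import Mathlib

open Filter

noncomputable section

/-- The collection of all `k`-element subsets of `Fin n`. -/
def kSets (n k : ℕ) : Finset (Finset (Fin n)) := Finset.powersetCard k Finset.univ

open Classical in
/-- The probability that the random hypergraph `H_k(n,p)` (each `k`-subset of `[n]`
present independently with probability `p`) satisfies the property `P`. -/
def hprob (n k : ℕ) (p : ℝ) (P : Finset (Finset (Fin n)) → Prop) : ℝ :=
  ∑ H ∈ (kSets n k).powerset,
    if P H then p ^ H.card * (1 - p) ^ ((kSets n k).card - H.card) else 0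

/-- A family of sets is intersecting (a clique) if no two of its members are disjoint. -/
def IsClique {n : ℕ} (C : Finset (Finset (Fin n))) : Prop :=
  ∀ A ∈ C, ∀ B ∈ C, (A ∩ B).Nonempty

/-- The star of `x` in `H`: the set of edges of `H` containing `x`. -/
def starOf {n : ℕ} (H : Finset (Finset (Fin n))) (x : Fin n) : Finset (Finset (Fin n)) :=
  H.filter (fun A => x ∈ A)

/-- The degree of `x` in `H`. -/
def vdeg {n : ℕ} (H : Finset (Finset (Fin n))) (x : Fin n) : ℕ := (starOf H x).card

/-- The maximum degree of `H`. -/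
def maxDegree {n : ℕ} (H : Finset (Finset (Fin n))) : ℕ :=
  Finset.univ.sup (vdeg H)

/-- A family is nontrivial if it is not contained in a star. -/
def IsNontrivial {n : ℕ} (C : Finset (Finset (Fin n))) : Prop :=
  ¬ ∃ x : Fin n, ∀ A ∈ C, x ∈ A

/-- `H` satisfies (strong) EKR if every maximum-size intersecting subfamily of `H`
is a star of `H`. -/
def EKR {n : ℕ} (H : Finset (Finset (Fin n))) : Prop :=
  ∀ C ⊆ H, IsClique C → (∀ D ⊆ H, IsClique D → D.card ≤ C.card) →
    ∃ x : Fin n, C = starOf H x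

open Classical in
/-- `q = q(n,k)`: the probability that two independent uniform `k`-subsets of `[n]` meet. -/
def interProb (n k : ℕ) : ℝ :=
  ((((kSets n k) ×ˢ (kSets n k)).filter fun AB => (AB.1 ∩ AB.2).Nonempty).card : ℝ) /
    ((kSets n k).card : ℝ) ^ 2

/-- `φ = p·C(n-1,k-1)`, the expected degree of a vertex. -/
def phi (n k : ℕ) (p : ℝ) : ℝ := p * ((n - 1).choose (k - 1) : ℝ)

/-- `μ̄ = φ·n/k`, the expected number of edges. -/
def mubar (n k : ℕ) (p : ℝ) : ℝ := phi n k p * n / k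

/-- The generalized binomial coefficient `C(x,t) = x(x-1)⋯(x-t+1)/t!`. -/
def gchoose (x : ℝ) (t : ℕ) : ℝ := (∏ i ∈ Finset.range t, (x - i)) / (t.factorial : ℝ)

/-- `Λ(t) = C(μ̄,t)·q^{C(t,2)}`. -/
def Lam (n k : ℕ) (p : ℝ) (t : ℕ) : ℝ :=
  gchoose (mubar n k p) t * interProb n k ^ t.choose 2

/-- `Λ'(t)`: equals `0` for `t ≤ 2` and `Λ(t)` otherwise. -/
def Lam' (n k : ℕ) (p : ℝ) (t : ℕ) : ℝ := if t ≤ 2 then 0 else Lam n k p t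

open Classical in
/-- The probability of `E` for a uniform sample from the finite set `s`. -/
def uprob {α : Type*} (s : Finset α) (E : α → Prop) : ℝ :=
  ((s.filter E).card : ℝ) / (s.card : ℝ)

open Classical in
/-- The probability of `E` under the probability mass function `w` on `Ω`. -/
def wprob {Ω : Type*} [Fintype Ω] (w : Ω → ℝ) (E : Ω → Prop) : ℝ :=
  ∑ ω ∈ Finset.univ.filter E, w ω

open Classical in
/-- The probability that the family `{A_1,…,A_m}` formed by `m` independent uniform
`k`-subsets of `[n]` satisfies `P`. -/
def iidprob (n k m : ℕ) (P : Finset (Finset (Fin n)) → Prop) : ℝ :=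
  uprob ((Finset.univ : Finset (Fin m → Finset (Fin n))).filter fun f => ∀ i, f i ∈ kSets n k)
    (fun f => P (Finset.image f Finset.univ))

open Classical in
/-- The probability that the tuple `(A_1,…,A_m)` of independent uniform `k`-subsets of `[n]`
satisfies `P`. -/
def tupleProb (n k m : ℕ) (P : (Fin m → Finset (Fin n)) → Prop) : ℝ :=
  uprob ((Finset.univ : Finset (Fin m → Finset (Fin n))).filter fun f => ∀ i, f i ∈ kSets n k) P

/-- `Pr(Bin(M,p) ≥ θ)`. -/
def binomProbGe (M : ℕ) (p : ℝ) (θ : ℕ) : ℝ :=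
  ∑ j ∈ Finset.Icc θ M, (M.choose j : ℝ) * p ^ j * (1 - p) ^ (M - j)

/-- `φ* = log³ n / log(1/q)`. -/
def phiStar (n k : ℕ) : ℝ := (Real.log n) ^ 3 / Real.log (1 / interProb n k)

/-- `α₁`: the largest integer `t` with `Pr(Bin(C(n-1,k-1),p) ≥ t) ≥ ψ/n`, where `ψ = log n`. -/
def alpha1 (n k : ℕ) (p : ℝ) : ℕ :=
  sSup {t : ℕ | Real.log n / n ≤ binomProbGe ((n - 1).choose (k - 1)) p t}

/-- `α₂ = min{t : Λ(t) ≤ σ}`. -/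
def alpha2 (n k : ℕ) (p σn : ℝ) : ℕ := sInf {t : ℕ | Lam n k p t ≤ σn}

/-- `α = max{α₁, α₂}`. -/
def alphaP (n k : ℕ) (p σn : ℝ) : ℕ := max (alpha1 n k p) (alpha2 n k p σn)

/-- `γ = min{α, φ*/3}`. -/
def gammaP (n k : ℕ) (p σn : ℝ) : ℕ := min (alphaP n k p σn) ⌊phiStar n k / 3⌋₊

/-- `τ = (1-ε)·γ`. -/
def tauP (ε : ℝ) (n k : ℕ) (p σn : ℝ) : ℝ := (1 - ε) * (gammaP n k p σn : ℝ)

/-- `λ = max{√(log n)/log(1/q), 2·√(log n/log(1/q))}`. -/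
def lamP (n k : ℕ) : ℝ :=
  max (Real.sqrt (Real.log n) / Real.log (1 / interProb n k))
    (2 * Real.sqrt (Real.log n / Real.log (1 / interProb n k)))

/-- `w̄ = max{φ²k²/n, 6 log n}`. -/
def wbar (n k : ℕ) (p : ℝ) : ℝ := max (phi n k p ^ 2 * (k : ℝ) ^ 2 / n) (6 * Real.log n)

/-- `q̄ = (1 + 2k²w̄/(q n²))·q`. -/
def qbar (n k : ℕ) (p : ℝ) : ℝ :=
  (1 + 2 * (k : ℝ) ^ 2 * wbar n k p / (interProb n k * (n : ℝ) ^ 2)) * interProb n k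

open Classical in
/-- The probability that the random subset of `H`, keeping each element independently
with probability `ρ`, satisfies `P`. -/
def sprob {β : Type*} [DecidableEq β] (H : Finset β) (ρ : ℝ) (P : Finset β → Prop) : ℝ :=
  ∑ G ∈ H.powerset, if P G then ρ ^ G.card * (1 - ρ) ^ (H.card - G.card) else 0

/-- The degree of `v` in the multiset `{f 0, …, f (m-1)}` (with multiplicity). -/
def tdeg {n m : ℕ} (f : Fin m → Finset (Fin n)) (v : Fin n) : ℕ :=
  (Finset.univ.filter fun i => v ∈ f i).card

/-- An increasing (up-)event in `{0,1}^ι`. -/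
def IncrEvent {ι : Type*} (A : Set (ι → Bool)) : Prop :=
  ∀ x y : ι → Bool, y ≤ x → y ∈ A → x ∈ A

/-- The coordinate `i` affects the event `A`. -/
def Affects {ι : Type*} (i : ι) (A : Set (ι → Bool)) : Prop :=
  ∃ η ∈ A, ∃ ν, ν ∉ A ∧ ∀ j, j ≠ i → η j = ν j

/-- Negative association of a family of `{0,1}`-valued random variables, defined on the
finite probability space `Ω` with probability mass function `w`. -/
def NegAssoc {Ω ι : Type*} [Fintype Ω] (w : Ω → ℝ) (X : ι → Ω → Bool) : Prop :=
  ∀ A B : Set (ι → Bool), IncrEvent A → IncrEvent B →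
    (∀ i, ¬ (Affects i A ∧ Affects i B)) →
    wprob w (fun ω => (fun i => X i ω) ∈ A ∧ (fun i => X i ω) ∈ B) ≤
      wprob w (fun ω => (fun i => X i ω) ∈ A) * wprob w (fun ω => (fun i => X i ω) ∈ B)

/-- `X = X_1 + ⋯ + X_m` for `{0,1}`-valued random variables. -/
def bcount {Ω : Type*} {m : ℕ} (X : Fin m → Ω → Bool) (ω : Ω) : ℕ :=
  (Finset.univ.filter fun i => X i ω = true).card

end

section SpectralUD
open Finset
variable {α : Type*} [DecidableEq α]

/-- Down operator: sum over one-point extensions inside `Ω`. -/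
def opD (Ω : Finset α) (f : Finset α → ℝ) (u : Finset α) : ℝ := ∑ i ∈ Ω \ u, f (insert i u)

/-- Up operator: sum over one-point deletions. -/
def opU (f : Finset α → ℝ) (v : Finset α) : ℝ := ∑ i ∈ v, f (v.erase i)

lemma sum_flag (Ω : Finset α) (j : ℕ) (φ : Finset α → α → ℝ) :
    ∑ u ∈ Ω.powersetCard j, ∑ i ∈ Ω \ u, φ u i =
      ∑ v ∈ Ω.powersetCard (j+1), ∑ i ∈ v, φ (v.erase i) i := by
  rw [Finset.sum_sigma', Finset.sum_sigma']
  refine Finset.sum_bij' (fun x _ => ⟨insert x.2 x.1, x.2⟩) (fun x _ => ⟨x.1.erase x.2, x.2⟩)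
    ?_ ?_ ?_ ?_ ?_
  · rintro ⟨u, i⟩ h
    simp only [mem_sigma, mem_powersetCard, Finset.mem_sdiff] at h ⊢
    refine ⟨⟨insert_subset h.2.1 h.1.1, ?_⟩, mem_insert_self _ _⟩
    rw [card_insert_of_notMem h.2.2, h.1.2]
  · rintro ⟨v, i⟩ h
    simp only [mem_sigma, mem_powersetCard, Finset.mem_sdiff] at h ⊢
    refine ⟨⟨(erase_subset _ _).trans h.1.1, ?_⟩, h.1.1 h.2, notMem_erase _ _⟩
    rw [card_erase_of_mem h.2, h.1.2]; rfl
  · rintro ⟨u, i⟩ h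
    simp only [mem_sigma, mem_powersetCard, Finset.mem_sdiff] at h
    simp [erase_insert h.2.2]
  · rintro ⟨v, i⟩ h
    simp only [mem_sigma, mem_powersetCard] at h
    simp [insert_erase h.2]
  · rintro ⟨u, i⟩ h
    simp only [mem_sigma, mem_powersetCard, Finset.mem_sdiff] at h
    simp [erase_insert h.2.2]

lemma ud_adj (Ω : Finset α) (j : ℕ) (f g : Finset α → ℝ) :
    ∑ u ∈ Ω.powersetCard j, opD Ω f u * g u =
      ∑ v ∈ Ω.powersetCard (j+1), f v * opU g v := by
  simp only [opD, opU, sum_mul, mul_sum]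
  rw [sum_flag Ω j (fun u i => f (insert i u) * g u)]
  refine sum_congr rfl fun v _ => sum_congr rfl fun i hi => ?_
  rw [insert_erase hi]

lemma ud_comm (Ω : Finset α) (g : Finset α → ℝ) (u : Finset α) (hu : u ⊆ Ω) :
    opD Ω (opU g) u = opU (opD Ω g) u + ((Ω.card : ℝ) - 2 * u.card) * g u := by
  have h1 : opD Ω (opU g) u = ((Ω.card : ℝ) - u.card) * g u +
      ∑ i ∈ Ω \ u, ∑ l ∈ u, g ((insert i u).erase l) := by
    have hc : ((Ω.card : ℝ) - u.card) * g u = ∑ i ∈ Ω \ u, g u := by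
      rw [sum_const, card_sdiff_of_subset hu, nsmul_eq_mul, Nat.cast_sub (card_le_card hu)]
    rw [hc, ← sum_add_distrib]
    refine sum_congr rfl fun i hi => ?_
    have hi' := (Finset.mem_sdiff.1 hi).2
    simp only [opU]
    rw [sum_insert hi', erase_insert hi']
  have h2 : opU (opD Ω g) u = (u.card : ℝ) * g u +
      ∑ l ∈ u, ∑ i ∈ Ω \ u, g ((insert i u).erase l) := by
    have hc : (u.card : ℝ) * g u = ∑ i ∈ u, g u := by
      rw [sum_const, nsmul_eq_mul]
    rw [hc, ← sum_add_distrib]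
    refine sum_congr rfl fun l hl => ?_
    simp only [opD]
    have : Ω \ u.erase l = insert l (Ω \ u) := by
      ext x; simp only [Finset.mem_sdiff, mem_erase, mem_insert]
      constructor
      · rintro ⟨a, b⟩; by_cases hx : x = l; exact Or.inl hx
        exact Or.inr ⟨a, fun c => b ⟨hx, c⟩⟩
      · rintro (rfl | ⟨a, b⟩)
        · exact ⟨hu hl, fun c => c.1 rfl⟩
        · exact ⟨a, fun c => b c.2⟩
    rw [this, sum_insert (by simp [hl]), insert_erase hl]
    congr 1
    refine sum_congr rfl fun i hi => ?_
    have hi' := (Finset.mem_sdiff.1 hi).2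
    rw [erase_insert_of_ne]
    rintro rfl; exact hi' hl
  rw [h1, h2, sum_comm]; ring

/-- squared norm on level `j` -/
def nsq (Ω : Finset α) (j : ℕ) (f : Finset α → ℝ) : ℝ := ∑ v ∈ Ω.powersetCard j, f v ^ 2

lemma nsq_nonneg (Ω : Finset α) (j : ℕ) (f : Finset α → ℝ) : 0 ≤ nsq Ω j f :=
  sum_nonneg fun _ _ => sq_nonneg _

lemma nsq_U (Ω : Finset α) (j : ℕ) (g : Finset α → ℝ) :
    nsq Ω (j+2) (opU g) = nsq Ω j (opD Ω g) + ((Ω.card : ℝ) - 2 * (j+1)) * nsq Ω (j+1) g := by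
  have h1 : nsq Ω (j+2) (opU g) = ∑ u ∈ Ω.powersetCard (j+1), opD Ω (opU g) u * g u := by
    rw [ud_adj]; simp only [nsq, sq]
  have h2 : nsq Ω j (opD Ω g) = ∑ v ∈ Ω.powersetCard (j+1), g v * opU (opD Ω g) v := by
    rw [← ud_adj]; simp only [nsq, sq]
  rw [h1, h2, nsq, mul_sum, ← sum_add_distrib]
  refine sum_congr rfl fun u hu => ?_
  rw [mem_powersetCard] at hu
  rw [ud_comm Ω g u hu.1, hu.2]; push_cast; ring

/-- vanishing of all sums over `r`-stars -/
def Orth (Ω : Finset α) (r j : ℕ) (f : Finset α → ℝ) : Prop :=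
  ∀ s ∈ Ω.powersetCard r, ∑ v ∈ (Ω.powersetCard j).filter (fun v => s ⊆ v), f v = 0

lemma orth_D (Ω : Finset α) (r j : ℕ) (f : Finset α → ℝ) (h : Orth Ω r (j+1) f) :
    Orth Ω r j (opD Ω f) := by
  intro s hs
  rw [mem_powersetCard] at hs
  rw [sum_filter]
  have : ∀ u ∈ Ω.powersetCard j, (if s ⊆ u then opD Ω f u else 0) =
      ∑ i ∈ Ω \ u, if s ⊆ u then f (insert i u) else 0 := by
    intro u _; split_ifs <;> simp [opD]
  rw [sum_congr rfl this, sum_flag Ω j (fun u i => if s ⊆ u then f (insert i u) else 0)]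
  have h2 : ∀ v ∈ Ω.powersetCard (j+1),
      (∑ i ∈ v, if s ⊆ v.erase i then f (insert i (v.erase i)) else 0) =
      ((j:ℝ) + 1 - r) * (if s ⊆ v then f v else 0) := by
    intro v hv
    rw [mem_powersetCard] at hv
    split_ifs with hsv
    · have : ((j:ℝ) + 1 - r) * f v = ∑ i ∈ v \ s, f v := by
        rw [sum_const, card_sdiff_of_subset hsv, nsmul_eq_mul, Nat.cast_sub (card_le_card hsv), hv.2, hs.2]
        push_cast; ring
      rw [this, ← sum_filter]
      refine sum_congr ?_ ?_
      · ext i; simp only [mem_filter, Finset.mem_sdiff, subset_erase]; tauto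
      · intro i hi; rw [insert_erase (Finset.mem_sdiff.1 hi).1]
    · rw [mul_zero]
      refine sum_eq_zero fun i hi => if_neg fun h => hsv (h.trans (erase_subset _ _))
  rw [sum_congr rfl h2, ← mul_sum, ← sum_filter, h s (mem_powersetCard.2 hs), mul_zero]

lemma orth_base (Ω : Finset α) (r : ℕ) (f : Finset α → ℝ) (h : Orth Ω r (r+1) f) :
    nsq Ω r (opD Ω f) = 0 := by
  have h := orth_D Ω r r f h
  refine sum_eq_zero fun u hu => ?_
  have := h u hu
  rw [mem_powersetCard] at hu
  rw [sum_eq_single u] at this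
  · rw [this]; ring
  · intro b hb hbu
    rw [mem_filter, mem_powersetCard] at hb
    exact absurd (eq_of_subset_of_card_le hb.2 (by omega)).symm hbu
  · intro h; simp [hu] at h

/-- spectral bound for the down operator. -/
lemma nsq_D_le (Ω : Finset α) (r m : ℕ) (f : Finset α → ℝ) (hm : 2 * r + m + 1 ≤ Ω.card)
    (h : Orth Ω r (r + m + 1) f) :
    nsq Ω (r + m) (opD Ω f) ≤ (m : ℝ) * ((Ω.card : ℝ) - (2 * r + m + 1)) * nsq Ω (r + m + 1) f := by
  induction m generalizing f with
  | zero => rw [Nat.add_zero] at *; rw [orth_base Ω r f h]; simp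
  | succ m ih =>
    have hD := ih (opD Ω f) (by omega) (orth_D Ω r _ f h)
    have hU := nsq_U Ω (r + m) (opD Ω f)
    set X := nsq Ω (r + (m + 1)) (opD Ω f) with hX
    set Y := nsq Ω (r + (m + 1) + 1) f with hY
    have hUU : nsq Ω (r + m + 2) (opU (opD Ω f)) ≤
        (((m+1 : ℕ):ℝ) * ((Ω.card : ℝ) - (2 * r + (m+1 : ℕ) + 1))) * X := by
      rw [hU]
      have e : nsq Ω (r + m + 1) (opD Ω f) = X := rfl
      rw [e] at hD ⊢
      push_cast
      nlinarith [hD]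
    set c := (((m+1 : ℕ):ℝ) * ((Ω.card : ℝ) - (2 * r + (m+1 : ℕ) + 1))) with hc
    have hc0 : 0 ≤ c := by
      refine mul_nonneg (by positivity) ?_
      have : ((2 * r + (m+1) + 1 : ℕ) : ℝ) ≤ Ω.card := by exact_mod_cast hm
      push_cast at this ⊢; linarith
    have hXi : X = ∑ v ∈ Ω.powersetCard (r + (m+1) + 1), f v * opU (opD Ω f) v := by
      rw [← ud_adj, hX]; simp only [nsq, sq]
    have hCS : X ^ 2 ≤ Y * nsq Ω (r + m + 2) (opU (opD Ω f)) := by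
      rw [hXi]
      exact Finset.sum_mul_sq_le_sq_mul_sq _ _ _
    have hX0 : 0 ≤ X := nsq_nonneg _ _ _
    have hY0 : 0 ≤ Y := nsq_nonneg _ _ _
    have h3 : X ^ 2 ≤ Y * (c * X) := hCS.trans (mul_le_mul_of_nonneg_left hUU hY0)
    rcases hX0.eq_or_lt with h0 | h0
    · rw [← h0]; positivity
    · have : X * X ≤ (c * Y) * X := by nlinarith
      exact le_of_mul_le_mul_right this h0

end SpectralUD


section Kneser
open Finset

/-- the `k`-subsets of `Fin (2k+1)` -/
abbrev Kn (k : ℕ) : Finset (Finset (Fin (2*k+1))) := kSets (2*k+1) k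

/-- neighbour of `v` along label `t` -/
def nb {k : ℕ} (v : Finset (Fin (2*k+1))) (t : Fin (2*k+1)) : Finset (Fin (2*k+1)) := vᶜ.erase t

lemma mem_Kn {k : ℕ} {v : Finset (Fin (2*k+1))} : v ∈ Kn k ↔ v.card = k := by
  simp [Kn, kSets, mem_powersetCard]

lemma card_compl_Kn {k : ℕ} {v : Finset (Fin (2*k+1))} (h : v ∈ Kn k) : (vᶜ).card = k+1 := by
  rw [card_compl, mem_Kn.1 h, Fintype.card_fin]; omega

lemma nb_mem {k : ℕ} {v : Finset (Fin (2*k+1))} {t} (h : v ∈ Kn k) (ht : t ∈ vᶜ) :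
    nb v t ∈ Kn k := by
  rw [mem_Kn, nb, card_erase_of_mem ht, card_compl_Kn h]; rfl

lemma label_mem {k : ℕ} {v : Finset (Fin (2*k+1))} {t} : t ∈ (nb v t)ᶜ := by
  simp [nb]

lemma nb_compl {k : ℕ} {v : Finset (Fin (2*k+1))} {t} : (nb v t)ᶜ = insert t v := by
  ext x; simp only [nb, mem_compl, mem_erase, mem_insert, not_and_or, not_not]

lemma nb_nb {k : ℕ} {v : Finset (Fin (2*k+1))} {t} (ht : t ∈ vᶜ) : nb (nb v t) t = v := by
  rw [nb, nb_compl, erase_insert (by simpa using ht)]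

lemma edge_swap {k : ℕ} {β : Type*} [AddCommMonoid β]
    (φ : Finset (Fin (2*k+1)) → Fin (2*k+1) → β) :
    ∑ v ∈ Kn k, ∑ t ∈ vᶜ, φ (nb v t) t = ∑ v ∈ Kn k, ∑ t ∈ vᶜ, φ v t := by
  rw [Finset.sum_sigma', Finset.sum_sigma']
  refine Finset.sum_bij' (fun x _ => ⟨nb x.1 x.2, x.2⟩) (fun x _ => ⟨nb x.1 x.2, x.2⟩)
    ?_ ?_ ?_ ?_ ?_
  · rintro ⟨u, i⟩ h
    simp only [mem_sigma] at h ⊢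
    exact ⟨nb_mem h.1 h.2, label_mem⟩
  · rintro ⟨u, i⟩ h
    simp only [mem_sigma] at h ⊢
    exact ⟨nb_mem h.1 h.2, label_mem⟩
  · rintro ⟨u, i⟩ h
    simp only [mem_sigma] at h
    simp [nb_nb h.2]
  · rintro ⟨u, i⟩ h
    simp only [mem_sigma] at h
    simp [nb_nb h.2]
  · rintro ⟨u, i⟩ h
    rfl

/-- Kneser adjacency operator -/
def KF {k : ℕ} (f : Finset (Fin (2*k+1)) → ℝ) (v : Finset (Fin (2*k+1))) : ℝ :=
  ∑ t ∈ vᶜ, f (nb v t)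

/-- signless bilinear form -/
def BF {k : ℕ} (f g : Finset (Fin (2*k+1)) → ℝ) : ℝ :=
  ∑ v ∈ Kn k, ∑ t ∈ vᶜ, (f v + f (nb v t)) * (g v + g (nb v t))

lemma BF_eq {k : ℕ} (f g : Finset (Fin (2*k+1)) → ℝ) :
    BF f g = 2 * ∑ v ∈ Kn k, f v * (((k:ℝ)+1) * g v + KF g v) := by
  have e1 : BF f g = ∑ v ∈ Kn k, ∑ t ∈ vᶜ, f v * (g v + g (nb v t)) +
      ∑ v ∈ Kn k, ∑ t ∈ vᶜ, f (nb v t) * (g (nb v t) + g (nb (nb v t) t)) := by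
    rw [← sum_add_distrib]
    refine sum_congr rfl fun v _ => ?_
    rw [← sum_add_distrib]
    refine sum_congr rfl fun t ht => ?_
    rw [nb_nb ht]; ring
  have e2 := edge_swap (k := k) (fun v t => f v * (g v + g (nb v t)))
  rw [e1, e2, ← two_mul]
  congr 1
  refine sum_congr rfl fun v hv => ?_
  rw [← mul_sum, sum_add_distrib, sum_const, card_compl_Kn hv, KF, nsmul_eq_mul]
  push_cast; ring

lemma KF_compl {k : ℕ} (g : Finset (Fin (2*k+1)) → ℝ) (v) : KF g v = opU g (vᶜ) := rfl

lemma nsq_KF {k : ℕ} (g : Finset (Fin (2*k+1)) → ℝ) :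
    ∑ v ∈ Kn k, KF g v ^ 2 = nsq univ (k+1) (opU g) := by
  rw [nsq]
  refine Finset.sum_bij' (fun v _ => vᶜ) (fun v _ => vᶜ) ?_ ?_ ?_ ?_ ?_
  · intro v hv; simp [mem_powersetCard, card_compl_Kn hv]
  · intro v hv; rw [mem_powersetCard] at hv; rw [mem_Kn, card_compl, hv.2, Fintype.card_fin]; omega
  · intro v _; simp
  · intro v _; simp
  · intro v _; rw [KF_compl]

/-- spectral bound orthogonal to stars -/
lemma BF_orth {k : ℕ} (hk : 2 ≤ k) (g : Finset (Fin (2*k+1)) → ℝ)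
    (hg : ∀ z, ∑ v ∈ (Kn k).filter (fun v => z ∈ v), g v = 0) :
    4 * ∑ v ∈ Kn k, g v ^ 2 ≤ BF g g := by
  obtain ⟨m, rfl⟩ : ∃ m, k = m + 2 := ⟨k - 2, by omega⟩
  have ho : Orth (univ : Finset (Fin (2*(m+2)+1))) 1 (1 + m + 1) g := by
    intro s hs
    rw [mem_powersetCard, card_eq_one] at hs
    obtain ⟨-, z, rfl⟩ := hs
    have := hg z
    simp only [Kn, kSets] at this
    simp only [singleton_subset_iff]
    rw [show 1 + m + 1 = m + 2 by ring]
    exact this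
  have h1 := nsq_D_le _ 1 m g (by rw [card_univ, Fintype.card_fin]; omega) ho
  have h2 := nsq_U (univ : Finset (Fin (2*(m+2)+1))) (1 + m) g
  have h3 := nsq_KF g
  rw [show m + 2 + 1 = 1 + m + 2 by ring, h2] at h3
  have h4 : nsq (univ : Finset (Fin (2*(m+2)+1))) (1 + m + 1) g = ∑ v ∈ Kn (m+2), g v ^ 2 := by
    rw [nsq, show 1 + m + 1 = m + 2 by ring]; rfl
  rw [card_univ, Fintype.card_fin] at h1 h3
  rw [h4] at h1 h3
  push_cast at h1 h3
  set G := ∑ v ∈ Kn (m+2), g v ^ 2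
  have h5 : ∑ v ∈ Kn (m+2), KF g v ^ 2 ≤ ((m:ℝ)+1)^2 * G := by
    rw [h3]; nlinarith
  have h6 : 0 ≤ ∑ v ∈ Kn (m+2), (((m:ℝ)+1) * g v + KF g v)^2 := sum_nonneg fun _ _ => sq_nonneg _
  have h7 : ∑ v ∈ Kn (m+2), (((m:ℝ)+1) * g v + KF g v)^2 =
     ((m:ℝ)+1)^2 * G + 2 * ((m:ℝ)+1) * (∑ v ∈ Kn (m+2), g v * KF g v) + ∑ v ∈ Kn (m+2), KF g v ^ 2 := by
    rw [mul_sum, mul_sum, ← sum_add_distrib, ← sum_add_distrib]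
    refine sum_congr rfl fun v _ => by ring
  have h8 : -((m:ℝ)+1) * G ≤ ∑ v ∈ Kn (m+2), g v * KF g v := by
    have : 0 ≤ (2 * ((m:ℝ)+1)) * (((m:ℝ)+1) * G + ∑ v ∈ Kn (m+2), g v * KF g v) := by nlinarith
    have := nonneg_of_mul_nonneg_right this (by positivity)
    linarith
  rw [BF_eq]
  have h9 : ∑ v ∈ Kn (m+2), g v * ((((m+2:ℕ):ℝ)+1) * g v + KF g v) = ((m:ℝ)+3) * G + ∑ v ∈ Kn (m+2), g v * KF g v := by
    rw [mul_sum, ← sum_add_distrib]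
    refine sum_congr rfl fun v _ => by push_cast; ring
  rw [h9]; linarith

end Kneser


section Phase1
open Finset

lemma card_star_Kn {k : ℕ} (hk : 1 ≤ k) (z : Fin (2*k+1)) :
    ((Kn k).filter (fun v => z ∈ v)).card = (2*k).choose (k-1) := by
  have := card_filter_powersetCard_subset ({z} : Finset (Fin (2*k+1))) univ k (subset_univ _) (by simpa)
  simpa [Kn, kSets] using this

lemma card_two_Kn {k : ℕ} (hk : 2 ≤ k) (y z : Fin (2*k+1)) (h : y ≠ z) :
    ((Kn k).filter (fun v => y ∈ v ∧ z ∈ v)).card = (2*k-1).choose (k-2) := by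
  have := card_filter_powersetCard_subset ({y, z} : Finset (Fin (2*k+1))) univ k (subset_univ _)
    (by rw [card_pair h]; exact hk)
  rw [card_pair h, card_univ, Fintype.card_fin] at this
  simpa [Kn, kSets, insert_subset_iff] using this

lemma filter_notMem_Kn {k : ℕ} (z : Fin (2*k+1)) :
    (Kn k).filter (fun v => z ∉ v) = (univ.erase z).powersetCard k := by
  ext v
  simp only [mem_filter, mem_Kn, mem_powersetCard, subset_erase, subset_univ, true_and]
  tauto

lemma card_notMem_Kn {k : ℕ} (z : Fin (2*k+1)) :
    ((Kn k).filter (fun v => z ∉ v)).card = (2*k).choose k := by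
  rw [filter_notMem_Kn, card_powersetCard, card_erase_of_mem (mem_univ _), card_univ,
    Fintype.card_fin]; rfl

lemma card_Kn (k : ℕ) : (Kn k).card = (2*k+1).choose k := by
  simp [Kn, kSets, card_powersetCard]

lemma card_Kn_mul (k : ℕ) : (k+1) * (Kn k).card = (2*k+1) * (2*k).choose k := by
  rw [card_Kn]
  have h := Nat.add_one_mul_choose_eq (2*k) k
  have h2 : (2*k+1).choose k = (2*k+1).choose (k+1) := by
    rw [← Nat.choose_symm_of_eq_add]; omega
  rw [h2]; linarith

/-- sum over stars -/
lemma sum_star_comm {k : ℕ} (x : Fin (2*k+1) → ℝ) (h : Finset (Fin (2*k+1)) → ℝ) :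
    ∑ v ∈ Kn k, h v * ∑ i ∈ v, x i = ∑ i, x i * ∑ v ∈ (Kn k).filter (fun v => i ∈ v), h v := by
  have : ∀ v ∈ Kn k, h v * ∑ i ∈ v, x i = ∑ i, if i ∈ v then x i * h v else 0 := by
    intro v _
    rw [mul_sum, ← sum_filter]
    refine sum_congr (by ext; simp) fun i _ => by ring
  rw [sum_congr rfl this, sum_comm]
  refine sum_congr rfl fun i _ => ?_
  rw [mul_sum, sum_filter]

lemma exists_decomp {k : ℕ} (hk : 2 ≤ k) (f : Finset (Fin (2*k+1)) → ℝ) :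
    ∃ (c : ℝ) (x : Fin (2*k+1) → ℝ), ∑ i, x i = 0 ∧
      ∀ z, ∑ v ∈ (Kn k).filter (fun v => z ∈ v), (f v - c - ∑ i ∈ v, x i) = 0 := by
  set c : ℝ := (∑ v ∈ Kn k, f v) / (Kn k).card with hc
  set R : ℝ := (((2*k-1).choose (k-1) : ℕ) : ℝ) with hR
  have hR0 : R ≠ 0 := by
    rw [hR]; exact_mod_cast (Nat.choose_pos (by omega)).ne'
  have hM0 : ((Kn k).card : ℝ) ≠ 0 := by
    rw [card_Kn]; exact_mod_cast (Nat.choose_pos (by omega)).ne'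
  set x : Fin (2*k+1) → ℝ := fun z => (∑ v ∈ (Kn k).filter (fun v => z ∈ v), (f v - c)) / R with hx
  have hx0 : ∑ i, x i = 0 := by
    have := sum_star_comm (k := k) (fun _ => 1) (fun v => f v - c)
    simp only [one_mul] at this
    rw [hx, ← sum_div, ← this]
    have h2 : ∀ v ∈ Kn k, (f v - c) * ∑ i ∈ v, (1:ℝ) = (f v - c) * k := by
      intro v hv; rw [sum_const, mem_Kn.1 hv]; simp
    rw [sum_congr rfl h2, ← sum_mul, sum_sub_distrib, sum_const, nsmul_eq_mul, hc,
      mul_div_cancel₀ _ hM0]; simp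
  refine ⟨c, x, hx0, fun z => ?_⟩
  have h1 : ∑ v ∈ (Kn k).filter (fun v => z ∈ v), ∑ i ∈ v, x i = R * x z := by
    have e := sum_star_comm (k := k) x (fun v => if z ∈ v then 1 else 0)
    simp only [ite_mul, one_mul, zero_mul] at e
    rw [← sum_filter] at e
    rw [e]
    have h3 : ∀ i, ∑ v ∈ (Kn k).filter (fun v => i ∈ v), (if z ∈ v then (1:ℝ) else 0) =
        ((2*k-1).choose (k-2) : ℕ) + if i = z then R else 0 := by
      intro i
      rw [← sum_filter, filter_filter, sum_const, nsmul_eq_mul, mul_one]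
      split_ifs with h
      · subst h
        simp only [and_self]
        rw [card_star_Kn (by omega), hR]
        norm_cast
        obtain ⟨m, rfl⟩ : ∃ m, k = m + 2 := ⟨k - 2, by omega⟩
        rw [show 2 * (m+2) = 2*m+3+1 by ring, show m + 2 - 1 = m + 1 by omega, Nat.choose_succ_succ]
        simp
      · rw [card_two_Kn hk i z h, add_zero]
    simp only [h3, mul_add, sum_add_distrib]
    rw [← sum_mul, hx0]; simp [mul_comm]
  rw [sum_sub_distrib, h1, hx, mul_div_cancel₀ _ hR0]; simp

/-- label sums -/
def Lz {k : ℕ} (f : Finset (Fin (2*k+1)) → ℝ) (z : Fin (2*k+1)) : ℝ :=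
  ∑ v ∈ (Kn k).filter (fun v => z ∉ v), (f v + f (nb v z))
/-- label square sums -/
def Qz {k : ℕ} (f : Finset (Fin (2*k+1)) → ℝ) (z : Fin (2*k+1)) : ℝ :=
  ∑ v ∈ (Kn k).filter (fun v => z ∉ v), (f v + f (nb v z)) ^ 2

lemma sum_by_label {k : ℕ} {β : Type*} [AddCommMonoid β]
    (φ : Finset (Fin (2*k+1)) → Fin (2*k+1) → β) :
    ∑ v ∈ Kn k, ∑ t ∈ vᶜ, φ v t = ∑ z, ∑ v ∈ (Kn k).filter (fun v => z ∉ v), φ v z := by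
  have : ∀ v ∈ Kn k, ∑ t ∈ vᶜ, φ v t = ∑ t, if t ∉ v then φ v t else 0 := by
    intro v _
    rw [← sum_filter]
    exact sum_congr (by ext; simp) fun _ _ => rfl
  rw [sum_congr rfl this, sum_comm]
  simp only [sum_filter]

lemma BF_eq_Qz {k : ℕ} (f : Finset (Fin (2*k+1)) → ℝ) : BF f f = ∑ z, Qz f z := by
  rw [BF, sum_by_label (fun v t => (f v + f (nb v t)) * (f v + f (nb v t)))]
  simp only [Qz, sq]

lemma phase1_spectral {k : ℕ} (hk : 2 ≤ k) (f : Finset (Fin (2*k+1)) → ℝ) :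
    ∑ z, (Qz f z - Lz f z ^ 2 / ((2*k).choose k : ℕ)) ≤
      2 * (BF f f - 2 * ∑ v ∈ Kn k, f v ^ 2) := by
  obtain ⟨c, x, hx0, hg⟩ := exists_decomp hk f
  set g : Finset (Fin (2*k+1)) → ℝ := fun v => f v - c - ∑ i ∈ v, x i with hgdef
  set h : Finset (Fin (2*k+1)) → ℝ := fun v => c + ∑ i ∈ v, x i with hh
  have hfgh : ∀ v, f v = g v + h v := fun v => by simp only [hgdef, hh]; ring
  have hl : ∀ v : Finset (Fin (2*k+1)), ∑ i ∈ vᶜ, x i = - ∑ i ∈ v, x i := by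
    intro v
    have := sum_add_sum_compl v x
    linarith
  have hln : ∀ v : Finset (Fin (2*k+1)), ∀ t ∈ vᶜ, ∑ i ∈ nb v t, x i = - (∑ i ∈ v, x i) - x t := by
    intro v t ht
    have := sum_erase_add (vᶜ) x ht
    rw [hl] at this
    rw [nb]; linarith
  -- K h
  have hKh : ∀ v ∈ Kn k, ((k:ℝ)+1) * h v + KF h v = (2*k+2) * c + ∑ i ∈ v, x i := by
    intro v hv
    have : KF h v = ∑ t ∈ vᶜ, (c - (∑ i ∈ v, x i) - x t) := by
      refine sum_congr rfl fun t ht => ?_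
      simp only [hh]; rw [hln v t ht]; ring
    rw [this, sum_sub_distrib, sum_const, card_compl_Kn hv, hl, nsmul_eq_mul]
    simp only [hh]; push_cast; ring
  have hgl : ∀ y : Fin (2*k+1) → ℝ, ∑ v ∈ Kn k, g v * ∑ i ∈ v, y i = 0 := by
    intro y
    rw [sum_star_comm]
    exact sum_eq_zero fun i _ => by rw [hg i, mul_zero]
  have hg1 : ∑ v ∈ Kn k, g v = 0 := by
    have := hgl (fun _ => 1)
    have h2 : ∀ v ∈ Kn k, g v * ∑ i ∈ v, (1:ℝ) = g v * k := by
      intro v hv; rw [sum_const, mem_Kn.1 hv]; simp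
    rw [sum_congr rfl h2, ← sum_mul] at this
    rcases mul_eq_zero.1 this with h | h
    · exact h
    · exfalso; have : k = 0 := by exact_mod_cast h
      omega
  have hl1 : ∑ v ∈ Kn k, ∑ i ∈ v, x i = 0 := by
    have := sum_star_comm (k := k) x (fun _ => 1)
    simp only [one_mul] at this
    rw [this]
    simp only [sum_const, card_star_Kn (show 1 ≤ k by omega)]
    rw [← sum_mul, hx0, zero_mul]
  have hBgh : BF g h = 0 := by
    rw [BF_eq, sum_congr rfl (fun v hv => by rw [hKh v hv])]
    simp only [mul_add, sum_add_distrib]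
    rw [hgl, ← sum_mul, hg1]; simp
  have hBhh : BF h h = (4*k+4) * c^2 * (Kn k).card + 2 * ∑ v ∈ Kn k, (∑ i ∈ v, x i)^2 := by
    rw [BF_eq, sum_congr rfl (fun v hv => by rw [hKh v hv])]
    have : ∀ v ∈ Kn k, h v * ((2*k+2) * c + ∑ i ∈ v, x i) =
       (2*k+2) * c^2 + ((2*k+3) * c) * (∑ i ∈ v, x i) + (∑ i ∈ v, x i)^2 := by
      intro v _; simp only [hh]; ring
    rw [sum_congr rfl this, sum_add_distrib, sum_add_distrib, ← mul_sum, ← mul_sum, hl1, sum_const, nsmul_eq_mul]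
    ring
  have hff : ∑ v ∈ Kn k, f v ^ 2 = ∑ v ∈ Kn k, g v ^ 2 + c^2 * (Kn k).card
      + ∑ v ∈ Kn k, (∑ i ∈ v, x i)^2 := by
    have : ∀ v ∈ Kn k, f v ^ 2 = g v ^ 2 + 2 * (g v * ∑ i ∈ v, x i) + 2 * c * g v +
       2 * c * (∑ i ∈ v, x i) + (∑ i ∈ v, x i)^2 + c^2 := by
      intro v _; rw [hfgh]; simp only [hh]; ring
    rw [sum_congr rfl this]
    simp only [sum_add_distrib]
    rw [← mul_sum, ← mul_sum, ← mul_sum, hgl, hg1, hl1, sum_const, nsmul_eq_mul]; ring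
  have hBff : BF f f = BF g g + 2 * BF g h + BF h h := by
    simp only [BF, mul_sum, ← sum_add_distrib]
    refine sum_congr rfl fun v _ => sum_congr rfl fun t _ => ?_
    rw [hfgh v, hfgh (nb v t)]; ring
  have hgg := BF_orth hk g hg
  have hcM : 0 ≤ c^2 * (Kn k).card := mul_nonneg (sq_nonneg _) (Nat.cast_nonneg _)
  have key : BF g g ≤ 2 * (BF f f - 2 * ∑ v ∈ Kn k, f v ^ 2) := by
    rw [hBff, hff, hBgh, hBhh]
    have : 0 ≤ (k:ℝ) * (c^2 * (Kn k).card) := mul_nonneg (Nat.cast_nonneg _) hcM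
    nlinarith
  refine le_trans ?_ key
  rw [BF_eq_Qz]
  refine sum_le_sum fun z _ => ?_
  set P : ℝ := (((2*k).choose k : ℕ) : ℝ) with hP
  have hP0 : 0 < P := by rw [hP]; exact_mod_cast (Nat.choose_pos (by omega))
  set a : ℝ := x z - 2 * c with ha
  have e : Qz g z = Qz f z + 2 * a * Lz f z + P * a^2 := by
    rw [Qz, Qz, Lz, mul_sum]
    have : P * a^2 = ∑ v ∈ (Kn k).filter (fun v => z ∉ v), a^2 := by
      rw [sum_const, card_notMem_Kn, nsmul_eq_mul]
    rw [this, ← sum_add_distrib, ← sum_add_distrib]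
    refine sum_congr rfl fun v hv => ?_
    rw [mem_filter] at hv
    simp only [hgdef]
    rw [hln v z (by simpa using hv.2)]; ring
  rw [e]
  have : 0 ≤ (Lz f z + P * a)^2 / P := by positivity
  have e2 : (Lz f z + P * a)^2 / P = Lz f z ^ 2 / P + 2 * a * Lz f z + P * a^2 := by
    field_simp; ring
  linarith

end Phase1


section Compare
open Finset

/-- monochromatic edge -/
def mono {k : ℕ} (F : Finset (Finset (Fin (2*k+1)))) (v : Finset (Fin (2*k+1))) (t : Fin (2*k+1)) :
    Prop := (v ∈ F ↔ nb v t ∈ F)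

instance {k : ℕ} (F : Finset (Finset (Fin (2*k+1)))) (v) (t) : Decidable (mono F v t) := by
  unfold mono; infer_instance

/-- local density property -/
structure DD {k : ℕ} (H : Finset (Finset (Fin (2*k+1)))) (d : ℕ) : Prop where
  sub : H ⊆ Kn k
  d1 : ∀ v ∈ Kn k, ((vᶜ).filter (fun t => nb v t ∉ H)).card ≤ d
  d2 : ∀ s : Finset (Fin (2*k+1)), s.card + 1 = k →
    ((sᶜ).filter (fun b => insert b s ∉ H)).card ≤ d

/-- double counting via reconstruction -/
lemma fib_count {A E X : Type*} [DecidableEq E] [DecidableEq X]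
    (T : Finset A) (E0 : Finset E) (f : A → E) (α β : A → X) (ψ : E → X → X → A)
    (P : E → Finset X) (Q : E → X → Finset X) (p q : ℕ)
    (hP : ∀ e ∈ E0, (P e).card ≤ p) (hQ : ∀ e ∈ E0, ∀ x ∈ P e, (Q e x).card ≤ q)
    (h : ∀ τ ∈ T, f τ ∈ E0 ∧ α τ ∈ P (f τ) ∧ β τ ∈ Q (f τ) (α τ) ∧ ψ (f τ) (α τ) (β τ) = τ) :
    T.card ≤ p * q * E0.card := by
  have h1 : T.card ≤ (E0.sigma (fun e => (P e).sigma (fun x => Q e x))).card := by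
    refine card_le_card_of_injOn (fun τ => ⟨f τ, α τ, β τ⟩) ?_ ?_
    · intro τ hτ
      obtain ⟨a, b, c, -⟩ := h τ hτ
      simp only [coe_sigma, Set.mem_sigma_iff, mem_coe]
      exact ⟨a, b, c⟩
    · intro τ hτ τ' hτ' e
      rw [← (h τ hτ).2.2.2, ← (h τ' hτ').2.2.2]
      simp only [Sigma.mk.injEq, heq_eq_eq] at e
      obtain ⟨e1, e2⟩ := e
      rw [e1, e2.1, e2.2]
  refine h1.trans ?_
  rw [card_sigma]
  calc ∑ e ∈ E0, ((P e).sigma (fun x => Q e x)).card ≤ ∑ e ∈ E0, p * q := by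
        refine sum_le_sum fun e he => ?_
        rw [card_sigma]
        calc ∑ x ∈ P e, (Q e x).card ≤ ∑ x ∈ P e, q := sum_le_sum fun x hx => hQ e he x hx
          _ = (P e).card * q := by rw [sum_const, smul_eq_mul]
          _ ≤ p * q := Nat.mul_le_mul_right _ (hP e he)
    _ = p * q * E0.card := by rw [sum_const, smul_eq_mul, mul_comm]

variable {k : ℕ} (H G : Finset (Finset (Fin (2*k+1)))) (Z : Finset (Fin (2*k+1)))

/-- monochromatic `H`–`H` edges -/
def E0 : Finset (Finset (Fin (2*k+1)) × Fin (2*k+1)) :=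
  ((Kn k) ×ˢ univ).filter (fun e => e.2 ∉ e.1 ∧ e.2 ∉ Z ∧ e.1 ∈ H ∧ nb e.1 e.2 ∈ H ∧ mono G e.1 e.2)
/-- monochromatic edges from outside `H` to `H` -/
def E1 : Finset (Finset (Fin (2*k+1)) × Fin (2*k+1)) :=
  ((Kn k) ×ˢ univ).filter (fun e => e.2 ∉ e.1 ∧ e.2 ∉ Z ∧ e.1 ∉ H ∧ nb e.1 e.2 ∈ H ∧ mono G e.1 e.2)
/-- monochromatic edges outside `H` -/
def E2 : Finset (Finset (Fin (2*k+1)) × Fin (2*k+1)) :=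
  ((Kn k) ×ˢ univ).filter (fun e => e.2 ∉ e.1 ∧ e.2 ∉ Z ∧ e.1 ∉ H ∧ nb e.1 e.2 ∉ H ∧ mono G e.1 e.2)
/-- all monochromatic edges -/
def EA : Finset (Finset (Fin (2*k+1)) × Fin (2*k+1)) :=
  ((Kn k) ×ˢ univ).filter (fun e => e.2 ∉ e.1 ∧ e.2 ∉ Z ∧ mono G e.1 e.2)

lemma mono_nb {G : Finset (Finset (Fin (2*k+1)))} {v : Finset (Fin (2*k+1))} {t} (h : t ∉ v) :
    mono G (nb v t) t ↔ mono G v t := by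
  unfold mono; rw [nb_nb (by simpa using h)]; tauto

lemma EA_card : (EA G Z).card = (E0 H G Z).card + 2 * (E1 H G Z).card + (E2 H G Z).card := by
  have hs : (((Kn k) ×ˢ (univ : Finset (Fin (2*k+1)))).filter (fun e => e.2 ∉ e.1 ∧ e.2 ∉ Z ∧ e.1 ∈ H ∧ nb e.1 e.2 ∉ H ∧
      mono G e.1 e.2)).card = (E1 H G Z).card := by
    refine card_bij' (fun e _ => (nb e.1 e.2, e.2)) (fun e _ => (nb e.1 e.2, e.2)) ?_ ?_ ?_ ?_
    · rintro ⟨v, t⟩ h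
      simp only [E1, mem_filter, mem_product, mem_univ, and_true] at h ⊢
      obtain ⟨a, b, c, d, e, f⟩ := h
      refine ⟨nb_mem a (by simpa using b), by simpa using label_mem (v := v) (t := t), c, e, ?_, (mono_nb b).2 f⟩
      rwa [nb_nb (by simpa using b)]
    · rintro ⟨v, t⟩ h
      simp only [E1, mem_filter, mem_product, mem_univ, and_true] at h ⊢
      obtain ⟨a, b, c, d, e, f⟩ := h
      refine ⟨nb_mem a (by simpa using b), by simpa using label_mem (v := v) (t := t), c, e, ?_, (mono_nb b).2 f⟩
      rwa [nb_nb (by simpa using b)]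
    · rintro ⟨v, t⟩ h
      simp only [mem_filter] at h
      simp [nb_nb (show t ∈ vᶜ by simpa using h.2.1)]
    · rintro ⟨v, t⟩ h
      simp only [E1, mem_filter] at h
      simp [nb_nb (show t ∈ vᶜ by simpa using h.2.1)]
  suffices h : (EA G Z).card = (E0 H G Z).card + (((Kn k) ×ˢ (univ : Finset (Fin (2*k+1)))).filter
      (fun e => e.2 ∉ e.1 ∧ e.2 ∉ Z ∧ e.1 ∈ H ∧ nb e.1 e.2 ∉ H ∧ mono G e.1 e.2)).card +
      (E1 H G Z).card + (E2 H G Z).card by rw [h, hs]; ring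
  simp only [EA, E0, E1, E2, card_filter]
  simp only [← sum_add_distrib]
  refine sum_congr rfl fun e _ => ?_
  by_cases h1 : e.1 ∈ H <;> by_cases h2 : nb e.1 e.2 ∈ H <;> by_cases h3 : e.2 ∉ e.1 ∧ e.2 ∉ Z ∧ mono G e.1 e.2 <;>
    simp [h1, h2]

lemma nb_nb_eq {v : Finset (Fin (2*k+1))} {b c} : nb (nb v b) c = (insert b v).erase c := by
  rw [nb, nb_compl]

end Compare


section Compare1
open Finset
variable {k : ℕ} {H G : Finset (Finset (Fin (2*k+1)))} {Z : Finset (Fin (2*k+1))} {d : ℕ}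

/-- triples at a missing vertex -/
def S1 (H G : Finset (Finset (Fin (2*k+1)))) (Z : Finset (Fin (2*k+1))) :
    Finset (Finset (Fin (2*k+1)) × Fin (2*k+1) × Fin (2*k+1)) :=
  ((Kn k) ×ˢ univ ×ˢ univ).filter (fun e => e.1 ∉ H ∧ e.2.1 ∉ e.1 ∧ e.2.2 ∉ e.1 ∧ e.2.1 ∉ Z ∧ e.2.2 ∉ Z ∧
    nb e.1 e.2.1 ∈ H ∧ nb e.1 e.2.2 ∈ H ∧ mono G e.1 e.2.2 ∧ ¬ mono G e.1 e.2.1)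

/-- good detours -/
def good1 (H : Finset (Finset (Fin (2*k+1)))) (Z : Finset (Fin (2*k+1)))
    (e : Finset (Fin (2*k+1)) × Fin (2*k+1) × Fin (2*k+1)) : Finset (Fin (2*k+1)) :=
  e.1.filter (fun c => c ∉ Z ∧ nb (nb e.1 e.2.2) c ∈ H ∧ nb (nb e.1 e.2.1) c ∈ H ∧
    nb (nb (nb e.1 e.2.2) c) e.2.1 ∈ H)

lemma good1_card (hD : DD H d) (hZ : Z.card ≤ 1) (e) (he : e ∈ S1 H G Z) :
    k - 1 - 3 * d ≤ (good1 H Z e).card := by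
  obtain ⟨v, a, b⟩ := e
  simp only [S1, mem_filter, mem_product, mem_univ, and_true] at he
  obtain ⟨hv, h1, ha, hb, haZ, hbZ, haH, hbH, hm, hn⟩ := he
  have hab : a ≠ b := by rintro rfl; exact hn hm
  set B1 := ((nb v b)ᶜ).filter (fun t => nb (nb v b) t ∉ H)
  set B2 := ((nb v a)ᶜ).filter (fun t => nb (nb v a) t ∉ H)
  set s := (nb v b).erase a with hs
  set B3 := (sᶜ).filter (fun c => insert c s ∉ H)
  have c1 : B1.card ≤ d := hD.d1 _ (hD.sub hbH)
  have c2 : B2.card ≤ d := hD.d1 _ (hD.sub haH)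
  have hs1 : s.card + 1 = k := by
    have : a ∈ nb v b := by simp [nb, ha, hab]
    rw [hs, card_erase_add_one this]; exact mem_Kn.1 (hD.sub hbH)
  have c3 : B3.card ≤ d := hD.d2 s hs1
  have hsub : v ⊆ good1 H Z (v, a, b) ∪ (Z ∪ (B1 ∪ (B2 ∪ B3))) := by
    intro c hc
    have hca : c ≠ a := by rintro rfl; exact ha hc
    have hcb : c ≠ b := by rintro rfl; exact hb hc
    have e3 : insert c s = nb (nb (nb v b) c) a := by
      ext x; simp only [hs, nb, mem_erase, mem_compl, mem_insert]; grind
    have m1 : c ∈ (nb v b)ᶜ := by rw [nb_compl]; exact mem_insert_of_mem hc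
    have m2 : c ∈ (nb v a)ᶜ := by rw [nb_compl]; exact mem_insert_of_mem hc
    have m3 : c ∈ sᶜ := by simp [hs, nb, hc]
    simp only [mem_union, good1, mem_filter, B1, B2, B3, e3]
    tauto
  have := card_le_card hsub
  have h2 := card_union_le (good1 H Z (v, a, b)) (Z ∪ (B1 ∪ (B2 ∪ B3)))
  have h3 := card_union_le Z (B1 ∪ (B2 ∪ B3))
  have h4 := card_union_le B1 (B2 ∪ B3)
  have h5 := card_union_le B2 B3
  rw [mem_Kn.1 hv] at this
  omega

set_option maxHeartbeats 2000000 in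
lemma S1_card (hD : DD H d) (hZ : Z.card ≤ 1) :
    (S1 H G Z).card * (k - 1 - 3 * d) ≤ 4 * (d * (k+1)) * (E0 H G Z).card := by
  set T := (S1 H G Z).sigma (good1 H Z) with hT
  have hT1 : (S1 H G Z).card * (k - 1 - 3 * d) ≤ T.card := by
    rw [hT, card_sigma, ← smul_eq_mul]
    exact card_nsmul_le_sum _ _ _ fun e he => good1_card hD hZ e he
  set T1 := T.filter (fun τ => mono G (nb τ.1.1 τ.1.2.2) τ.2)
  set T2 := T.filter (fun τ => mono G (nb (nb τ.1.1 τ.1.2.2) τ.2) τ.1.2.1)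
  set T3 := T.filter (fun τ => mono G (nb (nb τ.1.1 τ.1.2.1) τ.2) τ.1.2.2)
  set T4 := T.filter (fun τ => mono G (nb τ.1.1 τ.1.2.1) τ.2)
  have key : ∀ v a b c, (⟨(v, a, b), c⟩ : Σ _ : Finset (Fin (2*k+1)) × Fin (2*k+1) × Fin (2*k+1), Fin (2*k+1)) ∈ T →
      v ∈ Kn k ∧ v ∉ H ∧ a ∉ v ∧ b ∉ v ∧ a ∉ Z ∧ b ∉ Z ∧ nb v a ∈ H ∧ nb v b ∈ H ∧ mono G v b ∧ ¬ mono G v a ∧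
      a ≠ b ∧ c ∈ v ∧ c ∉ Z ∧ c ≠ a ∧ c ≠ b ∧ nb (nb v b) c ∈ H ∧ nb (nb v a) c ∈ H ∧ nb (nb (nb v b) c) a ∈ H ∧
      nb (nb (nb v b) c) a = nb (nb (nb v a) c) b := by
    intro v a b c hτ
    simp only [hT, mem_sigma, S1, good1, mem_filter, mem_product, mem_univ, and_true] at hτ
    obtain ⟨⟨hv, h1, ha, hb, haZ, hbZ, haH, hbH, hm, hn⟩, hc, hcZ, g1, g2, g3⟩ := hτ
    have hab : a ≠ b := by rintro rfl; exact hn hm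
    have hca : c ≠ a := by rintro rfl; exact ha hc
    have hcb : c ≠ b := by rintro rfl; exact hb hc
    refine ⟨hv, h1, ha, hb, haZ, hbZ, haH, hbH, hm, hn, hab, hc, hcZ, hca, hcb, g1, g2, g3, ?_⟩
    ext x; simp only [nb, mem_erase, mem_compl, mem_insert]; grind
  have hcov : T ⊆ T1 ∪ (T2 ∪ (T3 ∪ T4)) := by
    rintro ⟨⟨v, a, b⟩, c⟩ hτ
    obtain ⟨hv, h1, ha, hb, haZ, hbZ, haH, hbH, hm, hn, hab, hc, hcZ, hca, hcb, g1, g2, g3, e⟩ := key v a b c hτ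
    simp only [T1, T2, T3, T4, mem_union, mem_filter, hτ, true_and]
    unfold mono at *
    rw [e]
    tauto
  have b1 : T1.card ≤ d * (k+1) * (E0 H G Z).card := by
    refine fib_count T1 (E0 H G Z) (fun τ => (nb τ.1.1 τ.1.2.2, τ.2)) (fun τ => τ.1.2.2) (fun τ => τ.1.2.1)
      (fun e b a => ⟨(nb e.1 b, a, b), e.2⟩) (fun e => (e.1ᶜ).filter (fun t => nb e.1 t ∉ H))
      (fun e b => (nb e.1 b)ᶜ) d (k+1) ?_ ?_ ?_
    · rintro ⟨w, c⟩ he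
      simp only [E0, mem_filter, mem_product] at he
      exact hD.d1 _ he.1.1
    · rintro ⟨w, c⟩ he x hx
      simp only [E0, mem_filter, mem_product] at he hx
      rw [card_compl_Kn (nb_mem he.1.1 hx.1)]
    · rintro ⟨⟨v, a, b⟩, c⟩ hτ
      simp only [T1, mem_filter] at hτ
      obtain ⟨hv, h1, ha, hb, haZ, hbZ, haH, hbH, hm, hn, hab, hc, hcZ, hca, hcb, g1, g2, g3, e⟩ := key v a b c hτ.1
      have r : nb (nb v b) b = v := nb_nb (by simpa using hb)
      have m1 : c ∉ nb v b := by simp [nb, hc]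
      simp only [E0, mem_filter, mem_product, mem_univ, and_true, r]
      refine ⟨⟨hD.sub hbH, m1, hcZ, hbH, g1, hτ.2⟩, ⟨label_mem, h1⟩, by simpa using ha⟩
  have b4 : T4.card ≤ d * (k+1) * (E0 H G Z).card := by
    refine fib_count T4 (E0 H G Z) (fun τ => (nb τ.1.1 τ.1.2.1, τ.2)) (fun τ => τ.1.2.1) (fun τ => τ.1.2.2)
      (fun e a b => ⟨(nb e.1 a, a, b), e.2⟩) (fun e => (e.1ᶜ).filter (fun t => nb e.1 t ∉ H))
      (fun e b => (nb e.1 b)ᶜ) d (k+1) ?_ ?_ ?_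
    · rintro ⟨w, c⟩ he
      simp only [E0, mem_filter, mem_product] at he
      exact hD.d1 _ he.1.1
    · rintro ⟨w, c⟩ he x hx
      simp only [E0, mem_filter, mem_product] at he hx
      rw [card_compl_Kn (nb_mem he.1.1 hx.1)]
    · rintro ⟨⟨v, a, b⟩, c⟩ hτ
      simp only [T4, mem_filter] at hτ
      obtain ⟨hv, h1, ha, hb, haZ, hbZ, haH, hbH, hm, hn, hab, hc, hcZ, hca, hcb, g1, g2, g3, e⟩ := key v a b c hτ.1
      have r : nb (nb v a) a = v := nb_nb (by simpa using ha)
      have m1 : c ∉ nb v a := by simp [nb, hc]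
      simp only [E0, mem_filter, mem_product, mem_univ, and_true, r]
      refine ⟨⟨hD.sub haH, m1, hcZ, haH, g2, hτ.2⟩, ⟨label_mem, h1⟩, by simpa using hb⟩
  have b2 : T2.card ≤ (k+1) * d * (E0 H G Z).card := by
    refine fib_count T2 (E0 H G Z) (fun τ => (nb (nb τ.1.1 τ.1.2.2) τ.2, τ.1.2.1)) (fun τ => τ.1.2.2) (fun τ => τ.2)
      (fun e b c => ⟨(insert c (e.1.erase b), e.2, b), c⟩) (fun e => e.1)
      (fun e b => ((e.1.erase b)ᶜ).filter (fun c => insert c (e.1.erase b) ∉ H)) (k+1) d ?_ ?_ ?_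
    · rintro ⟨w, c⟩ he
      simp only [E0, mem_filter, mem_product] at he
      have := mem_Kn.1 he.1.1; dsimp only; omega
    · rintro ⟨w, c⟩ he x hx
      simp only [E0, mem_filter, mem_product] at he hx
      exact hD.d2 _ (by rw [card_erase_add_one hx]; exact mem_Kn.1 he.1.1)
    · rintro ⟨⟨v, a, b⟩, c⟩ hτ
      simp only [T2, mem_filter] at hτ
      obtain ⟨hv, h1, ha, hb, haZ, hbZ, haH, hbH, hm, hn, hab, hc, hcZ, hca, hcb, g1, g2, g3, e⟩ := key v a b c hτ.1
      have r : insert c ((nb (nb v b) c).erase b) = v := by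
        rw [nb_nb_eq]; ext x; simp only [mem_erase, mem_insert]; grind
      have m1 : a ∉ nb (nb v b) c := by rw [nb_nb_eq]; simp [hab, ha]
      simp only [E0, mem_filter, mem_product, mem_univ, and_true, r]
      refine ⟨⟨hD.sub g1, m1, haZ, g1, g3, hτ.2⟩, ?_, ⟨?_, h1⟩⟩
      · rw [nb_nb_eq]; simp [hcb.symm]
      · rw [nb_nb_eq]; simp
  have b3 : T3.card ≤ (k+1) * d * (E0 H G Z).card := by
    refine fib_count T3 (E0 H G Z) (fun τ => (nb (nb τ.1.1 τ.1.2.1) τ.2, τ.1.2.2)) (fun τ => τ.1.2.1) (fun τ => τ.2)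
      (fun e a c => ⟨(insert c (e.1.erase a), a, e.2), c⟩) (fun e => e.1)
      (fun e b => ((e.1.erase b)ᶜ).filter (fun c => insert c (e.1.erase b) ∉ H)) (k+1) d ?_ ?_ ?_
    · rintro ⟨w, c⟩ he
      simp only [E0, mem_filter, mem_product] at he
      have := mem_Kn.1 he.1.1; dsimp only; omega
    · rintro ⟨w, c⟩ he x hx
      simp only [E0, mem_filter, mem_product] at he hx
      exact hD.d2 _ (by rw [card_erase_add_one hx]; exact mem_Kn.1 he.1.1)
    · rintro ⟨⟨v, a, b⟩, c⟩ hτ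
      simp only [T3, mem_filter] at hτ
      obtain ⟨hv, h1, ha, hb, haZ, hbZ, haH, hbH, hm, hn, hab, hc, hcZ, hca, hcb, g1, g2, g3, e⟩ := key v a b c hτ.1
      rw [e] at g3
      have r : insert c ((nb (nb v a) c).erase a) = v := by
        rw [nb_nb_eq]; ext x; simp only [mem_erase, mem_insert]; grind
      have m1 : b ∉ nb (nb v a) c := by rw [nb_nb_eq]; simp [hab.symm, hb]
      simp only [E0, mem_filter, mem_product, mem_univ, and_true, r]
      refine ⟨⟨hD.sub g2, m1, hbZ, g2, g3, hτ.2⟩, ?_, ⟨?_, h1⟩⟩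
      · rw [nb_nb_eq]; simp [hca.symm]
      · rw [nb_nb_eq]; simp
  have h0 := card_le_card hcov
  have h2 := card_union_le T1 (T2 ∪ (T3 ∪ T4))
  have h3 := card_union_le T2 (T3 ∪ T4)
  have h4 := card_union_le T3 T4
  have e : (k+1) * d * (E0 H G Z).card = d * (k+1) * (E0 H G Z).card := by ring
  rw [e] at b2 b3
  have : 4 * (d * (k+1)) * (E0 H G Z).card = 4 * (d * (k+1) * (E0 H G Z).card) := by ring
  rw [this]; omega

/-- the majority property off `H` -/
def Maj (H G : Finset (Finset (Fin (2*k+1)))) (Z : Finset (Fin (2*k+1))) : Prop :=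
  ∀ v ∈ Kn k, v ∉ H → ((vᶜ).filter (fun t => t ∉ Z ∧ nb v t ∈ H ∧ mono G v t)).card ≤
    ((vᶜ).filter (fun t => t ∉ Z ∧ nb v t ∈ H ∧ ¬ mono G v t)).card

lemma E1_card (hD : DD H d) (hZ : Z.card ≤ 1) (hM : Maj H G Z) :
    (E1 H G Z).card * (k - d) ≤ 2 * (S1 H G Z).card := by
  set c1 : Finset (Fin (2*k+1)) → Finset (Fin (2*k+1)) :=
    fun v => (vᶜ).filter (fun t => t ∉ Z ∧ nb v t ∈ H ∧ mono G v t)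
  set c2 : Finset (Fin (2*k+1)) → Finset (Fin (2*k+1)) :=
    fun v => (vᶜ).filter (fun t => t ∉ Z ∧ nb v t ∈ H ∧ ¬ mono G v t)
  have hE : (E1 H G Z).card = ∑ v ∈ (Kn k).filter (fun v => v ∉ H), (c1 v).card := by
    rw [← card_sigma]
    refine card_bij' (fun e _ => ⟨e.1, e.2⟩) (fun e _ => (e.1, e.2)) ?_ ?_ ?_ ?_
    · rintro ⟨v, t⟩ h
      simp only [E1, c1, mem_filter, mem_product, mem_univ, and_true, mem_sigma, mem_compl] at h ⊢
      tauto
    · rintro ⟨v, t⟩ h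
      simp only [E1, c1, mem_filter, mem_product, mem_univ, and_true, mem_sigma, mem_compl] at h ⊢
      tauto
    · intros; rfl
    · intros; rfl
  have hS : (S1 H G Z).card = ∑ v ∈ (Kn k).filter (fun v => v ∉ H), (c2 v).card * (c1 v).card := by
    simp only [← card_product]
    rw [← card_sigma]
    refine card_bij' (fun e _ => ⟨e.1, e.2⟩) (fun e _ => (e.1, e.2)) ?_ ?_ ?_ ?_
    · rintro ⟨v, t⟩ h
      simp only [S1, c1, c2, mem_filter, mem_product, mem_univ, and_true, mem_sigma, mem_compl] at h ⊢
      tauto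
    · rintro ⟨v, t⟩ h
      simp only [S1, c1, c2, mem_filter, mem_product, mem_univ, and_true, mem_sigma, mem_compl] at h ⊢
      tauto
    · intros; rfl
    · intros; rfl
  rw [hE, hS, sum_mul, mul_sum]
  refine sum_le_sum fun v hv => ?_
  rw [mem_filter] at hv
  have hm := hM v hv.1 hv.2
  have hsub : vᶜ ⊆ c1 v ∪ (c2 v ∪ (Z ∪ (vᶜ).filter (fun t => nb v t ∉ H))) := by
    intro t ht
    simp only [c1, c2, mem_union, mem_filter, ht, true_and]
    tauto
  have h0 := card_le_card hsub
  have h2 := card_union_le (c1 v) (c2 v ∪ (Z ∪ (vᶜ).filter (fun t => nb v t ∉ H)))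
  have h3 := card_union_le (c2 v) (Z ∪ (vᶜ).filter (fun t => nb v t ∉ H))
  have h4 := card_union_le Z ((vᶜ).filter (fun t => nb v t ∉ H))
  have h5 := hD.d1 v hv.1
  rw [card_compl_Kn hv.1] at h0
  have h6 : k - d ≤ 2 * (c2 v).card := by
    have : (c1 v).card ≤ (c2 v).card := hm
    omega
  calc (c1 v).card * (k - d) ≤ (c1 v).card * (2 * (c2 v).card) := Nat.mul_le_mul_left _ h6
    _ = _ := by ring

lemma cmp1 (hD : DD H d) (hZ : Z.card ≤ 1) (hM : Maj H G Z) :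
    (E1 H G Z).card * (k - d) * (k - 1 - 3 * d) ≤ 8 * (d * (k+1)) * (E0 H G Z).card := by
  have h1 := E1_card hD hZ hM
  have h2 := S1_card (G := G) hD hZ
  calc _ ≤ 2 * (S1 H G Z).card * (k - 1 - 3 * d) := Nat.mul_le_mul_right _ h1
    _ = 2 * ((S1 H G Z).card * (k - 1 - 3 * d)) := by ring
    _ ≤ 2 * (4 * (d * (k+1)) * (E0 H G Z).card) := Nat.mul_le_mul_left _ h2
    _ = _ := by ring

end Compare1


section Compare2
open Finset
variable {k : ℕ} {H G : Finset (Finset (Fin (2*k+1)))} {Z : Finset (Fin (2*k+1))} {d : ℕ}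

lemma card_prod_filter_le {A B : Type*} (s : Finset A) (t : Finset B)
    (p : A → B → Prop) [∀ a b, Decidable (p a b)] (n : ℕ) (h : ∀ a ∈ s, (t.filter (p a)).card ≤ n) :
    ((s ×ˢ t).filter (fun x => p x.1 x.2)).card ≤ s.card * n := by
  rw [card_filter, sum_product]
  simp only [← card_filter]
  rw [← smul_eq_mul]
  exact sum_le_card_nsmul _ _ _ h

lemma card_prod_filter_le' {A B : Type*} (s : Finset A) (t : Finset B)
    (p : A → B → Prop) [∀ a b, Decidable (p a b)] (n : ℕ) (h : ∀ b ∈ t, (s.filter (fun a => p a b)).card ≤ n) :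
    ((s ×ˢ t).filter (fun x => p x.1 x.2)).card ≤ t.card * n := by
  rw [card_filter, sum_product_right]
  simp only [← card_filter]
  rw [← smul_eq_mul]
  exact sum_le_card_nsmul _ _ _ h

/-- good detours for missing-missing edges -/
def good2 (H : Finset (Finset (Fin (2*k+1)))) (Z : Finset (Fin (2*k+1)))
    (e : Finset (Fin (2*k+1)) × Fin (2*k+1)) : Finset (Fin (2*k+1) × Fin (2*k+1)) :=
  ((e.1 \ Z) ×ˢ (nb e.1 e.2 \ Z)).filter (fun a => nb e.1 a.2 ∈ H ∧ nb (nb e.1 a.2) a.1 ∈ H ∧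
    nb (nb (nb e.1 a.2) a.1) e.2 ∈ H ∧ nb (nb e.1 e.2) a.1 ∈ H)

lemma x_eq {v : Finset (Fin (2*k+1))} {a b : Fin (2*k+1)} (ha : a ∈ v) (hb : b ∉ v) :
    nb (nb v b) a = insert b (v.erase a) := by
  rw [nb_nb_eq, erase_insert_of_ne]; rintro rfl; exact hb ha

lemma y_eq {v : Finset (Fin (2*k+1))} {a b z : Fin (2*k+1)} (ha : a ∈ v) (hz : z ∉ v) (hb : b ∈ nb v z) :
    nb (nb (nb v b) a) z = insert a ((nb v z).erase b) := by
  simp only [nb, mem_erase, mem_compl] at hb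
  have haz : a ≠ z := by rintro rfl; exact hz ha
  have hab : a ≠ b := by rintro rfl; exact hb.2 ha
  ext x
  simp only [nb, mem_erase, mem_compl, mem_insert]
  by_cases h1 : x = a
  · subst h1; simp [haz, hab]
  · by_cases h2 : x = z
    · subst h2; simp [h1]
    · simp [h1, h2]

lemma good2_card (hD : DD H d) (hZ : Z.card ≤ 1) (e) (he : e ∈ E2 H G Z) :
    (k - 1) ^ 2 - 4 * (k * d) ≤ (good2 H Z e).card := by
  obtain ⟨v, z⟩ := e
  simp only [E2, mem_filter, mem_product, mem_univ, and_true] at he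
  obtain ⟨hv, hz, hzZ, h1, h2, hm⟩ := he
  have hv' : nb v z ∈ Kn k := nb_mem hv (by simpa using hz)
  have cv := mem_Kn.1 hv
  have cv' := mem_Kn.1 hv'
  set Bw := v ×ˢ ((vᶜ).filter (fun t => nb v t ∉ H)) with hBw
  set Bw2 := (((nb v z)ᶜ).filter (fun t => nb (nb v z) t ∉ H)) ×ˢ (nb v z) with hBw2
  set Bx := (v ×ˢ (univ : Finset (Fin (2*k+1)))).filter (fun x => x.2 ∈ (v.erase x.1)ᶜ ∧ insert x.2 (v.erase x.1) ∉ H) with hBx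
  set By := ((univ : Finset (Fin (2*k+1))) ×ˢ (nb v z)).filter
    (fun x => x.1 ∈ ((nb v z).erase x.2)ᶜ ∧ insert x.1 ((nb v z).erase x.2) ∉ H) with hBy
  have c1 : Bw.card ≤ k * d := by
    rw [hBw, card_product, cv]; exact Nat.mul_le_mul_left _ (hD.d1 v hv)
  have c2 : Bw2.card ≤ k * d := by
    rw [hBw2, card_product, cv', mul_comm]; exact Nat.mul_le_mul_left _ (hD.d1 _ hv')
  have c3 : Bx.card ≤ k * d := by
    have := card_prod_filter_le v (univ : Finset (Fin (2*k+1)))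
      (fun a b => b ∈ (v.erase a)ᶜ ∧ insert b (v.erase a) ∉ H) d ?_
    · rw [cv] at this; exact this
    · intro a ha
      refine le_trans (card_le_card ?_) (hD.d2 (v.erase a) (by rw [card_erase_add_one ha, cv]))
      intro b; simp only [mem_filter]; tauto
  have c4 : By.card ≤ k * d := by
    have := card_prod_filter_le' (univ : Finset (Fin (2*k+1))) (nb v z)
      (fun a b => a ∈ ((nb v z).erase b)ᶜ ∧ insert a ((nb v z).erase b) ∉ H) d ?_
    · rw [cv'] at this; exact this
    · intro a ha
      refine le_trans (card_le_card ?_) (hD.d2 ((nb v z).erase a) (by rw [card_erase_add_one ha, cv']))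
      intro b; simp only [mem_filter]; tauto
  have hsub : (v \ Z) ×ˢ (nb v z \ Z) ⊆ good2 H Z (v, z) ∪ (Bw ∪ (Bw2 ∪ (Bx ∪ By))) := by
    rintro ⟨a, b⟩ h
    have h' := h
    simp only [mem_product, Finset.mem_sdiff] at h
    obtain ⟨⟨hav, haZ⟩, hbv, hbZ⟩ := h
    have hbv' : b ∉ v ∧ b ≠ z := by simp [nb] at hbv; tauto
    have haz : a ≠ z := by rintro rfl; exact hz hav
    have hab : a ≠ b := by rintro rfl; exact hbv'.1 hav
    have m1 : a ∈ (nb v z)ᶜ := by rw [nb_compl]; exact mem_insert_of_mem hav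
    have m2 : a ∉ nb v z := by simpa using m1
    have ey := y_eq hav hz hbv
    have ex := x_eq hav hbv'.1
    rw [ex] at ey
    simp only [mem_union, good2, mem_filter, hBw, hBw2, hBx, hBy, mem_product, h', mem_univ, true_and,
      mem_compl, mem_erase, ex, ey, hav, hbv, hbv'.1, m2]
    tauto
  have h0 := card_le_card hsub
  have g2 := card_union_le (good2 H Z (v, z)) (Bw ∪ (Bw2 ∪ (Bx ∪ By)))
  have g3 := card_union_le Bw (Bw2 ∪ (Bx ∪ By))
  have g4 := card_union_le Bw2 (Bx ∪ By)
  have g5 := card_union_le Bx By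
  rw [card_product] at h0
  have k1 : k - 1 ≤ (v \ Z).card := by have := le_card_sdiff Z v; omega
  have k2 : k - 1 ≤ (nb v z \ Z).card := by have := le_card_sdiff Z (nb v z); omega
  have k3 : (k-1)^2 ≤ (v \ Z).card * (nb v z \ Z).card := by rw [sq]; exact Nat.mul_le_mul k1 k2
  omega

set_option maxHeartbeats 2000000 in
lemma cmp2 (hD : DD H d) (hZ : Z.card ≤ 1) :
    (E2 H G Z).card * ((k - 1)^2 - 4 * (k * d)) ≤ d * k * (2 * (E1 H G Z).card + 3 * (E0 H G Z).card) := by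
  set T := (E2 H G Z).sigma (good2 H Z) with hT
  have hT1 : (E2 H G Z).card * ((k - 1)^2 - 4 * (k * d)) ≤ T.card := by
    rw [hT, card_sigma, ← smul_eq_mul]
    exact card_nsmul_le_sum _ _ _ fun e he => good2_card hD hZ e he
  have key : ∀ v z a b, (⟨(v, z), (a, b)⟩ : Σ _ : Finset (Fin (2*k+1)) × Fin (2*k+1), Fin (2*k+1) × Fin (2*k+1)) ∈ T →
      v ∈ Kn k ∧ z ∉ v ∧ z ∉ Z ∧ v ∉ H ∧ nb v z ∉ H ∧ mono G v z ∧ a ∈ v ∧ a ∉ Z ∧ b ∈ nb v z ∧ b ∉ Z ∧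
      nb v b ∈ H ∧ nb (nb v b) a ∈ H ∧ nb (nb (nb v b) a) z ∈ H ∧ nb (nb v z) a ∈ H ∧
      b ∉ v ∧ b ≠ z ∧ a ≠ z ∧ a ≠ b ∧ nb (nb (nb v b) a) z = nb (nb (nb v z) a) b := by
    intro v z a b hτ
    simp only [hT, mem_sigma, E2, good2, mem_filter, mem_product, mem_univ, and_true, Finset.mem_sdiff] at hτ
    obtain ⟨⟨hv, hz, hzZ, h1, h2, hm⟩, ⟨⟨hav, haZ⟩, hbv, hbZ⟩, g1, g2, g3, g4⟩ := hτ
    have hbv' : b ∉ v ∧ b ≠ z := by simp [nb] at hbv; tauto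
    have haz : a ≠ z := by rintro rfl; exact hz hav
    have hab : a ≠ b := by rintro rfl; exact hbv'.1 hav
    refine ⟨hv, hz, hzZ, h1, h2, hm, hav, haZ, hbv, hbZ, g1, g2, g3, g4, hbv'.1, hbv'.2, haz, hab, ?_⟩
    rw [y_eq hav hz hbv, x_eq (v := nb (v) z) hbv (by simp [nb, hav])]
  set Ta := T.filter (fun τ => mono G τ.1.1 τ.2.2) with hTa
  set Tb := T.filter (fun τ => mono G (nb τ.1.1 τ.2.2) τ.2.1) with hTb
  set Tc := T.filter (fun τ => mono G (nb (nb τ.1.1 τ.2.2) τ.2.1) τ.1.2) with hTc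
  set Td := T.filter (fun τ => mono G (nb (nb τ.1.1 τ.1.2) τ.2.1) τ.2.2) with hTd
  set Te := T.filter (fun τ => mono G (nb τ.1.1 τ.1.2) τ.2.1) with hTe
  have hcov : T ⊆ Ta ∪ (Tb ∪ (Tc ∪ (Td ∪ Te))) := by
    rintro ⟨⟨v, z⟩, a, b⟩ hτ
    obtain ⟨hv, hz, hzZ, h1, h2, hm, hav, haZ, hbv, hbZ, g1, g2, g3, g4, hb, hbz, haz, hab, e⟩ := key v z a b hτ
    simp only [hTa, hTb, hTc, hTd, hTe, mem_union, mem_filter, hτ, true_and]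
    unfold mono at *
    rw [e]
    tauto
  have ba : Ta.card ≤ d * k * (E1 H G Z).card := by
    refine fib_count Ta (E1 H G Z) (fun τ => (τ.1.1, τ.2.2)) (fun τ => τ.1.2) (fun τ => τ.2.1)
      (fun e z a => ⟨(e.1, z), (a, e.2)⟩) (fun e => (e.1ᶜ).filter (fun t => nb e.1 t ∉ H))
      (fun e _ => e.1) d k ?_ ?_ ?_
    · rintro ⟨w, c⟩ he
      simp only [E1, mem_filter, mem_product] at he
      exact hD.d1 _ he.1.1
    · rintro ⟨w, c⟩ he x hx
      simp only [E1, mem_filter, mem_product] at he hx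
      exact (mem_Kn.1 he.1.1).le
    · rintro ⟨⟨v, z⟩, a, b⟩ hτ
      simp only [hTa, mem_filter] at hτ
      obtain ⟨hv, hz, hzZ, h1, h2, hm, hav, haZ, hbv, hbZ, g1, g2, g3, g4, hb, hbz, haz, hab, e⟩ := key v z a b hτ.1
      simp only [E1, mem_filter, mem_product, mem_univ, and_true, mem_compl]
      exact ⟨⟨hv, hb, hbZ, h1, g1, hτ.2⟩, ⟨hz, h2⟩, hav⟩
  have be : Te.card ≤ d * k * (E1 H G Z).card := by
    refine fib_count Te (E1 H G Z) (fun τ => (nb τ.1.1 τ.1.2, τ.2.1)) (fun τ => τ.1.2) (fun τ => τ.2.2)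
      (fun e z b => ⟨(nb e.1 z, z), (e.2, b)⟩) (fun e => (e.1ᶜ).filter (fun t => nb e.1 t ∉ H))
      (fun e _ => e.1) d k ?_ ?_ ?_
    · rintro ⟨w, c⟩ he
      simp only [E1, mem_filter, mem_product] at he
      exact hD.d1 _ he.1.1
    · rintro ⟨w, c⟩ he x hx
      simp only [E1, mem_filter, mem_product] at he hx
      exact (mem_Kn.1 he.1.1).le
    · rintro ⟨⟨v, z⟩, a, b⟩ hτ
      simp only [hTe, mem_filter] at hτ
      obtain ⟨hv, hz, hzZ, h1, h2, hm, hav, haZ, hbv, hbZ, g1, g2, g3, g4, hb, hbz, haz, hab, e⟩ := key v z a b hτ.1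
      have r : nb (nb v z) z = v := nb_nb (by simpa using hz)
      simp only [E1, mem_filter, mem_product, mem_univ, and_true, r]
      exact ⟨⟨nb_mem hv (by simpa using hz), by simp [nb, hav], haZ, h2, g4, hτ.2⟩, ⟨label_mem, h1⟩, hbv⟩
  have bb : Tb.card ≤ d * k * (E0 H G Z).card := by
    refine fib_count Tb (E0 H G Z) (fun τ => (nb τ.1.1 τ.2.2, τ.2.1)) (fun τ => τ.2.2) (fun τ => τ.1.2)
      (fun e b z => ⟨(nb e.1 b, z), (e.2, b)⟩) (fun e => (e.1ᶜ).filter (fun t => nb e.1 t ∉ H))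
      (fun e _ => e.1) d k ?_ ?_ ?_
    · rintro ⟨w, c⟩ he
      simp only [E0, mem_filter, mem_product] at he
      exact hD.d1 _ he.1.1
    · rintro ⟨w, c⟩ he x hx
      simp only [E0, mem_filter, mem_product] at he hx
      exact (mem_Kn.1 he.1.1).le
    · rintro ⟨⟨v, z⟩, a, b⟩ hτ
      simp only [hTb, mem_filter] at hτ
      obtain ⟨hv, hz, hzZ, h1, h2, hm, hav, haZ, hbv, hbZ, g1, g2, g3, g4, hb, hbz, haz, hab, e⟩ := key v z a b hτ.1
      have r : nb (nb v b) b = v := nb_nb (by simpa using hb)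
      simp only [E0, mem_filter, mem_product, mem_univ, and_true, r]
      exact ⟨⟨hD.sub g1, by simp [nb, hav], haZ, g1, g2, hτ.2⟩, ⟨label_mem, h1⟩, by simp [nb, hz, hbz.symm]⟩
  have bd : Td.card ≤ d * k * (E0 H G Z).card := by
    refine fib_count Td (E0 H G Z) (fun τ => (nb (nb τ.1.1 τ.1.2) τ.2.1, τ.2.2)) (fun τ => τ.2.1) (fun τ => τ.1.2)
      (fun e a z => ⟨(nb (nb e.1 a) z, z), (a, e.2)⟩) (fun e => (e.1ᶜ).filter (fun t => nb e.1 t ∉ H))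
      (fun e _ => e.1) d k ?_ ?_ ?_
    · rintro ⟨w, c⟩ he
      simp only [E0, mem_filter, mem_product] at he
      exact hD.d1 _ he.1.1
    · rintro ⟨w, c⟩ he x hx
      simp only [E0, mem_filter, mem_product] at he hx
      exact (mem_Kn.1 he.1.1).le
    · rintro ⟨⟨v, z⟩, a, b⟩ hτ
      simp only [hTd, mem_filter] at hτ
      obtain ⟨hv, hz, hzZ, h1, h2, hm, hav, haZ, hbv, hbZ, g1, g2, g3, g4, hb, hbz, haz, hab, e⟩ := key v z a b hτ.1
      have r : nb (nb v z) z = v := nb_nb (by simpa using hz)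
      have r2 : nb (nb (nb v z) a) a = nb v z := nb_nb (by simp [nb, hav])
      have m : z ∈ nb (nb v z) a := by rw [nb_nb_eq]; simp [haz.symm]
      have m2 : b ∉ nb (nb v z) a := by rw [nb_nb_eq]; simp [hb, hbz]
      rw [e] at g3
      simp only [E0, mem_filter, mem_product, mem_univ, and_true, r2, r]
      exact ⟨⟨hD.sub g4, m2, hbZ, g4, g3, hτ.2⟩, ⟨label_mem, h2⟩, m⟩
  have bc : Tc.card ≤ k * d * (E0 H G Z).card := by
    refine fib_count Tc (E0 H G Z) (fun τ => (nb (nb τ.1.1 τ.2.2) τ.2.1, τ.1.2)) (fun τ => τ.2.2) (fun τ => τ.2.1)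
      (fun e b a => ⟨(insert a (e.1.erase b), e.2), (a, b)⟩) (fun e => e.1)
      (fun e b => ((e.1.erase b)ᶜ).filter (fun a => insert a (e.1.erase b) ∉ H)) k d ?_ ?_ ?_
    · rintro ⟨w, c⟩ he
      simp only [E0, mem_filter, mem_product] at he
      exact (mem_Kn.1 he.1.1).le
    · rintro ⟨w, c⟩ he x hx
      simp only [E0, mem_filter, mem_product] at he hx
      exact hD.d2 _ (by rw [card_erase_add_one hx]; exact mem_Kn.1 he.1.1)
    · rintro ⟨⟨v, z⟩, a, b⟩ hτ
      simp only [hTc, mem_filter] at hτ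
      obtain ⟨hv, hz, hzZ, h1, h2, hm, hav, haZ, hbv, hbZ, g1, g2, g3, g4, hb, hbz, haz, hab, e⟩ := key v z a b hτ.1
      have ex := x_eq hav hb
      have e2 : (insert b (v.erase a)).erase b = v.erase a := erase_insert (by simp [hb])
      have r : insert a ((nb (nb v b) a).erase b) = v := by
        rw [ex, e2, insert_erase hav]
      have m1 : z ∉ nb (nb v b) a := by rw [ex]; simp [hbz.symm, hz]
      simp only [E0, mem_filter, mem_product, mem_univ, and_true, r]
      refine ⟨⟨hD.sub g2, m1, hzZ, g2, g3, hτ.2⟩, ?_, ⟨?_, h1⟩⟩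
      · rw [ex]; simp
      · rw [ex, e2]; simp
  have h0 := card_le_card hcov
  have h2 := card_union_le Ta (Tb ∪ (Tc ∪ (Td ∪ Te)))
  have h3 := card_union_le Tb (Tc ∪ (Td ∪ Te))
  have h4 := card_union_le Tc (Td ∪ Te)
  have h5 := card_union_le Td Te
  have e : k * d * (E0 H G Z).card = d * k * (E0 H G Z).card := by ring
  rw [e] at bc
  have : d * k * (2 * (E1 H G Z).card + 3 * (E0 H G Z).card) =
    2 * (d * k * (E1 H G Z).card) + 3 * (d * k * (E0 H G Z).card) := by ring
  rw [this]; omega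

end Compare2


section Compare3
open Finset
variable {k : ℕ} {H G F : Finset (Finset (Fin (2*k+1)))} {Z : Finset (Fin (2*k+1))} {d : ℕ}

lemma cmp_total (hD : DD H d) (hZ : Z.card ≤ 1) (hM : Maj H G Z) (hk : (10:ℝ)^7 ≤ k)
    (hd : (d:ℝ) ≤ k / 10^5) :
    ((EA G Z).card : ℝ) ≤ (1 + 25 / 10^5) * (E0 H G Z).card := by
  have h1 := cmp1 hD hZ hM
  have h2 := cmp2 (G := G) hD hZ
  have h0 := EA_card H G Z
  have h1' : ((E1 H G Z).card : ℝ) * ((k:ℝ) - d) * ((k:ℝ) - 1 - 3 * d) ≤ 8 * (d * (k+1)) * (E0 H G Z).card := by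
    have a : ((k:ℝ) - d) ≤ ((k - d : ℕ) : ℝ) := by
      have : k ≤ (k - d) + d := by omega
      have : (k:ℝ) ≤ ((k - d : ℕ) : ℝ) + d := by exact_mod_cast this
      linarith
    have b : ((k:ℝ) - 1 - 3 * d) ≤ ((k - 1 - 3 * d : ℕ) : ℝ) := by
      have : k ≤ (k - 1 - 3 * d) + 1 + 3 * d := by omega
      have : (k:ℝ) ≤ ((k - 1 - 3 * d : ℕ) : ℝ) + 1 + 3 * d := by exact_mod_cast this
      linarith
    have c : ((E1 H G Z).card : ℝ) * ((k - d : ℕ) : ℝ) * ((k - 1 - 3 * d : ℕ) : ℝ) ≤ 8 * (d * (k+1)) * (E0 H G Z).card := by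
      exact_mod_cast h1
    refine le_trans ?_ c
    have : 0 ≤ (k:ℝ) - 1 - 3 * d := by linarith
    gcongr
  have h2' : ((E2 H G Z).card : ℝ) * (((k:ℝ) - 1)^2 - 4 * (k * d)) ≤ d * k * (2 * (E1 H G Z).card + 3 * (E0 H G Z).card) := by
    have b : (((k:ℝ) - 1)^2 - 4 * (k * d)) ≤ (((k - 1)^2 - 4 * (k * d) : ℕ) : ℝ) := by
      have : (k-1)^2 ≤ ((k - 1)^2 - 4 * (k * d)) + 4 * (k * d) := by omega
      have h : (((k-1:ℕ):ℝ))^2 ≤ (((k - 1)^2 - 4 * (k * d) : ℕ) : ℝ) + 4 * (k * d) := by exact_mod_cast this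
      have hk1 : 1 ≤ k := by
        have : (1:ℝ) ≤ k := by linarith
        exact_mod_cast this
      rw [Nat.cast_sub hk1] at h
      push_cast at h; linarith
    have c : ((E2 H G Z).card : ℝ) * (((k - 1)^2 - 4 * (k * d) : ℕ) : ℝ) ≤ d * k * (2 * (E1 H G Z).card + 3 * (E0 H G Z).card) := by
      exact_mod_cast h2
    refine le_trans ?_ c
    gcongr
  have h0' : ((EA G Z).card : ℝ) = (E0 H G Z).card + 2 * (E1 H G Z).card + (E2 H G Z).card := by exact_mod_cast h0
  rw [h0']
  have p0 : (0:ℝ) ≤ (E0 H G Z).card := Nat.cast_nonneg _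
  have p1 : (0:ℝ) ≤ (E1 H G Z).card := Nat.cast_nonneg _
  have p2 : (0:ℝ) ≤ (E2 H G Z).card := Nat.cast_nonneg _
  generalize ((E0 H G Z).card : ℝ) = B0 at *
  generalize ((E1 H G Z).card : ℝ) = B1 at *
  generalize ((E2 H G Z).card : ℝ) = B2 at *
  have pd : (0:ℝ) ≤ d := Nat.cast_nonneg _
  generalize (d:ℝ) = δ at *
  generalize (k:ℝ) = κ at *
  have hκ : 0 < κ := by linarith
  have q1 : B1 ≤ 9 / 10^5 * B0 := by
    have l1 : (999/1000) * κ^2 ≤ (κ - δ) * (κ - 1 - 3 * δ) := by nlinarith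
    have l2 : 8 * (δ * (κ + 1)) ≤ 8.1 / 10^5 * κ^2 := by nlinarith
    have l3 : B1 * ((999/1000) * κ^2) ≤ (8.1/10^5 * κ^2) * B0 := by
      calc B1 * ((999/1000) * κ^2) ≤ B1 * ((κ - δ) * (κ - 1 - 3 * δ)) := by gcongr
        _ = B1 * (κ - δ) * (κ - 1 - 3 * δ) := by ring
        _ ≤ _ := h1'
        _ ≤ _ := by gcongr
    have l4 : κ^2 * ((999/1000) * B1) ≤ κ^2 * (8.1/10^5 * B0) := by linarith
    have := le_of_mul_le_mul_left l4 (by positivity)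
    linarith
  have q2 : B2 ≤ 4 / 10^5 * B0 := by
    have l1 : (999/1000) * κ^2 ≤ (κ - 1)^2 - 4 * (κ * δ) := by nlinarith
    have l2 : δ * κ ≤ 1 / 10^5 * κ^2 := by nlinarith
    have l3 : B2 * ((999/1000) * κ^2) ≤ (1/10^5 * κ^2) * (3.1 * B0) := by
      calc B2 * ((999/1000) * κ^2) ≤ B2 * ((κ - 1)^2 - 4 * (κ * δ)) := by gcongr
        _ ≤ _ := h2'
        _ ≤ (1/10^5 * κ^2) * (2 * B1 + 3 * B0) := by gcongr
        _ ≤ _ := by gcongr; linarith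
    have l4 : κ^2 * ((999/1000) * B2) ≤ κ^2 * (3.1/10^5 * B0) := by linarith
    have := le_of_mul_le_mul_left l4 (by positivity)
    linarith
  linarith

lemma exists_maj (hH : H ⊆ Kn k) (hF : F ⊆ H) (Z : Finset (Fin (2*k+1))) :
    ∃ G, G ⊆ Kn k ∧ (∀ v ∈ H, v ∈ G ↔ v ∈ F) ∧ Maj H G Z := by
  set c1 : Finset (Fin (2*k+1)) → Finset (Fin (2*k+1)) :=
    fun v => (vᶜ).filter (fun t => t ∉ Z ∧ nb v t ∈ H ∧ nb v t ∈ F) with hc1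
  set c2 : Finset (Fin (2*k+1)) → Finset (Fin (2*k+1)) :=
    fun v => (vᶜ).filter (fun t => t ∉ Z ∧ nb v t ∈ H ∧ nb v t ∉ F) with hc2
  set G := F ∪ (Kn k).filter (fun v => v ∉ H ∧ (c1 v).card ≤ (c2 v).card) with hG
  have hGH : ∀ v ∈ H, v ∈ G ↔ v ∈ F := by
    intro v hv
    simp only [hG, mem_union, mem_filter]; tauto
  refine ⟨G, ?_, hGH, ?_⟩
  · intro v hv
    simp only [hG, mem_union, mem_filter] at hv
    rcases hv with h | h
    · exact hH (hF h)
    · exact h.1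
  · intro v hv hvH
    have hvF : v ∉ F := fun h => hvH (hF h)
    by_cases h : (c1 v).card ≤ (c2 v).card
    · have hvG : v ∈ G := by simp only [hG, mem_union, mem_filter]; tauto
      have e1 : (vᶜ).filter (fun t => t ∉ Z ∧ nb v t ∈ H ∧ mono G v t) = c1 v := by
        refine filter_congr fun t _ => ?_
        unfold mono
        have := hGH (nb v t); tauto
      have e2 : (vᶜ).filter (fun t => t ∉ Z ∧ nb v t ∈ H ∧ ¬ mono G v t) = c2 v := by
        refine filter_congr fun t _ => ?_
        unfold mono
        have := hGH (nb v t); tauto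
      rw [e1, e2]; exact h
    · have hvG : v ∉ G := by simp only [hG, mem_union, mem_filter]; tauto
      have e1 : (vᶜ).filter (fun t => t ∉ Z ∧ nb v t ∈ H ∧ mono G v t) = c2 v := by
        refine filter_congr fun t _ => ?_
        unfold mono
        have := hGH (nb v t); tauto
      have e2 : (vᶜ).filter (fun t => t ∉ Z ∧ nb v t ∈ H ∧ ¬ mono G v t) = c1 v := by
        refine filter_congr fun t _ => ?_
        unfold mono
        have := hGH (nb v t); tauto
      rw [e1, e2]; omega

lemma E0_congr (h : ∀ v ∈ H, v ∈ G ↔ v ∈ F) : E0 H G Z = E0 H F Z := by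
  refine filter_congr fun e _ => ?_
  unfold mono
  have h1 := h e.1
  have h2 := h (nb e.1 e.2)
  tauto

/-- number of label `z` edges inside/outside `G` -/
lemma phase1_pm (hk : 2 ≤ k) (G : Finset (Finset (Fin (2*k+1)))) (γ : ℝ) (hγ : 0 < γ) (hγ1 : γ < 1/3)
    (hm : ((EA G ∅).card : ℝ) ≤ (Kn k).card / 2 * (1 + γ)) :
    ∃ z, ((2*k).choose k : ℝ) * (1 - 3*γ) ≤ ((Kn k).filter (fun v => z ∉ v ∧ v ∈ G ∧ nb v z ∈ G)).card ∨
      ((2*k).choose k : ℝ) * (1 - 3*γ) ≤ ((Kn k).filter (fun v => z ∉ v ∧ v ∉ G ∧ nb v z ∉ G)).card := by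
  set f : Finset (Fin (2*k+1)) → ℝ := fun v => if v ∈ G then 1 else -1 with hf
  set P : ℝ := ((2*k).choose k : ℝ) with hP
  have hP0 : 0 < P := by rw [hP]; exact_mod_cast (Nat.choose_pos (by omega))
  set mp : Fin (2*k+1) → ℝ := fun z => ((Kn k).filter (fun v => z ∉ v ∧ v ∈ G ∧ nb v z ∈ G)).card with hmp
  set mm : Fin (2*k+1) → ℝ := fun z => ((Kn k).filter (fun v => z ∉ v ∧ v ∉ G ∧ nb v z ∉ G)).card with hmm
  have hp0 : ∀ z, 0 ≤ mp z := fun z => Nat.cast_nonneg _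
  have hm0 : ∀ z, 0 ≤ mm z := fun z => Nat.cast_nonneg _
  have hQ : ∀ z, Qz f z = 4 * (mp z + mm z) := by
    intro z
    simp only [Qz, hmp, hmm, card_filter, sum_filter]
    push_cast
    rw [← sum_add_distrib, mul_sum]
    refine sum_congr rfl fun v _ => ?_
    by_cases h1 : z ∈ v <;> by_cases h2 : v ∈ G <;> by_cases h3 : nb v z ∈ G <;> simp [hf, h1, h2, h3] <;> norm_num
  have hL : ∀ z, Lz f z = 2 * (mp z - mm z) := by
    intro z
    simp only [Lz, hmp, hmm, card_filter, sum_filter]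
    push_cast
    rw [← sum_sub_distrib, mul_sum]
    refine sum_congr rfl fun v _ => ?_
    by_cases h1 : z ∈ v <;> by_cases h2 : v ∈ G <;> by_cases h3 : nb v z ∈ G <;> simp [hf, h1, h2, h3] <;> norm_num
  have hle : ∀ z, mp z + mm z ≤ P := by
    intro z
    have : P = (((Kn k).filter (fun v => z ∉ v)).card : ℝ) := by rw [card_notMem_Kn]
    rw [this]
    simp only [hmp, hmm, card_filter]
    push_cast
    rw [← sum_add_distrib]
    refine sum_le_sum fun v _ => ?_
    by_cases h1 : z ∈ v <;> by_cases h2 : v ∈ G <;> by_cases h3 : nb v z ∈ G <;> simp [h1, h2, h3]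
  have hBF : BF f f = 4 * (EA G ∅).card := by
    simp only [BF, EA, card_filter, sum_product]
    push_cast
    rw [mul_sum]
    refine sum_congr rfl fun v _ => ?_
    rw [mul_sum]
    have : vᶜ = univ.filter (fun t => t ∉ v) := by ext; simp
    rw [this, sum_filter]
    refine sum_congr rfl fun t _ => ?_
    unfold mono
    by_cases h1 : t ∈ v <;> by_cases h2 : v ∈ G <;> by_cases h3 : nb v t ∈ G <;> simp [hf, h1, h2, h3] <;> norm_num
  have hff : ∑ v ∈ Kn k, f v ^ 2 = (Kn k).card := by
    have : ∀ v ∈ Kn k, f v ^ 2 = 1 := by intro v _; simp only [hf]; split_ifs <;> norm_num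
    rw [sum_congr rfl this]; simp
  have hS := phase1_spectral hk f
  rw [hff, hBF] at hS
  have hB2 := BF_eq_Qz f
  rw [hBF] at hB2
  simp only [hQ, hL] at hS hB2
  have hMP : 3/2 * P ≤ (Kn k).card ∧ ((Kn k).card : ℝ) ≤ 2 * P := by
    have : ((k:ℝ)+1) * (Kn k).card = (2*k+1) * P := by rw [hP]; exact_mod_cast card_Kn_mul k
    have hk' : (2:ℝ) ≤ k := by exact_mod_cast hk
    constructor <;> nlinarith
  have hterm : ∀ z, 0 ≤ 4 * (mp z + mm z) - (2 * (mp z - mm z))^2 / P := by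
    intro z
    rw [sub_nonneg, div_le_iff₀ hP0]
    nlinarith [hle z, hp0 z, hm0 z, mul_nonneg (hp0 z) (hm0 z), mul_nonneg (add_nonneg (hp0 z) (hm0 z)) (sub_nonneg.2 (hle z))]
  have hlow : 2 * ((Kn k).card : ℝ) ≤ ∑ z, 4 * (mp z + mm z) := by
    have := sum_nonneg (fun z (_ : z ∈ (univ : Finset (Fin (2*k+1)))) => hterm z)
    have h2 := this.trans hS
    rw [← hB2]; linarith
  by_contra hcon
  push Not at hcon
  have hall : ∀ z, 3 * γ * (4 * (mp z + mm z)) ≤ 4 * (mp z + mm z) - (2 * (mp z - mm z))^2 / P := by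
    intro z
    obtain ⟨a1, a2⟩ := hcon z
    have a1 : mp z < P * (1 - 3*γ) := a1
    have a2 : mm z < P * (1 - 3*γ) := a2
    have b1 := hp0 z; have b2 := hm0 z
    have : (2 * (mp z - mm z))^2 / P ≤ (1 - 3*γ) * (4 * (mp z + mm z)) := by
      rw [div_le_iff₀ hP0]
      have c1 : mp z * mp z ≤ mp z * (P * (1 - 3*γ)) := mul_le_mul_of_nonneg_left a1.le b1
      have c2 : mm z * mm z ≤ mm z * (P * (1 - 3*γ)) := mul_le_mul_of_nonneg_left a2.le b2
      nlinarith [mul_nonneg b1 b2]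
    linarith
  have hsum := sum_le_sum (fun z (_ : z ∈ (univ : Finset (Fin (2*k+1)))) => hall z)
  rw [← mul_sum] at hsum
  have h4 := hsum.trans hS
  have h5 : 3 * γ * (2 * ((Kn k).card : ℝ)) ≤ 3 * γ * ∑ z, 4 * (mp z + mm z) := by gcongr
  nlinarith [hMP.1, mul_pos hγ hP0]

end Compare3


section Iso
open Finset

lemma iso_abs {α : Type*} [DecidableEq α] (Ω : Finset α) (m : ℕ) (hΩ : Ω.card = 2*(m+1))
    (f β : Finset α → ℝ) (hf : ∀ v, f v ^ 2 = f v) (a : ℝ)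
    (ha : a = ∑ w ∈ Ω.powersetCard (m+1), f w) :
    2 * (m+1) / (m+2) * (a - a^2 / ((2*(m+1)).choose (m+1) : ℕ)) ≤
      ∑ w ∈ Ω.powersetCard (m+1), ∑ t ∈ w, (f w - β (w.erase t))^2 := by
  set P : ℝ := (((2*(m+1)).choose (m+1) : ℕ) : ℝ) with hP
  have hPpos : 0 < P := by
    rw [hP]; exact_mod_cast Nat.choose_pos (by omega)
  have hcardP : ((Ω.powersetCard (m+1)).card : ℝ) = P := by
    rw [card_powersetCard, hΩ]
  have hcardQ : ((Ω.powersetCard m).card : ℝ) * (m+2) = P * (m+1) := by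
    rw [card_powersetCard, hΩ, hP]
    have := Nat.choose_succ_right_eq (2*(m+1)) m
    have h2 : 2*(m+1) - m = m+2 := by omega
    rw [h2] at this
    exact_mod_cast this.symm
  set c := a / P with hc
  set f0 : Finset α → ℝ := fun v => f v - c with hf0
  have horth : Orth Ω 0 (0+m+1) f0 := by
    intro s hs
    rw [powersetCard_zero, mem_singleton] at hs
    subst hs
    simp only [empty_subset, filter_true, zero_add, hf0, sum_sub_distrib, sum_const, nsmul_eq_mul]
    rw [← ha, hcardP, hc]; field_simp; ring
  have hD := nsq_D_le Ω 0 m f0 (by omega) horth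
  have hO := orth_D Ω 0 (0+m) f0 horth ∅ (by simp)
  simp only [empty_subset, filter_true, zero_add] at hO hD
  have hsq : ∑ w ∈ Ω.powersetCard (m+1), f w ^2 = a := by
    rw [ha]; exact sum_congr rfl fun v _ => hf v
  have hn0 : nsq Ω (m+1) f0 = a - a^2/P := by
    simp only [nsq, hf0, sub_sq, sum_add_distrib, sum_sub_distrib, ← mul_sum, ← sum_mul, sum_const, nsmul_eq_mul]
    rw [hsq, hcardP, ← ha, hc]; field_simp; ring
  have hDf : ∀ u ∈ Ω.powersetCard m, opD Ω f u = (m+2) * c + opD Ω f0 u := by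
    intro u hu
    rw [mem_powersetCard] at hu
    simp only [opD, hf0, sum_sub_distrib, sum_const, nsmul_eq_mul]
    rw [card_sdiff_of_subset hu.1, hΩ, hu.2]
    rw [show 2*(m+1) - m = m+2 by omega]; push_cast; ring
  have hnD : nsq Ω m (opD Ω f) = (m+2)*(m+1)*(a^2/P) + nsq Ω m (opD Ω f0) := by
    have : nsq Ω m (opD Ω f) = ∑ u ∈ Ω.powersetCard m, ((m+2) * c + opD Ω f0 u)^2 :=
      sum_congr rfl fun u hu => by rw [hDf u hu]
    rw [this]
    simp only [add_sq, sum_add_distrib, ← mul_sum, sum_const, nsmul_eq_mul, hO, nsq]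
    have : ((Ω.powersetCard m).card : ℝ) * ((m+2)*c)^2 = (P * (m+1)) * ((m+2)*c^2) := by
      rw [← hcardQ]; ring
    rw [this, hc]; field_simp; ring
  have hexp : ∑ w ∈ Ω.powersetCard (m+1), ∑ t ∈ w, (f w - β (w.erase t))^2 =
      (m+1) * a + ∑ u ∈ Ω.powersetCard m, ((m+2) * β u^2 - 2 * (opD Ω f u * β u)) := by
    have h1 := sum_flag Ω m (fun u _ => β u ^2)
    have h2 := ud_adj Ω m f β
    rw [sum_sub_distrib, ← mul_sum (f := fun u => opD Ω f u * β u), h2]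
    have h3 : ∑ u ∈ Ω.powersetCard m, ∑ i ∈ Ω \ u, β u ^2 = ∑ u ∈ Ω.powersetCard m, (m+2) * β u^2 := by
      refine sum_congr rfl fun u hu => ?_
      rw [mem_powersetCard] at hu
      rw [sum_const, card_sdiff_of_subset hu.1, hΩ, hu.2, show 2*(m+1) - m = m+2 by omega, nsmul_eq_mul]
      push_cast; ring
    rw [← h3, h1, ← hsq, mul_sum, mul_sum, ← sum_sub_distrib, ← sum_add_distrib]
    refine sum_congr rfl fun w hw => ?_
    rw [mem_powersetCard] at hw
    simp only [sub_sq, sum_add_distrib, sum_sub_distrib, sum_const, nsmul_eq_mul, opU, hw.2, mul_sum]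
    push_cast
    have : ∑ x ∈ w, 2 * f w * β (w.erase x) = ∑ x ∈ w, 2 * (f w * β (w.erase x)) :=
      sum_congr rfl fun x _ => by ring
    rw [this]; ring
  have hlow : -(nsq Ω m (opD Ω f) / (m+2)) ≤ ∑ u ∈ Ω.powersetCard m, ((m+2) * β u^2 - 2 * (opD Ω f u * β u)) := by
    rw [nsq, sum_div, ← sum_neg_distrib]
    refine sum_le_sum fun u _ => ?_
    have hm : (0:ℝ) < m+2 := by positivity
    have : (m+2) * β u^2 - 2 * (opD Ω f u * β u) - -(opD Ω f u^2/(m+2)) = ((m+2) * β u - opD Ω f u)^2/(m+2) := by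
      field_simp; ring
    have h2 : 0 ≤ ((m+2) * β u - opD Ω f u)^2/(m+2) := by positivity
    linarith
  rw [hexp]
  rw [hn0, hΩ] at hD
  have hm : (0:ℝ) < m+2 := by positivity
  have hup : nsq Ω m (opD Ω f) / (m+2) ≤ ((m+2)*(m+1)*(a^2/P) + m * (m+1) * (a - a^2/P)) / (m+2) := by
    rw [hnD]
    gcongr
    refine hD.trans (le_of_eq ?_)
    push_cast; ring
  have hfin : 2 * (m+1) / (m+2) * (a - a^2 / P) = (m+1) * a - ((m+2)*(m+1)*(a^2/P) + m * (m+1) * (a - a^2/P)) / (m+2) := by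
    field_simp; ring
  rw [hfin]; linarith

variable {k : ℕ}

lemma EA_half (G : Finset (Finset (Fin (2*k+1)))) (z : Fin (2*k+1)) :
    (EA G {z}).card = 2 * ∑ v ∈ (Kn k).filter (fun v => z ∉ v), ∑ t ∈ (vᶜ).erase z, if mono G v t then 1 else 0 := by
  have h0 : (EA G {z}).card = ∑ v ∈ Kn k, ∑ t ∈ vᶜ, if (t ≠ z ∧ mono G v t) then 1 else 0 := by
    rw [EA, card_filter, sum_product]
    refine sum_congr rfl fun v _ => ?_
    rw [← sum_subset (subset_univ (vᶜ))]
    · refine sum_congr rfl fun t ht => ?_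
      simp only [mem_compl] at ht
      simp [ht]
    · intro t _ ht
      simp only [mem_compl, not_not] at ht
      simp [ht]
  have h1 : ∀ v ∈ Kn k, (∑ t ∈ vᶜ, if (t ≠ z ∧ mono G v t) then 1 else 0) =
      (∑ t ∈ vᶜ, if (z ∉ v ∧ t ≠ z ∧ mono G v t) then 1 else 0) + 
      (∑ t ∈ vᶜ, if (z ∈ v ∧ t ≠ z ∧ mono G v t) then 1 else 0) := by
    intro v _
    by_cases h : z ∈ v <;> simp [h]
  have h2 : ∑ v ∈ Kn k, (∑ t ∈ vᶜ, if (z ∈ v ∧ t ≠ z ∧ mono G v t) then 1 else 0) =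
     ∑ v ∈ Kn k, (∑ t ∈ vᶜ, if (z ∉ v ∧ t ≠ z ∧ mono G v t) then 1 else 0) := by
    rw [← edge_swap (fun v t => if (z ∈ v ∧ t ≠ z ∧ mono G v t) then 1 else 0)]
    refine sum_congr rfl fun v _ => sum_congr rfl fun t ht => ?_
    have ht' : t ∉ v := by simpa using ht
    have hmn := mono_nb (G := G) ht'
    by_cases h : t = z
    · simp [h]
    · have : z ∈ nb v t ↔ z ∉ v := by simp [nb, Ne.symm h]
      simp only [this, hmn]
  rw [h0, sum_congr rfl h1, sum_add_distrib, h2, ← two_mul]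
  congr 1
  rw [sum_filter]
  refine sum_congr rfl fun v _ => ?_
  by_cases h : z ∈ v
  · simp [h]
  · simp only [h, not_false_eq_true, true_and, if_true]
    rw [← sum_filter, ← sum_filter]
    refine sum_congr ?_ fun _ _ => rfl
    ext t; simp; tauto

lemma phase2_iso (hk : 1 ≤ k) (G : Finset (Finset (Fin (2*k+1)))) (z : Fin (2*k+1)) (a : ℝ)
    (ha : a = ((Kn k).filter (fun v => z ∉ v ∧ v ∈ G)).card) :
    4 * k / (k+1) * (a - a^2 / ((2*k).choose k : ℕ)) ≤ (EA G {z}).card := by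
  obtain ⟨m, rfl⟩ : ∃ m, k = m + 1 := ⟨k-1, by omega⟩
  set Ω : Finset (Fin (2*(m+1)+1)) := univ.erase z with hΩ
  have hΩc : Ω.card = 2*(m+1) := by rw [hΩ, card_erase_of_mem (mem_univ _)]; simp
  have key := iso_abs Ω m hΩc (fun w => if Ω \ w ∈ G then 1 else 0) (fun u => if insert z u ∈ G then 0 else 1)
    (fun v => by split_ifs <;> simp) a ?_
  · rw [EA_half]
    push_cast
    have h : ∑ v ∈ (Kn (m+1)).filter (fun v => z ∉ v), ∑ t ∈ (vᶜ).erase z, (if mono G v t then (1:ℝ) else 0) =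
      ∑ w ∈ Ω.powersetCard (m+1), ∑ t ∈ w, ((if Ω \ w ∈ G then (1:ℝ) else 0) - (if insert z (w.erase t) ∈ G then 0 else 1))^2 := by
      rw [filter_notMem_Kn, ← hΩ]
      refine sum_bij' (fun v _ => Ω \ v) (fun v _ => Ω \ v) ?_ ?_ ?_ ?_ ?_
      · intro v hv; rw [mem_powersetCard] at hv ⊢
        refine ⟨sdiff_subset, ?_⟩
        rw [card_sdiff_of_subset hv.1]; omega
      · intro v hv; rw [mem_powersetCard] at hv ⊢
        refine ⟨sdiff_subset, ?_⟩
        rw [card_sdiff_of_subset hv.1]; omega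
      · intro v hv; rw [mem_powersetCard] at hv; exact Finset.sdiff_sdiff_eq_self hv.1
      · intro v hv; rw [mem_powersetCard] at hv; exact Finset.sdiff_sdiff_eq_self hv.1
      · intro v hv
        rw [mem_powersetCard] at hv
        rw [Finset.sdiff_sdiff_eq_self hv.1]
        have e : vᶜ.erase z = Ω \ v := by ext x; simp [hΩ]
        rw [e]
        refine sum_congr rfl fun t ht => ?_
        have e2 : insert z ((Ω \ v).erase t) = nb v t := by
          have hz : z ∉ v := fun h => by simpa [hΩ] using hv.1 h
          have htz : t ≠ z := by rintro rfl; simp [hΩ] at ht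
          ext x; simp only [mem_insert, mem_erase, Finset.mem_sdiff, hΩ, mem_univ, nb, mem_compl, and_true]
          by_cases hx : x = z
          · subst hx; simp [hz, Ne.symm htz]
          · simp [hx]
        rw [e2]
        unfold mono
        by_cases h1 : v ∈ G <;> by_cases h2 : nb v t ∈ G <;> simp [h1, h2]
    rw [h]
    have e : 4 * ((m:ℝ)+1) / (m+1+1) * (a - a^2 / ((2*(m+1)).choose (m+1) : ℕ)) = 2 * (2 * (m+1) / (m+2) * (a - a^2 / ((2*(m+1)).choose (m+1) : ℕ))) := by
      rw [show (m:ℝ)+1+1 = m+2 by ring]; ring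
    rw [e]
    linarith
  · rw [ha, card_filter]
    push_cast
    have : ∀ v ∈ Kn (m+1), (if z ∉ v ∧ v ∈ G then (1:ℝ) else 0) = if z ∉ v then (if v ∈ G then 1 else 0) else 0 := by
      intro v _; by_cases h : z ∈ v <;> simp [h]
    rw [sum_congr rfl this, ← sum_filter, filter_notMem_Kn, ← hΩ]
    refine sum_bij' (fun v _ => Ω \ v) (fun v _ => Ω \ v) ?_ ?_ ?_ ?_ ?_
    · intro v hv; rw [mem_powersetCard] at hv ⊢
      refine ⟨sdiff_subset, ?_⟩
      rw [card_sdiff_of_subset hv.1]; omega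
    · intro v hv; rw [mem_powersetCard] at hv ⊢
      refine ⟨sdiff_subset, ?_⟩
      rw [card_sdiff_of_subset hv.1]; omega
    · intro v hv; rw [mem_powersetCard] at hv; exact Finset.sdiff_sdiff_eq_self hv.1
    · intro v hv; rw [mem_powersetCard] at hv; exact Finset.sdiff_sdiff_eq_self hv.1
    · intro v hv; rw [mem_powersetCard] at hv
      rw [Finset.sdiff_sdiff_eq_self hv.1]

end Iso


section Determ
open Finset
variable {k : ℕ}

/-- edge weights with nearly constant weighted degrees -/
structure WW (H : Finset (Finset (Fin (2*k+1)))) (s : Finset (Fin (2*k+1)) → ℝ) : Prop where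
  s1 : ∀ u ∈ H, (999/1000 : ℝ) / k ≤ s u ∧ s u ≤ (1001/1000 : ℝ) / k
  s2 : ∀ u ∈ H, |(∑ t ∈ uᶜ, if nb u t ∈ H then (s u + s (nb u t)) / 2 else 0) - 1| ≤ (4/100 : ℝ) / k

/-- weighted edge count -/
noncomputable def Dw (s : Finset (Fin (2*k+1)) → ℝ) (X Y : Finset (Finset (Fin (2*k+1)))) : ℝ :=
  ∑ v ∈ Kn k, ∑ t ∈ vᶜ, if v ∈ X ∧ nb v t ∈ Y then (s v + s (nb v t)) / 2 else 0

lemma Dw_symm (s : Finset (Fin (2*k+1)) → ℝ) (X Y : Finset (Finset (Fin (2*k+1)))) :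
    Dw s X Y = Dw s Y X := by
  unfold Dw
  rw [← edge_swap (fun v t => if v ∈ X ∧ nb v t ∈ Y then (s v + s (nb v t)) / 2 else 0)]
  refine sum_congr rfl fun v _ => sum_congr rfl fun t ht => ?_
  rw [nb_nb ht, add_comm (s (nb v t))]
  simp only [and_comm]

lemma Dw_eq (s : Finset (Fin (2*k+1)) → ℝ) {X Y : Finset (Finset (Fin (2*k+1)))} (hX : X ⊆ Kn k) :
    Dw s X Y = ∑ v ∈ X, ∑ t ∈ vᶜ, if nb v t ∈ Y then (s v + s (nb v t)) / 2 else 0 := by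
  unfold Dw
  rw [← sum_subset hX]
  · refine sum_congr rfl fun v hv => ?_
    simp [hv]
  · intro v _ hv; simp [hv]

lemma Dw_add (s : Finset (Fin (2*k+1)) → ℝ) {X Y Y' Y'' : Finset (Finset (Fin (2*k+1)))}
    (h : ∀ v ∈ X, ∀ t ∈ vᶜ, (nb v t ∈ Y ↔ nb v t ∈ Y' ∨ nb v t ∈ Y''))
    (hd : Disjoint Y' Y'') :
    Dw s X Y = Dw s X Y' + Dw s X Y'' := by
  unfold Dw
  simp only [← sum_add_distrib]
  refine sum_congr rfl fun v _ => sum_congr rfl fun t ht => ?_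
  by_cases hv : v ∈ X
  · have := h v hv t ht
    by_cases h1 : nb v t ∈ Y'
    · have h2 : nb v t ∉ Y'' := disjoint_left.1 hd h1
      simp [hv, this, h1, h2]
    · simp [hv, this, h1]
  · simp [hv]

lemma Dw_mono (s : Finset (Fin (2*k+1)) → ℝ) {H X X' Y Y' : Finset (Finset (Fin (2*k+1)))}
    (hs : ∀ u ∈ H, 0 ≤ s u) (hX : X ⊆ X') (hY : Y ⊆ Y') (hX' : X' ⊆ H) (hY' : Y' ⊆ H) :
    Dw s X Y ≤ Dw s X' Y' := by
  unfold Dw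
  refine sum_le_sum fun v _ => sum_le_sum fun t _ => ?_
  by_cases h : v ∈ X ∧ nb v t ∈ Y
  · rw [if_pos h, if_pos ⟨hX h.1, hY h.2⟩]
  · rw [if_neg h]
    split_ifs with h'
    · have := hs _ (hX' h'.1); have := hs _ (hY' h'.2); linarith
    · exact le_rfl

lemma Dw_low (s : Finset (Fin (2*k+1)) → ℝ) {H X Y : Finset (Finset (Fin (2*k+1)))} (c : ℝ)
    (hs : ∀ u ∈ H, c ≤ s u) (hX : X ⊆ H) (hY : Y ⊆ H) :
    c * (∑ v ∈ Kn k, ∑ t ∈ vᶜ, if v ∈ X ∧ nb v t ∈ Y then (1:ℝ) else 0) ≤ Dw s X Y := by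
  unfold Dw
  simp only [mul_sum]
  refine sum_le_sum fun v _ => sum_le_sum fun t _ => ?_
  split_ifs with h'
  · have := hs _ (hX h'.1); have := hs _ (hY h'.2); linarith
  · simp

lemma Dw_deg {H : Finset (Finset (Fin (2*k+1)))} {s : Finset (Fin (2*k+1)) → ℝ} (hW : WW H s)
    (hH : H ⊆ Kn k) {X : Finset (Finset (Fin (2*k+1)))} (hX : X ⊆ H) :
    |Dw s X H - X.card| ≤ (4/100 : ℝ) / k * X.card := by
  rw [Dw_eq s (hX.trans hH)]
  have : (X.card : ℝ) = ∑ v ∈ X, (1:ℝ) := by simp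
  rw [this, ← sum_sub_distrib, mul_sum]
  refine (abs_sum_le_sum_abs _ _).trans (sum_le_sum fun v hv => ?_)
  rw [mul_one]
  exact hW.s2 v (hX hv)

lemma clique_nb {C : Finset (Finset (Fin (2*k+1)))} (hC : IsClique C) {v t} (h : v ∈ C) : nb v t ∉ C := by
  intro h'
  obtain ⟨x, hx⟩ := hC v h _ h'
  simp only [nb, mem_inter, mem_erase, mem_compl] at hx
  exact hx.2.2 hx.1

lemma star_clique (H : Finset (Finset (Fin (2*k+1)))) (x) : IsClique (starOf H x) := by
  intro A hA B hB
  simp only [starOf, mem_filter] at hA hB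
  exact ⟨x, by simp [hA.2, hB.2]⟩

lemma sum_stars {H : Finset (Finset (Fin (2*k+1)))} (hH : H ⊆ Kn k) :
    ∑ x, (starOf H x).card = k * H.card := by
  simp only [starOf, card_filter]
  rw [sum_comm]
  rw [show k * H.card = ∑ v ∈ H, k by rw [sum_const, smul_eq_mul, mul_comm]]
  refine sum_congr rfl fun v hv => ?_
  rw [← card_filter]
  have := mem_Kn.1 (hH hv)
  simpa using this

lemma max_ge {H C : Finset (Finset (Fin (2*k+1)))} (hH : H ⊆ Kn k)
    (hmax : ∀ D ⊆ H, IsClique D → D.card ≤ C.card) : k * H.card ≤ (2*k+1) * C.card := by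
  rw [← sum_stars hH]
  calc ∑ x, (starOf H x).card ≤ ∑ x : Fin (2*k+1), C.card :=
        sum_le_sum fun x _ => hmax _ (filter_subset _ _) (star_clique H x)
    _ = _ := by simp

lemma sum_pairs (Z : Finset (Fin (2*k+1))) (Q : Finset (Fin (2*k+1)) → Fin (2*k+1) → Prop) [∀ v t, Decidable (Q v t)] :
    (((((Kn k) ×ˢ univ).filter (fun e : Finset (Fin (2*k+1)) × Fin (2*k+1) => e.2 ∉ e.1 ∧ e.2 ∉ Z ∧ Q e.1 e.2)).card : ℕ) : ℝ) =
      ∑ v ∈ Kn k, ∑ t ∈ vᶜ, if t ∉ Z ∧ Q v t then (1:ℝ) else 0 := by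
  rw [card_filter, sum_product]
  push_cast
  refine sum_congr rfl fun v _ => ?_
  rw [← sum_subset (subset_univ (vᶜ))]
  · refine sum_congr rfl fun t ht => ?_
    simp only [mem_compl] at ht
    simp [ht]
  · intro t _ ht
    simp only [mem_compl, not_not] at ht
    simp [ht]

lemma phase1_bound {H C : Finset (Finset (Fin (2*k+1)))} {s : Finset (Fin (2*k+1)) → ℝ} (hk : 1 ≤ k)
    (hH : H ⊆ Kn k) (hW : WW H s) (hCH : C ⊆ H) (hC : IsClique C)
    (hmax : ∀ D ⊆ H, IsClique D → D.card ≤ C.card) :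
    (999/1000 : ℝ) * (E0 H C ∅).card ≤ (Kn k).card / 2 * (1 + 8/100) := by
  have hk0 : (0:ℝ) < k := by exact_mod_cast hk
  have hd1 : Dw s (H \ C) H = Dw s (H \ C) C + Dw s (H \ C) (H \ C) := by
    refine Dw_add s ?_ disjoint_sdiff
    intro v _ t _
    rw [Finset.mem_sdiff]
    constructor
    · intro h; by_cases h' : nb v t ∈ C; exact Or.inl h'; exact Or.inr ⟨h, h'⟩
    · rintro (h | h); exact hCH h; exact h.1
  have hd2 : Dw s C H = Dw s C C + Dw s C (H \ C) := by
    refine Dw_add s ?_ disjoint_sdiff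
    intro v _ t _
    rw [Finset.mem_sdiff]
    constructor
    · intro h; by_cases h' : nb v t ∈ C; exact Or.inl h'; exact Or.inr ⟨h, h'⟩
    · rintro (h | h); exact hCH h; exact h.1
  have hd3 : Dw s C C = 0 := by
    unfold Dw
    refine sum_eq_zero fun v _ => sum_eq_zero fun t _ => if_neg ?_
    rintro ⟨a, b⟩; exact clique_nb hC a b
  have hd4 := Dw_symm s C (H \ C)
  have b1 := (abs_le.1 (Dw_deg hW hH (X := H \ C) sdiff_subset)).2
  have b2 := (abs_le.1 (Dw_deg hW hH (X := C) hCH)).1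
  have hlow := Dw_low s ((999/1000 : ℝ) / k) (fun u hu => (hW.s1 u hu).1) (X := H \ C) (Y := H \ C) sdiff_subset sdiff_subset
  have hE : ((E0 H C ∅).card : ℝ) = ∑ v ∈ Kn k, ∑ t ∈ vᶜ, if v ∈ H \ C ∧ nb v t ∈ H \ C then (1:ℝ) else 0 := by
    rw [E0, sum_pairs ∅ (fun v t => v ∈ H ∧ nb v t ∈ H ∧ mono C v t)]
    refine sum_congr rfl fun v _ => sum_congr rfl fun t _ => ?_
    congr 1
    simp only [notMem_empty, not_false_eq_true, true_and, mono, Finset.mem_sdiff, eq_iff_iff]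
    have := @clique_nb k C hC v t
    tauto
  rw [← hE] at hlow
  have hc : ((H \ C).card : ℝ) = H.card - C.card := by
    rw [card_sdiff_of_subset hCH, Nat.cast_sub (card_le_card hCH)]
  rw [hc] at b1
  have hm : (k : ℝ) * H.card ≤ (2*k+1) * C.card := by exact_mod_cast max_ge hH hmax
  have hHM : (H.card : ℝ) ≤ (Kn k).card := by exact_mod_cast card_le_card hH
  have h1 : (999/1000 : ℝ) / k * (E0 H C ∅).card ≤ H.card - 2 * C.card + (4/100)/k * H.card := by
    linarith
  have h2 : (999/1000 : ℝ) * (E0 H C ∅).card ≤ k * (H.card - 2 * C.card) + (4/100) * H.card := by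
    have := mul_le_mul_of_nonneg_left h1 hk0.le
    field_simp at this
    linarith
  have h3 : (k:ℝ) * (H.card - 2 * C.card) ≤ H.card / 2 := by
    by_contra hcon
    push Not at hcon
    have : (0:ℝ) ≤ C.card := Nat.cast_nonneg _
    have h0 : (0:ℝ) ≤ H.card := Nat.cast_nonneg _
    nlinarith
  linarith

lemma card_missing {H : Finset (Finset (Fin (2*k+1)))} {d : ℕ} (hD : DD H d) :
    (k+1) * (Kn k \ H).card ≤ d * (Kn k).card := by
  have h := edge_swap (k := k) (fun v _ => if v ∉ H then 1 else 0)
  have h1 : ∑ v ∈ Kn k, ∑ t ∈ vᶜ, (if v ∉ H then 1 else 0) = (k+1) * (Kn k \ H).card := by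
    have : (Kn k \ H) = (Kn k).filter (fun v => v ∉ H) := by ext; simp
    rw [this, card_filter, mul_sum]
    refine sum_congr rfl fun v hv => ?_
    rw [sum_const, card_compl_Kn hv, smul_eq_mul]
  rw [← h1, ← h]
  calc _ ≤ ∑ v ∈ Kn k, d := sum_le_sum fun v hv => by rw [← card_filter]; exact hD.d1 v hv
    _ = _ := by rw [sum_const, smul_eq_mul, mul_comm]

lemma card_missing' {H : Finset (Finset (Fin (2*k+1)))} {d : ℕ} (hD : DD H d) (hd : (d:ℝ) ≤ k/10^5) :
    ((Kn k \ H).card : ℝ) ≤ 2/10^5 * ((2*k).choose k : ℕ) := by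
  have h1 : ((k:ℝ)+1) * (Kn k \ H).card ≤ d * (Kn k).card := by exact_mod_cast card_missing hD
  have h2 : ((k:ℝ)+1) * (Kn k).card = (2*k+1) * ((2*k).choose k : ℕ) := by exact_mod_cast card_Kn_mul k
  set P : ℝ := (((2*k).choose k : ℕ) : ℝ)
  have hP : 0 ≤ P := Nat.cast_nonneg _
  have hk : (0:ℝ) ≤ k := Nat.cast_nonneg _
  have hM : (0:ℝ) ≤ (Kn k).card := Nat.cast_nonneg _
  have h3 : ((Kn k).card : ℝ) ≤ 2 * P := by nlinarith
  by_contra hcon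
  push Not at hcon
  have h4 : (d:ℝ) * (Kn k).card ≤ k/10^5 * (2 * P) := by
    have : (0:ℝ) ≤ k/10^5 := by positivity
    nlinarith [Nat.cast_nonneg (α := ℝ) d]
  nlinarith

lemma phase1 {H C : Finset (Finset (Fin (2*k+1)))} {s : Finset (Fin (2*k+1)) → ℝ} {d : ℕ}
    (hD : DD H d) (hk : (10:ℝ)^7 ≤ k) (hd : (d:ℝ) ≤ k/10^5)
    (hW : WW H s) (hCH : C ⊆ H) (hC : IsClique C)
    (hmax : ∀ D ⊆ H, IsClique D → D.card ≤ C.card) :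
    ∃ z, ((C.filter (fun v => z ∉ v)).card : ℝ) ≤ 1/4 * ((2*k).choose k : ℕ) := by
  have hk2 : 2 ≤ k := by
    have : (2:ℝ) ≤ k := by linarith
    exact_mod_cast this
  have hH := hD.sub
  obtain ⟨G, hG, hGF, hMaj⟩ := exists_maj hH hCH ∅
  have h1 := phase1_bound (by omega) hH hW hCH hC hmax
  have h2 := cmp_total hD (by simp) hMaj hk hd
  rw [E0_congr hGF] at h2
  have hM : (0:ℝ) ≤ (Kn k).card := Nat.cast_nonneg _
  have hm := card_missing' hD hd
  have hP : (0:ℝ) < ((2*k).choose k : ℕ) := by exact_mod_cast Nat.choose_pos (by omega)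
  set P : ℝ := (((2*k).choose k : ℕ) : ℝ) with hPdef
  obtain ⟨z, hz | hz⟩ := phase1_pm hk2 G (82/1000) (by norm_num) (by norm_num) (by linarith)
  · exfalso
    have hsub : ((Kn k).filter (fun v => z ∉ v ∧ v ∈ G ∧ nb v z ∈ G)) ⊆
        (Kn k \ H) ∪ ((Kn k).filter (fun v => z ∉ v ∧ nb v z ∉ H)) := by
      intro v hv
      rw [mem_filter] at hv
      obtain ⟨a, b, c, e⟩ := hv
      by_cases h1 : v ∈ H
      · by_cases h2 : nb v z ∈ H
        · exact absurd ((hGF _ h2).1 e) (clique_nb hC ((hGF _ h1).1 c))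
        · exact mem_union_right _ (mem_filter.2 ⟨a, b, h2⟩)
      · exact mem_union_left _ (Finset.mem_sdiff.2 ⟨a, h1⟩)
    have hinj : ((Kn k).filter (fun v => z ∉ v ∧ nb v z ∉ H)).card ≤ (Kn k \ H).card := by
      refine card_le_card_of_injOn (fun v => nb v z) ?_ ?_
      · intro v hv
        simp only [coe_filter, Set.mem_ofPred_eq] at hv
        simp only [mem_coe, Finset.mem_sdiff]
        exact ⟨nb_mem hv.1 (by simpa using hv.2.1), hv.2.2⟩
      · intro v hv w hw e
        simp only [coe_filter, Set.mem_ofPred_eq] at hv hw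
        have e' : nb v z = nb w z := e
        rw [← nb_nb (v := v) (t := z) (by simpa using hv.2.1), e', nb_nb (by simpa using hw.2.1)]
    have h3 := (card_le_card hsub).trans (card_union_le _ _)
    have h4 : (((Kn k).filter (fun v => z ∉ v ∧ v ∈ G ∧ nb v z ∈ G)).card : ℝ) ≤ 2 * (Kn k \ H).card := by
      have : ((Kn k).filter (fun v => z ∉ v ∧ v ∈ G ∧ nb v z ∈ G)).card ≤ 2 * (Kn k \ H).card := by omega
      exact_mod_cast this
    linarith
  · refine ⟨z, ?_⟩
    have hc := card_notMem_Kn (k := k) z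
    have h5 : (C.filter (fun v => z ∉ v)).card + ((Kn k).filter (fun v => z ∉ v ∧ v ∉ G ∧ nb v z ∉ G)).card ≤ (2*k).choose k := by
      rw [← hc, ← card_union_of_disjoint]
      · refine card_le_card (union_subset ?_ ?_)
        · intro v hv; rw [mem_filter] at hv ⊢; exact ⟨hH (hCH hv.1), hv.2⟩
        · intro v hv; rw [mem_filter] at hv ⊢; exact ⟨hv.1, hv.2.1⟩
      · rw [disjoint_left]
        intro v hv hv'
        rw [mem_filter] at hv hv'
        exact hv'.2.2.1 ((hGF _ (hCH hv.1)).2 hv.1)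
    have h6 : ((C.filter (fun v => z ∉ v)).card : ℝ) + ((Kn k).filter (fun v => z ∉ v ∧ v ∉ G ∧ nb v z ∉ G)).card ≤ P := by
      rw [hPdef]; exact_mod_cast h5
    linarith

end Determ


section Determ2
open Finset
variable {k : ℕ}

lemma E0_half {H C : Finset (Finset (Fin (2*k+1)))} (z : Fin (2*k+1)) (hC : IsClique C) :
    ((E0 H C {z}).card : ℝ) ≤ 2 * ∑ v ∈ Kn k, ∑ t ∈ vᶜ,
      if v ∈ (H.filter (fun v => z ∈ v)) \ C ∧ nb v t ∈ H \ C then (1:ℝ) else 0 := by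
  rw [E0, sum_pairs {z} (fun v t => v ∈ H ∧ nb v t ∈ H ∧ mono C v t)]
  have hx := edge_swap (k := k) (fun v t => if v ∈ (H.filter (fun v => z ∈ v)) \ C ∧ nb v t ∈ H \ C then (1:ℝ) else 0)
  rw [two_mul (∑ v ∈ Kn k, _)]
  nth_rewrite 2 [← hx]
  simp only [← sum_add_distrib]
  refine sum_le_sum fun v _ => sum_le_sum fun t ht => ?_
  have hn : nb (nb v t) t = v := nb_nb ht
  rw [hn]
  by_cases h : t ∉ ({z} : Finset (Fin (2*k+1))) ∧ v ∈ H ∧ nb v t ∈ H ∧ mono C v t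
  · rw [if_pos h]
    obtain ⟨h1, h2, h3, h4⟩ := h
    rw [mem_singleton] at h1
    have hvC : v ∉ C := fun h => clique_nb hC h (h4.1 h)
    have hnC : nb v t ∉ C := fun h => hvC (h4.2 h)
    by_cases hz : z ∈ v
    · rw [if_pos ⟨by simp [h2, hz, hvC], by simp [h3, hnC]⟩]
      split_ifs <;> norm_num
    · have hzn : z ∈ nb v t := by simp [nb, hz, Ne.symm h1]
      rw [if_pos (c := nb v t ∈ _ ∧ _) ⟨by simp [h3, hzn, hnC], by simp [h2, hvC]⟩]
      split_ifs <;> norm_num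
  · rw [if_neg h]
    split_ifs <;> norm_num

lemma phase2 {H C : Finset (Finset (Fin (2*k+1)))} {s : Finset (Fin (2*k+1)) → ℝ} {d : ℕ}
    (hD : DD H d) (hk : (10:ℝ)^7 ≤ k) (hd : (d:ℝ) ≤ k/10^5)
    (hW : WW H s) (hCH : C ⊆ H) (hC : IsClique C)
    (hmax : ∀ D ⊆ H, IsClique D → D.card ≤ C.card) (z : Fin (2*k+1))
    (hz : ((C.filter (fun v => z ∉ v)).card : ℝ) ≤ 1/4 * ((2*k).choose k : ℕ)) :
    C.filter (fun v => z ∉ v) = ∅ := by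
  have hk0 : (0:ℝ) < k := by linarith
  have hk1 : 1 ≤ k := by
    have : (1:ℝ) ≤ k := by linarith
    exact_mod_cast this
  have hH := hD.sub
  set A := C.filter (fun v => z ∉ v) with hA
  set B := (H.filter (fun v => z ∈ v)) \ C with hB
  have hAC : A ⊆ C := filter_subset _ _
  have hAH : A ⊆ H := hAC.trans hCH
  have hBH : B ⊆ H := sdiff_subset.trans (filter_subset _ _)
  have hBA : (B.card : ℝ) ≤ A.card := by
    have h1 : (starOf H z).card ≤ C.card := hmax _ (filter_subset _ _) (star_clique H z)
    have h2 : C.card = (C.filter (fun v => z ∈ v)).card + A.card := by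
      rw [hA, card_filter_add_card_filter_not]
    have h3 : (starOf H z).card = B.card + (C.filter (fun v => z ∈ v)).card := by
      rw [starOf, hB, ← card_union_of_disjoint]
      · congr 1
        ext v
        simp only [mem_filter, mem_union, Finset.mem_sdiff]
        have := @hCH v
        tauto
      · rw [disjoint_left]; intro v hv hv'
        rw [Finset.mem_sdiff] at hv; rw [mem_filter] at hv'; exact hv.2 hv'.1
    have : B.card ≤ A.card := by omega
    exact_mod_cast this
  -- weights
  have hspos : ∀ u ∈ H, 0 ≤ s u := fun u hu => le_trans (by positivity) (hW.s1 u hu).1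
  have e1 : Dw s B H = Dw s B C + Dw s B (H \ C) := by
    refine Dw_add s ?_ disjoint_sdiff
    intro v _ t _
    rw [Finset.mem_sdiff]
    constructor
    · intro h; by_cases h' : nb v t ∈ C; exact Or.inl h'; exact Or.inr ⟨h, h'⟩
    · rintro (h | h); exact hCH h; exact h.1
  have e2 : Dw s A H = Dw s A B + Dw s A (H \ B) := by
    refine Dw_add s ?_ disjoint_sdiff
    intro v _ t _
    rw [Finset.mem_sdiff (s := H) (t := B)]
    constructor
    · intro h; by_cases h' : nb v t ∈ B; exact Or.inl h'; exact Or.inr ⟨h, h'⟩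
    · rintro (h | h); exact hBH h; exact h.1
  have e3 : Dw s A B ≤ Dw s B C := by
    rw [Dw_symm s B C]
    exact Dw_mono s hspos hAC (subset_refl _) hCH hBH
  have e4 : Dw s A (H \ B) ≤ (1001/1000 : ℝ) / k * A.card := by
    rw [Dw_eq s (hAH.trans hH)]
    have : (1001/1000 : ℝ) / k * A.card = ∑ v ∈ A, (1001/1000 : ℝ) / k := by
      rw [sum_const, nsmul_eq_mul, mul_comm]
    rw [this]
    refine sum_le_sum fun v hv => ?_
    have hvC := hAC hv
    have hzv : z ∉ v := (mem_filter.1 hv).2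
    rw [← sum_subset (s₁ := {z}) (by simpa using hzv)]
    · rw [sum_singleton]
      split_ifs with h
      · have a1 := (hW.s1 v (hAH hv)).2
        have a2 := (hW.s1 _ (Finset.mem_sdiff.1 h).1).2
        linarith
      · positivity
    · intro t ht htz
      rw [mem_singleton] at htz
      refine if_neg fun h => ?_
      rw [Finset.mem_sdiff] at h
      refine h.2 ?_
      rw [hB, Finset.mem_sdiff, mem_filter]
      exact ⟨⟨h.1, by simp [nb, hzv, Ne.symm htz]⟩, clique_nb hC hvC⟩
  have b1 := (abs_le.1 (Dw_deg hW hH hBH)).2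
  have b2 := (abs_le.1 (Dw_deg hW hH hAH)).1
  have hlow := Dw_low s ((999/1000 : ℝ) / k) (fun u hu => (hW.s1 u hu).1) (X := B) (Y := H \ C) hBH sdiff_subset
  -- isoperimetry
  obtain ⟨G, hG, hGF, hMaj⟩ := exists_maj hH hCH {z}
  have h2 := cmp_total hD (by simp) hMaj hk hd
  rw [E0_congr hGF] at h2
  have hm := card_missing' hD hd
  have hP : (0:ℝ) < ((2*k).choose k : ℕ) := by exact_mod_cast Nat.choose_pos (by omega)
  have h3 := phase2_iso hk1 G z _ rfl
  have h4 := E0_half (H := H) z hC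
  rw [← hB] at h4
  set P : ℝ := (((2*k).choose k : ℕ) : ℝ) with hPdef
  set T := ∑ v ∈ Kn k, ∑ t ∈ vᶜ, if v ∈ B ∧ nb v t ∈ H \ C then (1:ℝ) else 0 with hT
  set a : ℝ := (((Kn k).filter (fun v => z ∉ v ∧ v ∈ G)).card : ℝ) with ha
  have a1 : (A.card : ℝ) ≤ a := by
    rw [ha]
    have : A.card ≤ ((Kn k).filter (fun v => z ∉ v ∧ v ∈ G)).card := by
      refine card_le_card fun v hv => ?_
      rw [mem_filter]
      exact ⟨hH (hAH hv), (mem_filter.1 hv).2, (hGF _ (hAH hv)).2 (hAC hv)⟩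
    exact_mod_cast this
  have a2 : a ≤ A.card + (Kn k \ H).card := by
    rw [ha]
    have : ((Kn k).filter (fun v => z ∉ v ∧ v ∈ G)).card ≤ A.card + (Kn k \ H).card := by
      refine (card_le_card ?_).trans (card_union_le _ _)
      intro v hv
      rw [mem_filter] at hv
      by_cases h : v ∈ H
      · exact mem_union_left _ (mem_filter.2 ⟨(hGF _ h).1 hv.2.2, hv.2.1⟩)
      · exact mem_union_right _ (Finset.mem_sdiff.2 ⟨hv.1, h⟩)
    exact_mod_cast this
  have ha0 : 0 ≤ a := Nat.cast_nonneg _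
  have hA0 : (0:ℝ) ≤ A.card := Nat.cast_nonneg _
  have a3 : a ≤ 26/100 * P := by linarith
  have a4 : 74/100 * a ≤ a - a^2/P := by
    have : a^2/P ≤ 26/100 * a := by
      rw [div_le_iff₀ hP]; nlinarith
    linarith
  have a5 : (399/100:ℝ) ≤ 4 * k / (k+1) := by
    rw [le_div_iff₀ (by linarith)]; linarith
  have a6 : (399/100:ℝ) * (74/100 * a) ≤ (EA G {z}).card := by
    refine le_trans ?_ h3
    exact mul_le_mul a5 a4 (by positivity) (by positivity)
  have hT0 : (14/10) * (A.card : ℝ) ≤ T := by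
    have : (0:ℝ) ≤ (E0 H C {z}).card := Nat.cast_nonneg _
    linarith
  have f1 : (999/1000:ℝ)/k * ((14/10) * (A.card : ℝ)) ≤ (999/1000:ℝ)/k * T :=
    mul_le_mul_of_nonneg_left hT0 (by positivity)
  have hBk : (4/100:ℝ)/k * B.card ≤ (4/100:ℝ)/k * A.card :=
    mul_le_mul_of_nonneg_left hBA (by positivity)
  have f2 : (999/1000:ℝ)/k * ((14/10) * (A.card : ℝ)) ≤ (1001/1000 : ℝ) / k * A.card + (8/100)/k * A.card := by
    have : (8/100:ℝ)/k = (4/100)/k + (4/100)/k := by ring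
    rw [this]; linarith
  have f3 : (A.card : ℝ) ≤ 0 := by
    have : (999/1000:ℝ)/k * ((14/10) * (A.card : ℝ)) - ((1001/1000 : ℝ) / k * A.card + (8/100)/k * A.card) = (3176/10000) * (A.card/k) := by
      field_simp; ring
    have h7 : (A.card : ℝ)/k ≤ 0 := by linarith
    by_contra hcon
    push Not at hcon
    have : 0 < (A.card : ℝ)/k := by positivity
    linarith
  have : A.card = 0 := by
    have : A.card ≤ 0 := by exact_mod_cast f3
    omega
  exact card_eq_zero.1 this

theorem determ {H : Finset (Finset (Fin (2*k+1)))} {s : Finset (Fin (2*k+1)) → ℝ} {d : ℕ}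
    (hD : DD H d) (hk : (10:ℝ)^7 ≤ k) (hd : (d:ℝ) ≤ k/10^5) (hW : WW H s) : EKR H := by
  intro C hCH hC hmax
  obtain ⟨z, hz⟩ := phase1 hD hk hd hW hCH hC hmax
  have h := phase2 hD hk hd hW hCH hC hmax z hz
  refine ⟨z, ?_⟩
  refine eq_of_subset_of_card_le ?_ (hmax _ (filter_subset _ _) (star_clique H z))
  intro v hv
  rw [starOf, mem_filter]
  refine ⟨hCH hv, ?_⟩
  by_contra hzv
  have : v ∈ C.filter (fun v => z ∉ v) := mem_filter.2 ⟨hv, hzv⟩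
  rw [h] at this
  simp at this

end Determ2


section Weights
open Finset
variable {k : ℕ}

/-- degree of `v` into `H` -/
def dg (H : Finset (Finset (Fin (2*k+1)))) (v : Finset (Fin (2*k+1))) : ℕ :=
  ((vᶜ).filter (fun t => nb v t ∈ H)).card

/-- truncated inverse degree -/
noncomputable def iv (H : Finset (Finset (Fin (2*k+1)))) (v : Finset (Fin (2*k+1))) : ℝ :=
  1 / max (dg H v : ℝ) ((k:ℝ)/2)

/-- iterated averages -/
noncomputable def qq (H : Finset (Finset (Fin (2*k+1)))) : ℕ → Finset (Fin (2*k+1)) → ℝ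
  | 0, v => iv H v
  | (j+1), v => iv H v * ∑ t ∈ vᶜ, if nb v t ∈ H then qq H j (nb v t) else 0

variable {H : Finset (Finset (Fin (2*k+1)))} {d : ℕ}

lemma dg_le {v} (hv : v ∈ Kn k) : dg H v ≤ k+1 := by
  rw [← card_compl_Kn hv]; exact card_filter_le _ _

lemma dg_ge (hD : DD H d) {v} (hv : v ∈ Kn k) : k + 1 ≤ dg H v + d := by
  have := hD.d1 v hv
  have h2 := card_filter_add_card_filter_not (s := vᶜ) (fun t => nb v t ∈ H)
  rw [card_compl_Kn hv] at h2
  unfold dg; omega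

lemma dg_real (hD : DD H d) (hk : (10:ℝ)^7 ≤ k) (hd : (d:ℝ) ≤ k/10^5) {v} (hv : v ∈ Kn k) :
    (1 - 1/10^5) * (k:ℝ) ≤ dg H v ∧ (dg H v : ℝ) ≤ k+1 := by
  have h1 : (k:ℝ) + 1 ≤ dg H v + d := by exact_mod_cast dg_ge hD hv
  have h2 : (dg H v : ℝ) ≤ k+1 := by exact_mod_cast dg_le (H := H) hv
  constructor <;> linarith

lemma iv_eq (hD : DD H d) (hk : (10:ℝ)^7 ≤ k) (hd : (d:ℝ) ≤ k/10^5) {v} (hv : v ∈ Kn k) :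
    iv H v = 1 / dg H v := by
  have := (dg_real hD hk hd hv).1
  rw [iv, max_eq_left]; linarith

lemma iv_nonneg (v) : 0 ≤ iv H v := by unfold iv; positivity

lemma iv_le (hk : 0 < k) (v) : iv H v ≤ 2/k := by
  have hk0 : (0:ℝ) < k := by exact_mod_cast hk
  unfold iv
  rw [div_le_div_iff₀ (by positivity) hk0]
  have := le_max_right (dg H v : ℝ) ((k:ℝ)/2)
  linarith

lemma sum_const_deg (v) (c : ℝ) : (∑ t ∈ vᶜ, if nb v t ∈ H then c else 0) = dg H v * c := by
  rw [← sum_filter, sum_const, nsmul_eq_mul, dg]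

/-- lower and upper bounds for the averages -/
lemma qq_avg (hD : DD H d) (hk : (10:ℝ)^7 ≤ k) (hd : (d:ℝ) ≤ k/10^5) (j : ℕ) (lo hi : ℝ)
    (h : ∀ v ∈ Kn k, lo ≤ qq H j v ∧ qq H j v ≤ hi) :
    ∀ v ∈ Kn k, lo ≤ qq H (j+1) v ∧ qq H (j+1) v ≤ hi := by
  intro v hv
  have hdeg := (dg_real hD hk hd hv).1
  have hpos : (0:ℝ) < dg H v := by linarith
  simp only [qq]
  rw [iv_eq hD hk hd hv]
  constructor
  · have : lo = 1 / dg H v * ∑ t ∈ vᶜ, if nb v t ∈ H then lo else 0 := by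
      rw [sum_const_deg]; field_simp
    rw [this]
    gcongr with t ht
    split_ifs
    · exact (h _ (nb_mem hv ht)).1
    · exact le_rfl
  · have : hi = 1 / dg H v * ∑ t ∈ vᶜ, if nb v t ∈ H then hi else 0 := by
      rw [sum_const_deg]; field_simp
    rw [this]
    gcongr with t ht
    split_ifs
    · exact (h _ (nb_mem hv ht)).2
    · exact le_rfl

lemma iv_bounds (hD : DD H d) (hk : (10:ℝ)^7 ≤ k) (hd : (d:ℝ) ≤ k/10^5) {v} (hv : v ∈ Kn k) :
    (1 - 1/10^6) / (k:ℝ) ≤ iv H v ∧ iv H v ≤ (1 + 2/10^5) / k := by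
  have hk0 : (0:ℝ) < k := by linarith
  obtain ⟨h1, h2⟩ := dg_real hD hk hd hv
  have hpos : (0:ℝ) < dg H v := by linarith
  rw [iv_eq hD hk hd hv]
  constructor
  · rw [div_le_div_iff₀ hk0 hpos]
    nlinarith
  · rw [div_le_div_iff₀ hpos hk0]
    nlinarith

lemma qq_bounds (hD : DD H d) (hk : (10:ℝ)^7 ≤ k) (hd : (d:ℝ) ≤ k/10^5) (j : ℕ) :
    ∀ v ∈ Kn k, (1 - 1/10^6) / (k:ℝ) ≤ qq H j v ∧ qq H j v ≤ (1 + 2/10^5) / k := by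
  induction j with
  | zero => intro v hv; exact iv_bounds hD hk hd hv
  | succ j ih => exact qq_avg hD hk hd j _ _ ih

/-- the vertex weights -/
noncomputable def sw (H : Finset (Finset (Fin (2*k+1)))) (v : Finset (Fin (2*k+1))) : ℝ :=
  2 * qq H 0 v - 2 * qq H 1 v + 2 * qq H 2 v - qq H 3 v

lemma qq_deg (hD : DD H d) (hk : (10:ℝ)^7 ≤ k) (hd : (d:ℝ) ≤ k/10^5) (j : ℕ) {v} (hv : v ∈ Kn k) :
    (∑ t ∈ vᶜ, if nb v t ∈ H then qq H j (nb v t) else 0) = dg H v * qq H (j+1) v := by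
  have hdeg := (dg_real hD hk hd hv).1
  have hpos : (0:ℝ) < dg H v := by linarith
  simp only [qq]
  rw [iv_eq hD hk hd hv]
  field_simp

lemma sw_WW (hD : DD H d) (hk : (10:ℝ)^7 ≤ k) (hd : (d:ℝ) ≤ k/10^5) (μ : ℝ)
    (hμ : ∀ v ∈ Kn k, |qq H 3 v - μ| ≤ (39/1000)/(k:ℝ)^2) : WW H (sw H) := by
  have hk0 : (0:ℝ) < k := by linarith
  have hμ4 : ∀ v ∈ Kn k, |qq H 4 v - μ| ≤ (39/1000)/(k:ℝ)^2 := by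
    have := qq_avg hD hk hd 3 (μ - (39/1000)/(k:ℝ)^2) (μ + (39/1000)/(k:ℝ)^2) (fun v hv => by
      have := abs_le.1 (hμ v hv); constructor <;> linarith)
    intro v hv
    have := this v hv
    rw [abs_le]; constructor <;> linarith
  constructor
  · intro u hu
    have hu := hD.sub hu
    have b0 := qq_bounds hD hk hd 0 u hu
    have b1 := qq_bounds hD hk hd 1 u hu
    have b2 := qq_bounds hD hk hd 2 u hu
    have b3 := qq_bounds hD hk hd 3 u hu
    simp only [div_eq_mul_inv _ (k:ℝ)] at b0 b1 b2 b3 ⊢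
    have : 0 < (k:ℝ)⁻¹ := by positivity
    unfold sw
    constructor <;> linarith
  · intro u hu
    have hu := hD.sub hu
    have hsum : (∑ t ∈ uᶜ, if nb u t ∈ H then (sw H u + sw H (nb u t)) / 2 else 0) =
        1 + dg H u * (qq H 3 u - qq H 4 u) / 2 := by
      have e : ∀ t ∈ uᶜ, (if nb u t ∈ H then (sw H u + sw H (nb u t)) / 2 else 0) =
        (if nb u t ∈ H then sw H u / 2 else 0) + (if nb u t ∈ H then qq H 0 (nb u t) else 0) -
        (if nb u t ∈ H then qq H 1 (nb u t) else 0) + (if nb u t ∈ H then qq H 2 (nb u t) else 0)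
        - (if nb u t ∈ H then qq H 3 (nb u t) else 0) / 2 := by
        intro t _
        split_ifs
        · unfold sw; ring
        · ring
      rw [sum_congr rfl e, sum_sub_distrib, sum_add_distrib, sum_sub_distrib, sum_add_distrib, ← sum_div,
        sum_const_deg, qq_deg hD hk hd 0 hu, qq_deg hD hk hd 1 hu, qq_deg hD hk hd 2 hu, qq_deg hD hk hd 3 hu]
      have hdeg := (dg_real hD hk hd hu).1
      have hpos : (0:ℝ) < dg H u := by linarith
      have h0 : dg H u * qq H 0 u = 1 := by
        simp only [qq]; rw [iv_eq hD hk hd hu]; field_simp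
      unfold sw
      linear_combination h0
    rw [hsum, add_sub_cancel_left]
    have h3 := abs_le.1 (hμ u hu)
    have h4 := abs_le.1 (hμ4 u hu)
    have h5 : |qq H 3 u - qq H 4 u| ≤ 2 * ((39/1000)/(k:ℝ)^2) := by
      rw [abs_le]; constructor <;> linarith
    rw [abs_div, abs_mul, Nat.abs_cast, abs_of_pos (by norm_num : (0:ℝ) < 2)]
    have h6 := (dg_real hD hk hd hu).2
    calc (dg H u : ℝ) * |qq H 3 u - qq H 4 u| / 2 ≤ (k+1) * (2 * ((39/1000)/(k:ℝ)^2)) / 2 := by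
          gcongr
      _ ≤ (4/100)/k := by
          rw [show (k+1) * (2 * ((39/1000)/(k:ℝ)^2)) / 2 = ((39/1000) * (k+1))/(k:ℝ)^2 by ring]
          rw [div_le_div_iff₀ (by positivity) hk0]
          nlinarith

theorem determ2 (hD : DD H d) (hk : (10:ℝ)^7 ≤ k) (hd : (d:ℝ) ≤ k/10^5) (μ : ℝ)
    (hμ : ∀ v ∈ Kn k, |qq H 3 v - μ| ≤ (39/1000)/(k:ℝ)^2) : EKR H :=
  determ hD hk hd (sw_WW hD hk hd μ hμ)

end Weights


set_option linter.unusedSectionVars false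
section ProbTools
open Finset
variable {α : Type*} [DecidableEq α]

/-- expectation over the random subset of `S` -/
noncomputable def Ex (S : Finset α) (p : ℝ) (φ : Finset α → ℝ) : ℝ :=
  ∑ A ∈ S.powerset, p ^ A.card * (1-p) ^ (S.card - A.card) * φ A

variable {S T : Finset α} {p : ℝ} {φ ψ : Finset α → ℝ}

lemma Ex_congr (h : ∀ A, A ⊆ S → φ A = ψ A) : Ex S p φ = Ex S p ψ :=
  sum_congr rfl fun A hA => by rw [h A (mem_powerset.1 hA)]

lemma Ex_mono (h0 : 0 ≤ p) (h1 : p ≤ 1) (h : ∀ A, A ⊆ S → φ A ≤ ψ A) : Ex S p φ ≤ Ex S p ψ :=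
  sum_le_sum fun A hA => mul_le_mul_of_nonneg_left (h A (mem_powerset.1 hA))
    (mul_nonneg (pow_nonneg h0 _) (pow_nonneg (by linarith) _))

lemma Ex_add : Ex S p (fun A => φ A + ψ A) = Ex S p φ + Ex S p ψ := by
  simp only [Ex, mul_add, sum_add_distrib]

lemma Ex_smul (c : ℝ) : Ex S p (fun A => c * φ A) = c * Ex S p φ := by
  simp only [Ex, mul_sum]; exact sum_congr rfl fun A _ => by ring

lemma Ex_sub : Ex S p (fun A => φ A - ψ A) = Ex S p φ - Ex S p ψ := by
  simp only [Ex, mul_sub, sum_sub_distrib]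

lemma Ex_sum {ι : Type*} (I : Finset ι) (f : ι → Finset α → ℝ) :
    Ex S p (fun A => ∑ i ∈ I, f i A) = ∑ i ∈ I, Ex S p (f i) := by
  simp only [Ex, mul_sum]; rw [sum_comm]

lemma Ex_empty : Ex ∅ p φ = φ ∅ := by simp [Ex]

lemma Ex_insert {v : α} (hv : v ∉ S) :
    Ex (insert v S) p φ = p * Ex S p (fun A => φ (insert v A)) + (1-p) * Ex S p φ := by
  unfold Ex
  rw [sum_powerset_insert hv, add_comm, mul_sum, mul_sum]
  congr 1
  · refine sum_congr rfl fun A hA => ?_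
    have hA := mem_powerset.1 hA
    rw [card_insert_of_notMem hv, card_insert_of_notMem (fun h => hv (hA h)), Nat.add_sub_add_right]
    ring
  · refine sum_congr rfl fun A hA => ?_
    have hA := card_le_card (mem_powerset.1 hA)
    rw [card_insert_of_notMem hv, Nat.succ_sub hA, pow_succ]
    ring

lemma Ex_const (c : ℝ) : Ex S p (fun _ => c) = c := by
  induction S using Finset.induction_on with
  | empty => exact Ex_empty
  | insert v S hv ih => rw [Ex_insert hv, ih]; ring

lemma Ex_union (h : Disjoint S T) : Ex (S ∪ T) p φ = Ex S p (fun A => Ex T p (fun B => φ (A ∪ B))) := by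
  induction T using Finset.induction_on generalizing φ with
  | empty => rw [union_empty]; exact Ex_congr fun A _ => by rw [Ex_empty, union_empty]
  | insert v T hv ih =>
    rw [disjoint_insert_right] at h
    rw [union_insert, Ex_insert (by simp [hv, h.1]), ih h.2, ih h.2]
    rw [← Ex_smul, ← Ex_smul, ← Ex_add]
    refine Ex_congr fun A _ => ?_
    rw [Ex_insert hv]
    simp only [union_insert]

lemma Ex_marg (h : T ⊆ S) (g : Finset α → ℝ) : Ex S p (fun A => g (A ∩ T)) = Ex T p g := by
  have e : S = T ∪ (S \ T) := by rw [union_sdiff_of_subset h]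
  rw [e, Ex_union disjoint_sdiff]
  refine Ex_congr fun A hA => ?_
  have : Ex (S \ T) p (fun B => g ((A ∪ B) ∩ T)) = Ex (S \ T) p (fun _ => g A) := by
    refine Ex_congr fun B hB => ?_
    congr 1
    ext x
    simp only [mem_inter, mem_union]
    constructor
    · rintro ⟨h1 | h1, h2⟩
      · exact h1
      · exact absurd h2 (Finset.mem_sdiff.1 (hB h1)).2
    · intro h1; exact ⟨Or.inl h1, hA h1⟩
  rw [this, Ex_const]

lemma Ex_card {β : Type*} [DecidableEq β] {S' : Finset β} (h : S.card = S'.card) (g : ℕ → ℝ) :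
    Ex S p (fun A => g A.card) = Ex S' p (fun A => g A.card) := by
  unfold Ex
  rw [sum_powerset_apply_card (fun m => p ^ m * (1-p)^(S.card - m) * g m),
    sum_powerset_apply_card (fun m => p ^ m * (1-p)^(S'.card - m) * g m), h]

lemma Ex_card_mean : Ex S p (fun A => (A.card : ℝ)) = p * S.card := by
  induction S using Finset.induction_on with
  | empty => rw [Ex_empty]; simp
  | insert v S hv ih =>
    rw [Ex_insert hv, ih]
    have : Ex S p (fun A => (((insert v A).card : ℕ) : ℝ)) = Ex S p (fun A => (A.card : ℝ) + 1) := by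
      refine Ex_congr fun A hA => ?_
      rw [card_insert_of_notMem (fun h => hv (hA h))]; push_cast; rfl
    rw [this, Ex_add, ih, Ex_const, card_insert_of_notMem hv]; push_cast; ring

lemma Ex_missing (y : ℝ) : Ex S p (fun A => y ^ (S \ A).card) = (p + (1-p) * y) ^ S.card := by
  induction S using Finset.induction_on with
  | empty => rw [Ex_empty]; simp
  | insert v S hv ih =>
    rw [Ex_insert hv, card_insert_of_notMem hv, pow_succ, ← ih]
    have h1 : Ex S p (fun A => y ^ (insert v S \ insert v A).card) = Ex S p (fun A => y ^ (S \ A).card) := by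
      refine Ex_congr fun A hA => ?_
      rw [insert_sdiff_insert, sdiff_insert_of_notMem hv]
    have h2 : Ex S p (fun A => y ^ (insert v S \ A).card) = Ex S p (fun A => y * y ^ (S \ A).card) := by
      refine Ex_congr fun A hA => ?_
      rw [insert_sdiff_of_notMem _ (fun h => hv (hA h)), card_insert_of_notMem (by simp [hv]), pow_succ]; ring
    rw [h1, h2, Ex_smul]; ring

lemma exp_le_sq (x : ℝ) : Real.exp x ≤ x + Real.exp (x^2) := by
  have h2 := Real.add_one_le_exp (x^2)
  rcases le_or_gt |x| 1 with h | h
  · have := (abs_le.1 (Real.abs_exp_sub_one_sub_id_le h)).2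
    linarith
  · rcases lt_abs.1 h with h | h
    · have : Real.exp x ≤ Real.exp (x^2) := Real.exp_le_exp.2 (by nlinarith)
      linarith
    · have : Real.exp x ≤ 1 := Real.exp_le_one_iff.2 (by linarith)
      nlinarith

lemma mcd (h0 : 0 ≤ p) (h1 : p ≤ 1) (c : α → ℝ) (l : ℝ)
    (h : ∀ v ∈ S, ∀ A, A ⊆ S → v ∉ A → |φ (insert v A) - φ A| ≤ c v) :
    Ex S p (fun A => Real.exp (l * (φ A - Ex S p φ))) ≤ Real.exp (l^2 * ∑ v ∈ S, c v ^2) := by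
  induction S using Finset.induction_on generalizing φ with
  | empty => rw [Ex_empty, Ex_empty]; simp
  | insert v S hv ih =>
    set m0 := Ex S p φ with hm0
    set m1 := Ex S p (fun A => φ (insert v A)) with hm1
    have i0 := ih (φ := φ) (fun w hw A hA hwA => h w (mem_insert_of_mem hw) A (hA.trans (subset_insert _ _)) hwA)
    have i1 := ih (φ := fun A => φ (insert v A)) (fun w hw A hA hwA => by
      have := h w (mem_insert_of_mem hw) (insert v A) (insert_subset_insert _ hA) (by
        rw [mem_insert]; rintro (rfl | h'); exact hv hw; exact hwA h')
      rwa [Finset.insert_comm] at this)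
    have hc : |m1 - m0| ≤ c v := by
      rw [hm1, hm0, ← Ex_sub]
      have hh : ∀ A, A ⊆ S → |φ (insert v A) - φ A| ≤ c v := fun A hA =>
        h v (mem_insert_self _ _) A (hA.trans (subset_insert _ _)) (fun h' => hv (hA h'))
      rw [abs_le]
      constructor
      · rw [← Ex_const (S := S) (p := p) (-c v)]
        exact Ex_mono h0 h1 fun A hA => (abs_le.1 (hh A hA)).1
      · rw [← Ex_const (S := S) (p := p) (c v)]
        exact Ex_mono h0 h1 fun A hA => (abs_le.1 (hh A hA)).2
    rw [Ex_insert hv, Ex_insert hv, ← hm0, ← hm1, sum_insert hv, mul_add, Real.exp_add]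
    set m := p * m1 + (1-p) * m0 with hm
    set E := Real.exp (l^2 * ∑ v ∈ S, c v^2) with hE
    have e1 : Ex S p (fun A => Real.exp (l * (φ (insert v A) - m))) = Real.exp (l * (m1 - m)) * Ex S p (fun A => Real.exp (l * (φ (insert v A) - m1))) := by
      rw [← Ex_smul]
      refine Ex_congr fun A _ => ?_
      rw [← Real.exp_add]; congr 1; ring
    have e0 : Ex S p (fun A => Real.exp (l * (φ A - m))) = Real.exp (l * (m0 - m)) * Ex S p (fun A => Real.exp (l * (φ A - m0))) := by
      rw [← Ex_smul]
      refine Ex_congr fun A _ => ?_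
      rw [← Real.exp_add]; congr 1; ring
    rw [e1, e0]
    have x1 := exp_le_sq (l * (m1 - m))
    have x0 := exp_le_sq (l * (m0 - m))
    have hsq : (m1 - m0)^2 ≤ c v ^2 := sq_le_sq' (by linarith [(abs_le.1 hc).1]) (abs_le.1 hc).2
    have y1 : Real.exp ((l * (m1-m))^2) ≤ Real.exp (l^2 * c v^2) := by
      refine Real.exp_le_exp.2 ?_
      rw [mul_pow]
      refine mul_le_mul_of_nonneg_left ?_ (sq_nonneg _)
      have : (m1 - m)^2 = (1-p)^2 * (m1-m0)^2 := by rw [hm]; ring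
      rw [this]
      have : (1-p)^2 ≤ 1 := by nlinarith
      nlinarith [sq_nonneg (m1-m0)]
    have y0 : Real.exp ((l * (m0-m))^2) ≤ Real.exp (l^2 * c v^2) := by
      refine Real.exp_le_exp.2 ?_
      rw [mul_pow]
      refine mul_le_mul_of_nonneg_left ?_ (sq_nonneg _)
      have : (m0 - m)^2 = p^2 * (m1-m0)^2 := by rw [hm]; ring
      rw [this]
      have : p^2 ≤ 1 := by nlinarith
      nlinarith [sq_nonneg (m1-m0)]
    have hp1 : 0 ≤ 1 - p := by linarith
    calc p * (Real.exp (l * (m1 - m)) * Ex S p (fun A => Real.exp (l * (φ (insert v A) - m1)))) +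
          (1-p) * (Real.exp (l * (m0 - m)) * Ex S p (fun A => Real.exp (l * (φ A - m0))))
        ≤ p * (Real.exp (l * (m1 - m)) * E) + (1-p) * (Real.exp (l * (m0 - m)) * E) := by
          gcongr
      _ = (p * Real.exp (l * (m1 - m)) + (1-p) * Real.exp (l * (m0 - m))) * E := by ring
      _ ≤ (p * (l * (m1 - m) + Real.exp (l^2 * c v^2)) + (1-p) * (l * (m0 - m) + Real.exp (l^2 * c v^2))) * E := by
          have : 0 ≤ E := (Real.exp_pos _).le
          gcongr
          · linarith
          · linarith
      _ = Real.exp (l^2 * c v^2) * E := by rw [hm]; ring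

open Classical in
lemma markov_exp (h0 : 0 ≤ p) (h1 : p ≤ 1) (c : α → ℝ) (V τ : ℝ) (hV : 0 < V) (hτ : 0 < τ)
    (hcV : ∑ v ∈ S, c v ^2 ≤ V)
    (h : ∀ v ∈ S, ∀ A, A ⊆ S → v ∉ A → |φ (insert v A) - φ A| ≤ c v) :
    Ex S p (fun A => if τ < |φ A - Ex S p φ| then 1 else 0) ≤ 2 * Real.exp (-(τ^2 / (4*V))) := by
  have key : ∀ l : ℝ, |l| = τ/(2*V) → Real.exp (-(|l| * τ)) * Ex S p (fun A => Real.exp (l * (φ A - Ex S p φ))) ≤ Real.exp (-(τ^2/(4*V))) := by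
    intro l hl
    calc _ ≤ Real.exp (-(|l| * τ)) * Real.exp (l^2 * V) := by
          refine mul_le_mul_of_nonneg_left ((mcd h0 h1 c l h).trans (Real.exp_le_exp.2 ?_)) (Real.exp_pos _).le
          exact mul_le_mul_of_nonneg_left hcV (sq_nonneg _)
      _ = Real.exp (-(τ^2/(4*V))) := by
          rw [← Real.exp_add, ← sq_abs l, hl]; congr 1; field_simp; ring
  set l := τ/(2*V) with hl
  have hl0 : 0 < l := by positivity
  have k1 := key l (abs_of_pos hl0)
  have k2 := key (-l) (by rw [abs_neg, abs_of_pos hl0])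
  rw [abs_neg] at k2
  rw [abs_of_pos hl0] at k1 k2
  rw [← Ex_smul] at k1 k2
  rw [two_mul]
  refine le_trans ?_ (add_le_add k1 k2)
  rw [← Ex_add]
  refine Ex_mono h0 h1 fun A _ => ?_
  rw [← Real.exp_add, ← Real.exp_add]
  have p1 := Real.exp_pos (-(l*τ) + l * (φ A - Ex S p φ))
  have p2 := Real.exp_pos (-(l*τ) + -l * (φ A - Ex S p φ))
  split_ifs with hh
  · rcases lt_abs.1 hh with h' | h'
    · have : 1 ≤ Real.exp (-(l*τ) + l * (φ A - Ex S p φ)) := Real.one_le_exp (by nlinarith)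
      linarith
    · have : 1 ≤ Real.exp (-(l*τ) + -l * (φ A - Ex S p φ)) := Real.one_le_exp (by nlinarith)
      linarith
  · linarith

end ProbTools


section Struct
open Finset
variable {k : ℕ}

/-- inner sets relative to `u` -/
def inn (u x : Finset (Fin (2*k+1))) : Prop := (x ∩ u).card ≤ 1 ∨ k ≤ (x ∩ u).card + 1

instance (u x : Finset (Fin (2*k+1))) : Decidable (inn u x) := by unfold inn; infer_instance

/-- three step walk -/
def y2 (u : Finset (Fin (2*k+1))) (b a : Fin (2*k+1)) : Finset (Fin (2*k+1)) := nb (nb u b) a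
/-- three step walk -/
def y3 (u : Finset (Fin (2*k+1))) (b a c : Fin (2*k+1)) : Finset (Fin (2*k+1)) := nb (y2 u b a) c

/-- coefficients in the expansion of the third average -/
noncomputable def al (H : Finset (Finset (Fin (2*k+1)))) (u : Finset (Fin (2*k+1))) (b a c : Fin (2*k+1)) : ℝ :=
  if nb u b ∈ H ∧ y2 u b a ∈ H ∧ y3 u b a c ∈ H then iv H u * iv H (nb u b) * iv H (y2 u b a) else 0

/-- agreement on inner sets -/
def Agr (u : Finset (Fin (2*k+1))) (H H' : Finset (Finset (Fin (2*k+1)))) : Prop :=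
  ∀ x, inn u x → (x ∈ H ↔ x ∈ H')

variable {H H' : Finset (Finset (Fin (2*k+1)))} {u : Finset (Fin (2*k+1))}

lemma q3_expand : qq H 3 u = ∑ b ∈ uᶜ, ∑ a ∈ (nb u b)ᶜ, ∑ c ∈ (y2 u b a)ᶜ, al H u b a c * iv H (y3 u b a c) := by
  simp only [qq, mul_sum]
  refine sum_congr rfl fun b _ => ?_
  by_cases h1 : nb u b ∈ H
  · simp only [h1, if_true, mul_sum]
    refine sum_congr rfl fun a _ => ?_
    by_cases h2 : nb (nb u b) a ∈ H
    · simp only [h2, if_true, mul_sum]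
      refine sum_congr rfl fun c _ => ?_
      simp only [al, y2, y3, h1, h2, true_and]
      split_ifs <;> ring
    · simp [h2, al, y2]
  · simp [h1, al]

lemma inn1 (b) : inn u (nb u b) := by
  left
  have : nb u b ∩ u = ∅ := by
    ext x; simp only [nb, mem_inter, mem_erase, mem_compl, notMem_empty, iff_false]; tauto
  rw [this]; simp

lemma y2_eq (b a) : y2 u b a = (insert b u).erase a := nb_nb_eq

lemma y2_compl (b a) : (y2 u b a)ᶜ = insert a (nb u b) := nb_compl

lemma y3_eq (b a c) : y3 u b a c = (insert a (nb u b)).erase c := by rw [y3, nb, y2_compl]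

lemma y3_compl (b a c) : (y3 u b a c)ᶜ = insert c (y2 u b a) := nb_compl

lemma inn2 (hu : u ∈ Kn k) (b a) : inn u (y2 u b a) := by
  right
  have h1 : u.erase a ⊆ y2 u b a ∩ u := by
    intro x hx
    rw [mem_erase] at hx
    rw [y2_eq]; simp [hx.1, hx.2]
  have h2 := card_le_card h1
  have h3 := pred_card_le_card_erase (s := u) (a := a)
  rw [mem_Kn.1 hu] at h3
  omega

lemma inn3 (b a c) : inn u (y3 u b a c) := by
  left
  have : y3 u b a c ∩ u ⊆ {a} := by
    intro x hx
    rw [y3_eq] at hx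
    simp only [nb, mem_inter, mem_erase, mem_insert, mem_compl] at hx
    rw [mem_singleton]; tauto
  exact (card_le_card this).trans (by simp)

lemma dg_congr {v : Finset (Fin (2*k+1))} (h : ∀ t ∈ vᶜ, (nb v t ∈ H ↔ nb v t ∈ H')) : dg H v = dg H' v := by
  unfold dg
  congr 1
  exact filter_congr h

lemma iv_congr {v : Finset (Fin (2*k+1))} (h : ∀ t ∈ vᶜ, (nb v t ∈ H ↔ nb v t ∈ H')) : iv H v = iv H' v := by
  unfold iv; rw [dg_congr h]

lemma al_congr (hu : u ∈ Kn k) (h : Agr u H H') (b a c) : al H u b a c = al H' u b a c := by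
  unfold al
  rw [iv_congr (v := u) (fun t _ => h _ (inn1 t)),
    iv_congr (v := nb u b) (fun t _ => h _ (inn2 hu b t)),
    iv_congr (v := y2 u b a) (fun t _ => h _ (inn3 b a t))]
  simp only [h _ (inn1 b), h _ (inn2 hu b a), h _ (inn3 b a c)]

lemma al_nonneg (b a c) : 0 ≤ al H u b a c := by
  unfold al
  split_ifs
  · have := iv_nonneg (H := H) u
    have := iv_nonneg (H := H) (nb u b)
    have := iv_nonneg (H := H) (y2 u b a)
    positivity
  · exact le_rfl

lemma al_le (hk : 0 < k) (b a c) : al H u b a c ≤ (2/k)^3 := by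
  unfold al
  have h0 : (0:ℝ) ≤ 2/k := by positivity
  split_ifs
  · have h1 := iv_nonneg (H := H) u
    have h2 := iv_nonneg (H := H) (nb u b)
    have h3 := iv_nonneg (H := H) (y2 u b a)
    have g1 := iv_le (H := H) hk u
    have g2 := iv_le (H := H) hk (nb u b)
    have g3 := iv_le (H := H) hk (y2 u b a)
    calc _ ≤ (2/k : ℝ) * (2/k) * (2/k) := by gcongr
      _ = _ := by ring
  · positivity

/-- inverse of truncated numbers is Lipschitz -/
lemma inv_lip (hk : 0 < k) (x y : ℝ) (hxy : |x - y| ≤ 1) :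
    |1 / max x ((k:ℝ)/2) - 1 / max y ((k:ℝ)/2)| ≤ (2/k)^2 := by
  have hk0 : (0:ℝ) < k := by exact_mod_cast hk
  have hx : (k:ℝ)/2 ≤ max x ((k:ℝ)/2) := le_max_right _ _
  have hy : (k:ℝ)/2 ≤ max y ((k:ℝ)/2) := le_max_right _ _
  have hd : |max y ((k:ℝ)/2) - max x ((k:ℝ)/2)| ≤ 1 := by
    rw [abs_sub_comm]; exact (abs_max_sub_max_le_abs _ _ _).trans hxy
  set X := max x ((k:ℝ)/2)
  set Y := max y ((k:ℝ)/2)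
  have hX : 0 < X := by linarith [half_pos hk0]
  have hY : 0 < Y := by linarith [half_pos hk0]
  rw [show 1/X - 1/Y = (Y - X)/(X*Y) by field_simp, abs_div, abs_of_pos (mul_pos hX hY), div_pow]
  rw [div_le_div_iff₀ (by positivity) (by positivity)]
  have : (k:ℝ)/2 * (k/2) ≤ X * Y := mul_le_mul hx hy (by positivity) hX.le
  nlinarith [abs_nonneg (Y-X)]

lemma dg_insert (v w : Finset (Fin (2*k+1))) : dg H v ≤ dg (insert w H) v ∧ dg (insert w H) v ≤ dg H v + 1 := by
  unfold dg
  constructor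
  · exact card_le_card (monotone_filter_right _ (fun t _ h => mem_insert_of_mem h))
  · have hinj : Set.InjOn (fun t => nb v t) (vᶜ : Finset (Fin (2*k+1))) := by
      intro s hs t ht e
      have e' : (nb v s)ᶜ = (nb v t)ᶜ := congrArg _ e
      rw [nb_compl, nb_compl] at e'
      have : s ∈ insert t v := e' ▸ mem_insert_self s v
      rw [mem_insert] at this
      rcases this with h | h
      · exact h
      · simp at hs; exact absurd h hs
    have h1 : (vᶜ).filter (fun t => nb v t ∈ insert w H) ⊆ (vᶜ).filter (fun t => nb v t ∈ H) ∪ (vᶜ).filter (fun t => nb v t = w) := by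
      intro t ht
      simp only [mem_filter, mem_union, mem_insert] at ht ⊢
      tauto
    have h2 : ((vᶜ).filter (fun t => nb v t = w)).card ≤ 1 := by
      rw [card_le_one]
      intro s hs t ht
      rw [mem_filter] at hs ht
      exact hinj hs.1 ht.1 (hs.2.trans ht.2.symm)
    exact (card_le_card h1).trans ((card_union_le _ _).trans (by omega))

lemma iv_insert (hk : 0 < k) (v w : Finset (Fin (2*k+1))) : |iv (insert w H) v - iv H v| ≤ (2/k)^2 := by
  unfold iv
  refine inv_lip hk _ _ ?_
  obtain ⟨h1, h2⟩ := dg_insert (H := H) v w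
  have h1 : (dg H v : ℝ) ≤ dg (insert w H) v := by exact_mod_cast h1
  have h2 : (dg (insert w H) v : ℝ) ≤ dg H v + 1 := by exact_mod_cast h2
  rw [abs_le]; constructor <;> linarith

/-- an outer neighbour of the endpoint determines the walk up to few choices -/
lemma outer_walk (hu : u ∈ Kn k) {b a c t : Fin (2*k+1)} {w : Finset (Fin (2*k+1))} (ha : a ∈ (nb u b)ᶜ) (hw : ¬ inn u w)
    (ht : t ∈ (y3 u b a c)ᶜ) (h : nb (y3 u b a c) t = w) (hwK : w ∈ Kn k) :
    (w \ u).card = 2 ∧ b ∈ w \ u ∧ a ∈ u \ w ∧ c ∈ w \ u := by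
  have hw' : w = (insert c ((insert b u).erase a)).erase t := by
    rw [← h, nb, y3_compl, y2_eq]
  have hcard : (w \ u).card + (w ∩ u).card = k := by
    rw [card_sdiff_add_card_inter]; exact mem_Kn.1 hwK
  have h2 : 2 ≤ (w \ u).card := by
    unfold inn at hw; omega
  have hsub : w \ u ⊆ {b, c} := by
    intro x hx
    rw [Finset.mem_sdiff, hw'] at hx
    simp only [mem_erase, mem_insert] at hx
    simp only [mem_insert, mem_singleton]; tauto
  have hle : ({b, c} : Finset (Fin (2*k+1))).card ≤ 2 := card_le_two
  have heq : w \ u = {b, c} := eq_of_subset_of_card_le hsub (by omega)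
  have hbc : b ≠ c := by
    rintro rfl
    rw [heq] at h2; simp at h2
  have hb : b ∈ w \ u := by rw [heq]; simp
  have hc : c ∈ w \ u := by rw [heq]; simp
  refine ⟨by rw [heq]; exact card_pair hbc, hb, ?_, hc⟩
  rw [Finset.mem_sdiff] at hb hc ⊢
  have hab : a ≠ b := by
    rintro rfl
    have := hb.1
    rw [hw'] at this
    simp only [mem_erase, mem_insert] at this
    tauto
  have hau : a ∈ u := by
    rw [nb_compl, mem_insert] at ha
    exact ha.resolve_left hab
  refine ⟨hau, fun haw => ?_⟩
  have hac : a ≠ c := by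
    rintro rfl
    exact hc.2 hau
  rw [hw'] at haw
  simp only [mem_erase, mem_insert] at haw
  tauto

/-- bounded differences -/
lemma q3_diff (hk : 0 < k) (hu : u ∈ Kn k) {w : Finset (Fin (2*k+1))} (hw : ¬ inn u w) (hwK : w ∈ Kn k) :
    |qq (insert w H) 3 u - qq H 3 u| ≤ if (w \ u).card = 2 then (8 * (2/(k:ℝ))^5 : ℝ) else (0:ℝ) := by
  have hA : Agr u (insert w H) H := by
    intro x hx
    rw [mem_insert]
    constructor
    · rintro (rfl | h)
      · exact absurd hx hw
      · exact h
    · exact Or.inr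
  rw [q3_expand, q3_expand]
  simp only [← sum_sub_distrib]
  have hk0 : (0:ℝ) ≤ 2/k := by positivity
  have hbd : ∀ b, ∀ a ∈ (nb u b)ᶜ, ∀ c,
      |al (insert w H) u b a c * iv (insert w H) (y3 u b a c) - al H u b a c * iv H (y3 u b a c)| ≤
        if ((w \ u).card = 2 ∧ b ∈ w \ u ∧ a ∈ u \ w ∧ c ∈ w \ u) then (2/k : ℝ)^5 else 0 := by
    intro b a ha c
    rw [al_congr hu hA, ← mul_sub, abs_mul, abs_of_nonneg (al_nonneg b a c)]
    split_ifs with h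
    · calc _ ≤ (2/k : ℝ)^3 * (2/k)^2 := by
            refine mul_le_mul (al_le hk b a c) (iv_insert hk _ _) (abs_nonneg _) (by positivity)
        _ = _ := by ring
    · have : iv (insert w H) (y3 u b a c) = iv H (y3 u b a c) := by
        refine iv_congr fun t ht => ?_
        rw [mem_insert]
        constructor
        · rintro (h' | h')
          · exact absurd (outer_walk hu ha hw ht h' hwK) h
          · exact h'
        · exact Or.inr
      rw [this]; simp
  calc _ ≤ ∑ b ∈ uᶜ, ∑ a ∈ (nb u b)ᶜ, ∑ c ∈ (y2 u b a)ᶜ,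
        (if ((w \ u).card = 2 ∧ b ∈ w \ u ∧ a ∈ u \ w ∧ c ∈ w \ u) then (2/k : ℝ)^5 else 0) := by
        refine (abs_sum_le_sum_abs _ _).trans (sum_le_sum fun b _ => ?_)
        refine (abs_sum_le_sum_abs _ _).trans (sum_le_sum fun a ha => ?_)
        refine (abs_sum_le_sum_abs _ _).trans (sum_le_sum fun c _ => ?_)
        exact hbd b a ha c
    _ ≤ ∑ b : Fin (2*k+1), ∑ a : Fin (2*k+1), ∑ c : Fin (2*k+1),
        (if ((w \ u).card = 2 ∧ b ∈ w \ u ∧ a ∈ u \ w ∧ c ∈ w \ u) then (2/k : ℝ)^5 else 0) := by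
        have hn : ∀ b a c, 0 ≤ (if ((w \ u).card = 2 ∧ b ∈ w \ u ∧ a ∈ u \ w ∧ c ∈ w \ u) then (2/k : ℝ)^5 else 0) := by
          intro b a c; split_ifs <;> positivity
        refine (sum_le_sum_of_subset_of_nonneg (subset_univ _) (fun b _ _ => sum_nonneg fun a _ => sum_nonneg fun c _ => hn b a c)).trans
          (sum_le_sum fun b _ => ?_)
        refine (sum_le_sum_of_subset_of_nonneg (subset_univ _) (fun a _ _ => sum_nonneg fun c _ => hn b a c)).trans
          (sum_le_sum fun a _ => ?_)
        exact (sum_le_sum_of_subset_of_nonneg (subset_univ _) (fun c _ _ => hn b a c))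
    _ ≤ _ := by
        by_cases h2 : (w \ u).card = 2
        · have h3 : (u \ w).card = 2 := by
            have e1 := card_sdiff_add_card_inter w u
            have e2 := card_sdiff_add_card_inter u w
            rw [inter_comm] at e2
            rw [mem_Kn.1 hu] at e2; rw [mem_Kn.1 hwK] at e1; omega
          simp only [h2, true_and, if_true]
          have : ∀ b a, (∑ c : Fin (2*k+1), if (b ∈ w \ u ∧ a ∈ u \ w ∧ c ∈ w \ u) then (2/k : ℝ)^5 else 0) =
              if b ∈ w \ u then (if a ∈ u \ w then 2 * (2/k : ℝ)^5 else 0) else 0 := by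
            intro b a
            by_cases hb : b ∈ w \ u
            · by_cases ha : a ∈ u \ w
              · simp only [hb, ha, true_and, if_true]
                rw [← sum_filter, sum_const, filter_mem_eq_inter, univ_inter, h2]; norm_num
              · simp only [ha, false_and, and_false, if_false, sum_const_zero, ite_self]
            · simp only [hb, false_and, if_false, sum_const_zero]
          simp only [this]
          have h4 : ∀ b, (∑ a : Fin (2*k+1), if b ∈ w \ u then (if a ∈ u \ w then 2 * (2/k : ℝ)^5 else 0) else 0) =
              if b ∈ w \ u then 4 * (2/k : ℝ)^5 else 0 := by
            intro b
            by_cases hb : b ∈ w \ u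
            · simp only [hb, if_true]
              rw [← sum_filter, sum_const, filter_mem_eq_inter, univ_inter, h3]; norm_num; ring
            · simp only [hb, if_false, sum_const_zero]
          simp only [h4]
          rw [← sum_filter, sum_const, filter_mem_eq_inter, univ_inter, h2]
          refine le_of_eq ?_
          norm_num; ring
        · simp [h2]

lemma card_two_diff (hu : u ∈ Kn k) : ((Kn k).filter (fun w => (w \ u).card = 2)).card ≤ (k+1)^2 * k^2 := by
  have h1 : ((Kn k).filter (fun w => (w \ u).card = 2)).card ≤ ((uᶜ).powersetCard 2 ×ˢ u.powersetCard 2).card := by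
    refine card_le_card_of_injOn (fun w => (w \ u, u \ w)) ?_ ?_
    · intro w hw
      simp only [coe_filter, Set.mem_ofPred_eq] at hw
      have e1 := card_sdiff_add_card_inter w u
      have e2 := card_sdiff_add_card_inter u w
      rw [inter_comm] at e2
      rw [mem_Kn.1 hu] at e2; rw [mem_Kn.1 hw.1] at e1
      simp only [mem_coe, mem_product, mem_powersetCard]
      refine ⟨⟨?_, hw.2⟩, sdiff_subset, by omega⟩
      intro x hx; simp only [Finset.mem_sdiff] at hx; simp [hx.2]
    · intro w _ w' _ e
      simp only [Prod.mk.injEq] at e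
      have key : ∀ w : Finset (Fin (2*k+1)), w = (u \ (u \ w)) ∪ (w \ u) := by
        intro w; ext x; simp only [mem_union, Finset.mem_sdiff]; tauto
      rw [key w, key w', e.1, e.2]
  refine h1.trans ?_
  rw [card_product, card_powersetCard, card_powersetCard, card_compl_Kn hu, mem_Kn.1 hu]
  exact Nat.mul_le_mul (Nat.choose_le_pow _ _) (Nat.choose_le_pow _ _)

end Struct


section MeanEst
open Finset
variable {k : ℕ}

/-- limiting mean -/
noncomputable def mu (k : ℕ) (p : ℝ) : ℝ :=
  Ex (Finset.range (k-1)) p (fun A => 1 / max (2 + (A.card : ℝ)) ((k:ℝ)/2))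

/-- outer sets -/
def Out (u : Finset (Fin (2*k+1))) : Finset (Finset (Fin (2*k+1))) := (Kn k).filter (fun x => ¬ inn u x)

lemma mu_bounds {p : ℝ} (h0 : 0 ≤ p) (h1 : p ≤ 1) (hp : 1 - 1/10^5 ≤ p) (hk : (10:ℝ)^7 ≤ k) :
    1/((k:ℝ)+1) ≤ mu k p ∧ mu k p ≤ (1 + 2/10^5)/k := by
  have hk0 : (0:ℝ) < k := by linarith
  have hk1 : 1 ≤ k := by
    have : (0:ℝ) < k := hk0
    exact_mod_cast this
  have hc : ∀ A, A ⊆ Finset.range (k-1) → (A.card : ℝ) ≤ k - 1 := by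
    intro A hA
    have := card_le_card hA
    rw [card_range] at this
    have h2 : A.card + 1 ≤ k := by omega
    have h3 : ((A.card : ℝ)) + 1 ≤ k := by exact_mod_cast h2
    linarith
  constructor
  · rw [← Ex_const (S := Finset.range (k-1)) (p := p) (1/((k:ℝ)+1))]
    refine Ex_mono h0 h1 fun A hA => ?_
    have := hc A hA
    refine one_div_le_one_div_of_le (lt_max_of_lt_right (by positivity)) (max_le (by linarith) (by linarith))
  · have : mu k p ≤ Ex (Finset.range (k-1)) p (fun A => (1/(k:ℝ) + 2 * (k-1)/(k:ℝ)^2) + (-2/(k:ℝ)^2) * (A.card : ℝ)) := by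
      refine Ex_mono h0 h1 fun A hA => ?_
      have h2 := hc A hA
      set x : ℝ := (A.card : ℝ)
      set M := max (2+x) ((k:ℝ)/2) with hM
      have hM1 : 2 + x ≤ M := le_max_left _ _
      have hM2 : (k:ℝ)/2 ≤ M := le_max_right _ _
      have hM0 : 0 < M := by linarith
      have e : (1/(k:ℝ) + 2 * (k-1)/(k:ℝ)^2) + (-2/(k:ℝ)^2) * x = (k + 2*(k-1) - 2*x)/(k:ℝ)^2 := by
        field_simp; ring
      rw [e, div_le_div_iff₀ hM0 (by positivity)]
      have h5 : x ≤ M - 2 := by linarith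
      rcases le_total M k with h6 | h6
      · nlinarith [mul_nonneg (sub_nonneg.2 h6) (by linarith : 0 ≤ 2*M - k), mul_nonneg (sub_nonneg.2 h5) hM0.le]
      · nlinarith [mul_nonneg (sub_nonneg.2 h6) hk0.le, mul_nonneg (sub_nonneg.2 h2) hM0.le]
    refine this.trans ?_
    rw [Ex_add, Ex_const, Ex_smul, Ex_card_mean, card_range, Nat.cast_sub hk1]
    have e : (1/(k:ℝ) + 2 * (k-1)/(k:ℝ)^2) + (-2/(k:ℝ)^2) * (p * ((k:ℝ) - (1:ℕ))) =
        (k + 2*(k-1)*(1-p))/(k:ℝ)^2 := by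
      push_cast; field_simp; ring
    rw [e, div_le_div_iff₀ (by positivity) hk0]
    have : (k + 2*((k:ℝ)-1)*(1-p)) ≤ (1+2/10^5) * k := by
      nlinarith [mul_nonneg (by linarith : (0:ℝ) ≤ k - 1) (by linarith : 0 ≤ 1/10^5 - (1-p))]
    nlinarith

variable {H : Finset (Finset (Fin (2*k+1)))} {u : Finset (Fin (2*k+1))} {d : ℕ} {p : ℝ}

lemma agr_out {B : Finset (Finset (Fin (2*k+1)))} (hB : B ⊆ Out u) : Agr u (H.filter (inn u) ∪ B) H := by
  intro x hx
  rw [mem_union, mem_filter]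
  constructor
  · rintro (h | h)
    · exact h.1
    · exact absurd hx (mem_filter.1 (hB h)).2
  · exact fun h => Or.inl ⟨h, hx⟩

lemma al_sum (hD : DD H d) (hk : (10:ℝ)^7 ≤ k) (hd : (d:ℝ) ≤ k/10^5) (hu : u ∈ Kn k) :
    ∑ b ∈ uᶜ, ∑ a ∈ (nb u b)ᶜ, ∑ c ∈ (y2 u b a)ᶜ, al H u b a c = 1 := by
  have hiv : ∀ v ∈ Kn k, (dg H v : ℝ) * iv H v = 1 := by
    intro v hv
    have := (dg_real hD hk hd hv).1
    rw [iv_eq hD hk hd hv, mul_one_div_cancel]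
    have : (0:ℝ) < dg H v := by linarith
    exact this.ne'
  have e1 : ∀ b ∈ uᶜ, ∀ a ∈ (nb u b)ᶜ, ∑ c ∈ (y2 u b a)ᶜ, al H u b a c =
      if nb u b ∈ H ∧ y2 u b a ∈ H then iv H u * iv H (nb u b) else 0 := by
    intro b hb a ha
    split_ifs with h
    · have : ∀ c ∈ (y2 u b a)ᶜ, al H u b a c =
        if nb (y2 u b a) c ∈ H then iv H u * iv H (nb u b) * iv H (y2 u b a) else 0 := by
        intro c _
        simp only [al, y3, h.1, h.2, true_and]
      rw [sum_congr rfl this, sum_const_deg]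
      have := hiv _ (hD.sub h.2)
      linear_combination (iv H u * iv H (nb u b)) * this
    · refine sum_eq_zero fun c _ => ?_
      unfold al
      rw [if_neg]; tauto
  have e2 : ∀ b ∈ uᶜ, ∑ a ∈ (nb u b)ᶜ, ∑ c ∈ (y2 u b a)ᶜ, al H u b a c =
      if nb u b ∈ H then iv H u else 0 := by
    intro b hb
    rw [sum_congr rfl (e1 b hb)]
    split_ifs with h
    · simp only [h, true_and, y2]
      rw [sum_const_deg]
      have := hiv _ (hD.sub h)
      linear_combination (iv H u) * this
    · simp [h]
  rw [sum_congr rfl e2, sum_const_deg, hiv _ hu]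

lemma nb_inj_on (v : Finset (Fin (2*k+1))) : Set.InjOn (nb v) (vᶜ : Finset (Fin (2*k+1))) := by
  intro s hs t ht e
  by_contra hne
  have : t ∈ nb v s := by
    simp only [nb, mem_erase]; exact ⟨fun h => hne h.symm, by simpa using ht⟩
  rw [e] at this
  simp [nb] at this

/-- degenerate walks -/
lemma mean_deg (hu : u ∈ Kn k) {x : Fin (2*k+1)} :
    Ex (Out u) p (fun B => iv (H.filter (inn u) ∪ B) (nb u x)) = iv H (nb u x) := by
  rw [← Ex_const (S := Out u) (p := p) (iv H (nb u x))]
  refine Ex_congr fun B hB => ?_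
  exact iv_congr fun t _ => agr_out hB _ (inn2 hu x t)

/-- nondegenerate walks -/
lemma mean_nondeg (hk : 4 ≤ k) (hD : DD H d) (hu : u ∈ Kn k) {b a c : Fin (2*k+1)} (hb : b ∈ uᶜ) (ha : a ∈ u)
    (hc : c ∈ nb u b) (h2 : y2 u b a ∈ H) (h3 : y3 u b a c ∈ H) :
    Ex (Out u) p (fun B => iv (H.filter (inn u) ∪ B) (y3 u b a c)) =
    Ex (Finset.range (k-1)) p (fun A => 1 / max ((1 + if insert c (u.erase a) ∈ H then 1 else 0) + (A.card : ℝ)) ((k:ℝ)/2)) := by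
  have hbu : b ∉ u := by simpa using hb
  have hc' : c ≠ b ∧ c ∉ u := by simpa [nb] using hc
  have hab : a ≠ b := fun h => hbu (h ▸ ha)
  have hac : a ≠ c := fun h => hc'.2 (h ▸ ha)
  set y := y3 u b a c with hy
  have hyc : yᶜ = insert c (insert b (u.erase a)) := by
    rw [hy, y3_compl, y2_eq, erase_insert_of_ne hab.symm]
  have hcn : c ∉ insert b (u.erase a) := by simp [hc'.1, hc'.2]
  have hbn : b ∉ u.erase a := by simp [hbu]
  set T := (u.erase a).image (nb y) with hT
  have hsub : u.erase a ⊆ yᶜ := by rw [hyc]; intro x hx; simp [mem_erase.1 hx]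
  have hinj : Set.InjOn (nb y) (u.erase a : Finset (Fin (2*k+1))) := fun s hs t ht e =>
    nb_inj_on y (by exact_mod_cast hsub hs) (by exact_mod_cast hsub ht) e
  have hucard := mem_Kn.1 hu
  have hTc : T.card = k - 1 := by
    rw [hT, card_image_of_injOn hinj, card_erase_of_mem ha, hucard]
  have hout : ∀ t ∈ u.erase a, nb y t ∈ Kn k ∧ ¬ inn u (nb y t) := by
    intro t ht
    refine ⟨nb_mem (hD.sub h3) (hsub ht), ?_⟩
    have e : nb y t ∩ u = (u.erase a).erase t := by
      rw [nb, hyc]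
      ext x
      simp only [mem_inter, mem_erase, mem_insert]
      constructor
      · rintro ⟨⟨h1, rfl | rfl | h⟩, h'⟩
        · exact absurd h' hc'.2
        · exact absurd h' hbu
        · exact ⟨h1, h⟩
      · rintro ⟨h1, h⟩
        exact ⟨⟨h1, Or.inr (Or.inr h)⟩, h.2⟩
    rw [inn, e, card_erase_of_mem ht, card_erase_of_mem ha, hucard]
    omega
  have hTO : T ⊆ Out u := by
    intro x hx
    obtain ⟨t, ht, rfl⟩ := mem_image.1 hx
    exact mem_filter.2 (hout t ht)
  have hnc : nb y c = y2 u b a := by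
    rw [nb, hy, y3_compl, erase_insert]
    rw [y2_eq, erase_insert_of_ne hab.symm]; exact hcn
  have hnb : nb y b = insert c (u.erase a) := by
    rw [nb, hyc, erase_insert_of_ne hc'.1, erase_insert hbn]
  have hdg : ∀ B, B ⊆ Out u → (dg (H.filter (inn u) ∪ B) y : ℝ) =
      (1 + if insert c (u.erase a) ∈ H then 1 else 0) + ((B ∩ T).card : ℝ) := by
    intro B hB
    have i1 : nb y c ∈ H.filter (inn u) ∪ B := by
      rw [hnc]; exact (agr_out hB _ (inn2 hu b a)).2 h2
    have i2 : nb y b ∈ H.filter (inn u) ∪ B ↔ insert c (u.erase a) ∈ H := by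
      rw [hnb]
      refine agr_out hB _ ?_
      have := inn2 hu c a
      rwa [y2_eq, erase_insert_of_ne hac.symm] at this
    have i3 : ((u.erase a).filter (fun t => nb y t ∈ H.filter (inn u) ∪ B)).card = (B ∩ T).card := by
      rw [← card_image_of_injOn (f := nb y) (s := (u.erase a).filter (fun t => nb y t ∈ H.filter (inn u) ∪ B))
        (hinj.mono (by intro x hx; simp only [coe_filter, Set.mem_ofPred_eq] at hx; exact_mod_cast hx.1))]
      congr 1
      ext x
      simp only [mem_image, mem_filter, mem_inter, hT, mem_union]
      constructor
      · rintro ⟨t, ⟨ht, h⟩, rfl⟩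
        refine ⟨?_, t, ht, rfl⟩
        rcases h with h | h
        · exact absurd h.2 (hout t ht).2
        · exact h
      · rintro ⟨hB, t, ht, rfl⟩
        exact ⟨t, ⟨ht, Or.inr hB⟩, rfl⟩
    unfold dg
    rw [hyc, filter_insert, if_pos i1, card_insert_of_notMem (by simp [hc'.1, hc'.2]), filter_insert]
    by_cases h : insert c (u.erase a) ∈ H
    · rw [if_pos (i2.2 h), card_insert_of_notMem (by simp [hbu]), i3, if_pos h]; push_cast; ring
    · rw [if_neg (fun h' => h (i2.1 h')), i3, if_neg h]; push_cast; ring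
  calc _ = Ex (Out u) p (fun B => (fun A : Finset (Finset (Fin (2*k+1))) =>
        1 / max ((1 + if insert c (u.erase a) ∈ H then 1 else 0) + (A.card : ℝ)) ((k:ℝ)/2)) (B ∩ T)) := by
        refine Ex_congr fun B hB => ?_
        simp only [iv]
        rw [hdg B hB]
    _ = _ := by
        exact (Ex_marg hTO (fun A : Finset (Finset (Fin (2*k+1))) =>
          1 / max ((1 + if insert c (u.erase a) ∈ H then 1 else 0) + (A.card : ℝ)) ((k:ℝ)/2))).trans <| Ex_card (by rw [hTc, card_range]) (fun n => 1 / max ((1 + if insert c (u.erase a) ∈ H then 1 else 0) + (n : ℝ)) ((k:ℝ)/2))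

end MeanEst


section MeanEst2
open Finset
variable {k : ℕ}
variable {H : Finset (Finset (Fin (2*k+1)))} {u : Finset (Fin (2*k+1))} {d : ℕ} {p : ℝ}

/-- error weights -/
noncomputable def er (H : Finset (Finset (Fin (2*k+1)))) (u : Finset (Fin (2*k+1))) (b a c : Fin (2*k+1)) : ℝ :=
  if a = b ∨ c = a then (5/10^5)/(k:ℝ) else if insert c (u.erase a) ∈ H then 0 else (2/(k:ℝ))^2

lemma er_nonneg (b a c) : 0 ≤ er H u b a c := by
  unfold er; split_ifs <;> positivity

lemma term_err (h0 : 0 ≤ p) (h1 : p ≤ 1) (hp : 1 - 1/10^5 ≤ p) (hD : DD H d) (hk : (10:ℝ)^7 ≤ k)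
    (hd : (d:ℝ) ≤ k/10^5) (hu : u ∈ Kn k) {b a c : Fin (2*k+1)} (hb : b ∈ uᶜ) (ha : a ∈ (nb u b)ᶜ)
    (hc : c ∈ (y2 u b a)ᶜ) (h2 : y2 u b a ∈ H) (h3 : y3 u b a c ∈ H) :
    |Ex (Out u) p (fun B => iv (H.filter (inn u) ∪ B) (y3 u b a c)) - mu k p| ≤ er H u b a c := by
  have hk0 : (0:ℝ) < k := by linarith
  have hk4 : 4 ≤ k := by
    have : (4:ℝ) ≤ k := by linarith
    exact_mod_cast this
  unfold er
  split_ifs with h h'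
  · obtain ⟨x, hx⟩ : ∃ x, y3 u b a c = nb u x := by
      rcases h with h | h
      · exact ⟨c, by rw [y3, y2, h, nb_nb hb]⟩
      · exact ⟨b, by rw [y3, y2, h, nb_nb ha]⟩
    rw [hx] at h3
    rw [hx, mean_deg hu]
    obtain ⟨i1, i2⟩ := iv_bounds hD hk hd (hD.sub h3)
    obtain ⟨m1, m2⟩ := mu_bounds h0 h1 hp hk
    have m3 : (1 - 1/10^6)/(k:ℝ) ≤ 1/((k:ℝ)+1) := by
      rw [div_le_div_iff₀ hk0 (by positivity)]; nlinarith
    have e1 : (1 - 1/10^6)/(k:ℝ) = (1 - 1/10^6) * (1/(k:ℝ)) := by ring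
    have e2 : (1 + 2/10^5)/(k:ℝ) = (1 + 2/10^5) * (1/(k:ℝ)) := by ring
    have e3 : (5/10^5)/(k:ℝ) = (5/10^5) * (1/(k:ℝ)) := by ring
    have : 0 < 1/(k:ℝ) := by positivity
    rw [e1] at i1 m3; rw [e2] at i2 m2; rw [e3, abs_le]
    constructor <;> linarith
  all_goals
    push Not at h
    have hau : a ∈ u := by
      rw [nb_compl, mem_insert] at ha; exact ha.resolve_left h.1
    have hcu : c ∈ nb u b := by
      rw [y2_compl, mem_insert] at hc; exact hc.resolve_left h.2
    rw [mean_nondeg hk4 hD hu hb hau hcu h2 h3]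
  · simp only [h', if_true, mu]
    have : (1:ℝ) + 1 = 2 := by norm_num
    simp [this]
  · simp only [h', if_false, mu, add_zero]
    rw [← Ex_sub, abs_le]
    have hA : ∀ A : Finset ℕ, |1 / max (1 + (A.card:ℝ)) ((k:ℝ)/2) - 1 / max (2 + (A.card:ℝ)) ((k:ℝ)/2)| ≤ (2/(k:ℝ))^2 := by
      intro A
      refine inv_lip (by omega) _ _ ?_
      have : (1 + (A.card:ℝ)) - (2 + (A.card:ℝ)) = -1 := by ring
      rw [this]; simp
    constructor
    · rw [← Ex_const (S := Finset.range (k-1)) (p := p) (-(2/(k:ℝ))^2)]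
      exact Ex_mono h0 h1 fun A _ => (abs_le.1 (hA A)).1
    · rw [← Ex_const (S := Finset.range (k-1)) (p := p) ((2/(k:ℝ))^2)]
      exact Ex_mono h0 h1 fun A _ => (abs_le.1 (hA A)).2

lemma er_sum (hD : DD H d) (hk : 0 < k) (hu : u ∈ Kn k) :
    ∑ b ∈ uᶜ, ∑ a ∈ (nb u b)ᶜ, ∑ c ∈ (y2 u b a)ᶜ, er H u b a c ≤
      (k+1) * ((2*k+1) * ((5/10^5)/(k:ℝ)) + k * (d * (2/(k:ℝ))^2)) := by
  have hucard := mem_Kn.1 hu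
  have hb : ∀ b ∈ uᶜ, ∑ a ∈ (nb u b)ᶜ, ∑ c ∈ (y2 u b a)ᶜ, er H u b a c ≤
      (2*k+1) * ((5/10^5)/(k:ℝ)) + k * (d * (2/(k:ℝ))^2) := by
    intro b hb
    have hbu : b ∉ u := by simpa using hb
    rw [nb_compl, sum_insert hbu]
    have f1 : ∑ c ∈ (y2 u b b)ᶜ, er H u b b c ≤ (k+1) * ((5/10^5)/(k:ℝ)) := by
      have : y2 u b b = u := nb_nb hb
      rw [this]
      refine (sum_le_card_nsmul _ _ ((5/10^5)/(k:ℝ)) fun c _ => ?_).trans ?_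
      · simp [er]
      · rw [card_compl_Kn hu, nsmul_eq_mul]; push_cast; exact le_rfl
    have f2 : ∀ a ∈ u, ∑ c ∈ (y2 u b a)ᶜ, er H u b a c ≤ (5/10^5)/(k:ℝ) + d * (2/(k:ℝ))^2 := by
      intro a ha
      have hab : a ≠ b := fun h => hbu (h ▸ ha)
      rw [y2_compl, sum_insert (by simp [nb, ha])]
      refine add_le_add (by simp [er]) ?_
      have g1 : ∀ c ∈ nb u b, er H u b a c = if insert c (u.erase a) ∉ H then (2/(k:ℝ))^2 else 0 := by
        intro c hc
        have hca : c ≠ a := by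
          rintro rfl
          simp [nb, ha] at hc
        unfold er
        rw [if_neg (by tauto)]
        by_cases h : insert c (u.erase a) ∈ H
        · rw [if_pos h, if_neg (by tauto)]
        · rw [if_neg h, if_pos h]
      rw [sum_congr rfl g1, ← sum_filter, sum_const, nsmul_eq_mul]
      refine mul_le_mul_of_nonneg_right ?_ (by positivity)
      have g2 := hD.d2 (u.erase a) (by rw [card_erase_of_mem ha, hucard]; omega)
      refine Nat.cast_le.2 (le_trans (card_le_card ?_) g2)
      refine filter_subset_filter _ ?_
      intro x hx
      have : x ≠ b ∧ x ∉ u := by simpa [nb] using hx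
      simp [this.2]
    have f3 := sum_le_card_nsmul _ _ _ f2
    rw [hucard, nsmul_eq_mul] at f3
    linarith
  refine (sum_le_card_nsmul _ _ _ hb).trans ?_
  rw [card_compl_Kn hu, nsmul_eq_mul]; push_cast; exact le_rfl

lemma mean_est (h0 : 0 ≤ p) (h1 : p ≤ 1) (hp : 1 - 1/10^5 ≤ p) (hD : DD H d) (hk : (10:ℝ)^7 ≤ k)
    (hd : (d:ℝ) ≤ k/10^5) (hu : u ∈ Kn k) :
    |Ex (Out u) p (fun B => qq (H.filter (inn u) ∪ B) 3 u) - mu k p| ≤ (2/100)/(k:ℝ)^2 := by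
  have hk0 : (0:ℝ) < k := by linarith
  have hk1 : 0 < k := by exact_mod_cast hk0
  have e1 : Ex (Out u) p (fun B => qq (H.filter (inn u) ∪ B) 3 u) =
      ∑ b ∈ uᶜ, ∑ a ∈ (nb u b)ᶜ, ∑ c ∈ (y2 u b a)ᶜ,
        al H u b a c * Ex (Out u) p (fun B => iv (H.filter (inn u) ∪ B) (y3 u b a c)) := by
    rw [Ex_congr (ψ := fun B => ∑ b ∈ uᶜ, ∑ a ∈ (nb u b)ᶜ, ∑ c ∈ (y2 u b a)ᶜ,
        al H u b a c * iv (H.filter (inn u) ∪ B) (y3 u b a c))]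
    · simp only [Ex_sum, Ex_smul]
    · intro B hB
      rw [q3_expand]
      simp only [al_congr hu (agr_out (H := H) hB)]
  have e2 : mu k p = ∑ b ∈ uᶜ, ∑ a ∈ (nb u b)ᶜ, ∑ c ∈ (y2 u b a)ᶜ, al H u b a c * mu k p := by
    simp only [← sum_mul]
    rw [al_sum hD hk hd hu, one_mul]
  have e3 : |Ex (Out u) p (fun B => qq (H.filter (inn u) ∪ B) 3 u) - mu k p| ≤
      ∑ b ∈ uᶜ, ∑ a ∈ (nb u b)ᶜ, ∑ c ∈ (y2 u b a)ᶜ, (2/(k:ℝ))^3 * er H u b a c := by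
    rw [e1]
    nth_rewrite 1 [e2]
    simp only [← sum_sub_distrib]
    refine (abs_sum_le_sum_abs _ _).trans (sum_le_sum fun b hb => ?_)
    refine (abs_sum_le_sum_abs _ _).trans (sum_le_sum fun a ha => ?_)
    refine (abs_sum_le_sum_abs _ _).trans (sum_le_sum fun c hc => ?_)
    rw [← mul_sub, abs_mul, abs_of_nonneg (al_nonneg b a c)]
    by_cases h : nb u b ∈ H ∧ y2 u b a ∈ H ∧ y3 u b a c ∈ H
    · exact mul_le_mul (al_le hk1 b a c) (term_err h0 h1 hp hD hk hd hu hb ha hc h.2.1 h.2.2) (abs_nonneg _) (by positivity)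
    · have : al H u b a c = 0 := by unfold al; rw [if_neg h]
      rw [this, zero_mul]
      exact mul_nonneg (by positivity) (er_nonneg b a c)
  refine e3.trans ?_
  simp only [← mul_sum]
  refine (mul_le_mul_of_nonneg_left (er_sum hD hk1 hu) (by positivity)).trans ?_
  have hb1 : (k+1) * ((2*k+1) * ((5/10^5)/(k:ℝ)) + k * (d * (2/(k:ℝ))^2)) ≤ (1/1000) * (k:ℝ) := by
    have a1 : (2*k+1) * ((5/10^5)/(k:ℝ)) ≤ 3 * (5/10^5) := by
      rw [mul_div_assoc', div_le_iff₀ hk0]; nlinarith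
    have a2 : k * (d * (2/(k:ℝ))^2) ≤ 4/10^5 := by
      have : k * (d * (2/(k:ℝ))^2) = 4 * d / k := by field_simp; ring
      rw [this, div_le_iff₀ hk0]; linarith
    have : (k+1) * ((2*k+1) * ((5/10^5)/(k:ℝ)) + k * (d * (2/(k:ℝ))^2)) ≤ (k+1) * (3 * (5/10^5) + 4/10^5) :=
      mul_le_mul_of_nonneg_left (add_le_add a1 a2) (by positivity)
    linarith
  refine (mul_le_mul_of_nonneg_left hb1 (by positivity)).trans ?_
  have : (2/(k:ℝ))^3 * ((1/1000) * (k:ℝ)) = (8/1000)/(k:ℝ)^2 := by field_simp; ring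
  rw [this]
  exact div_le_div_of_nonneg_right (by norm_num) (by positivity)

end MeanEst2


section Conc
open Finset
variable {k : ℕ}
variable {H : Finset (Finset (Fin (2*k+1)))} {u : Finset (Fin (2*k+1))} {d : ℕ} {p : ℝ}

open Classical in
lemma conc (h0 : 0 ≤ p) (h1 : p ≤ 1) (hk : (10:ℝ)^7 ≤ k) (hu : u ∈ Kn k) :
    Ex (Out u) p (fun B => if (1/100)/(k:ℝ)^2 < |qq (H ∪ B) 3 u - Ex (Out u) p (fun B => qq (H ∪ B) 3 u)| then 1 else 0)
      ≤ 2 * Real.exp (-((k:ℝ)^2/10^10)) := by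
  have hk0 : (0:ℝ) < k := by linarith
  have hk1 : 0 < k := by exact_mod_cast hk0
  refine (markov_exp (φ := fun B => qq (H ∪ B) 3 u) h0 h1
    (fun w => if (w \ u).card = 2 then (8 * (2/(k:ℝ))^5 : ℝ) else (0:ℝ)) (131072/(k:ℝ)^6) ((1/100)/(k:ℝ)^2)
    (by positivity) (by positivity) ?_ ?_).trans ?_
  · have e : ∀ w ∈ Out u, (if (w \ u).card = 2 then (8 * (2/(k:ℝ))^5 : ℝ) else (0:ℝ))^2 =
        if (w \ u).card = 2 then (8 * (2/(k:ℝ))^5 : ℝ)^2 else (0:ℝ) := by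
      intro w _; split_ifs <;> simp
    rw [sum_congr rfl e, ← sum_filter, sum_const, nsmul_eq_mul]
    have c1 : (((Out u).filter (fun w => (w \ u).card = 2)).card : ℝ) ≤ (k+1)^2 * k^2 := by
      have := card_two_diff hu
      have h2 : ((Out u).filter (fun w => (w \ u).card = 2)).card ≤ (k+1)^2 * k^2 :=
        le_trans (card_le_card (filter_subset_filter _ (filter_subset _ _))) this
      exact_mod_cast h2
    have c2 : ((k:ℝ)+1)^2 * k^2 ≤ 2 * (k:ℝ)^4 := by
      have : ((k:ℝ)+1)^2 ≤ 2 * (k:ℝ)^2 := by nlinarith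
      nlinarith [mul_le_mul_of_nonneg_right this (sq_nonneg (k:ℝ))]
    refine (mul_le_mul_of_nonneg_right (c1.trans c2) (by positivity)).trans (le_of_eq ?_)
    field_simp; norm_num
  · intro w hw B hB hwB
    rw [union_insert]
    have := mem_filter.1 hw
    exact q3_diff hk1 hu this.2 this.1
  · have : (k:ℝ)^2/10^10 ≤ ((1/100)/(k:ℝ)^2)^2 / (4 * (131072/(k:ℝ)^6)) := by
      have e : ((1/100)/(k:ℝ)^2)^2 / (4 * (131072/(k:ℝ)^6)) = (k:ℝ)^2 * (1/(10^4*4*131072)) := by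
        field_simp; try norm_num
      rw [e, div_eq_mul_inv]
      exact mul_le_mul_of_nonneg_left (by norm_num) (by positivity)
    have := Real.exp_le_exp.2 (neg_le_neg this)
    linarith

open Classical in
lemma bad_u (h0 : 0 ≤ p) (h1 : p ≤ 1) (hp : 1 - 1/10^5 ≤ p) (hk : (10:ℝ)^7 ≤ k)
    (hd : (d:ℝ) ≤ k/10^5) (hu : u ∈ Kn k) :
    Ex (Kn k) p (fun H => if DD H d ∧ (39/1000)/(k:ℝ)^2 < |qq H 3 u - mu k p| then 1 else 0)
      ≤ 2 * Real.exp (-((k:ℝ)^2/10^10)) := by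
  have hk0 : (0:ℝ) < k := by linarith
  have hU : Kn k = (Kn k).filter (inn u) ∪ Out u := (filter_union_filter_not_eq _ _).symm
  have hdis : Disjoint ((Kn k).filter (inn u)) (Out u) := disjoint_filter_filter_not _ _ _
  rw [hU, Ex_union hdis, ← Ex_const (S := (Kn k).filter (inn u)) (p := p) (2 * Real.exp (-((k:ℝ)^2/10^10)))]
  refine Ex_mono h0 h1 fun A hA => ?_
  by_cases hex : ∃ B, B ⊆ Out u ∧ DD (A ∪ B) d
  · obtain ⟨B0, hB0, hD⟩ := hex
    have hfil : (A ∪ B0).filter (inn u) = A := by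
      ext x
      simp only [mem_filter, mem_union]
      constructor
      · rintro ⟨h | h, h'⟩
        · exact h
        · exact absurd h' (mem_filter.1 (hB0 h)).2
      · exact fun h => ⟨Or.inl h, (mem_filter.1 (hA h)).2⟩
    have hm := mean_est h0 h1 hp hD hk hd hu
    rw [hfil] at hm
    refine le_trans (Ex_mono h0 h1 fun B _ => ?_) (conc (H := A) h0 h1 hk hu)
    by_cases h : DD (A ∪ B) d ∧ (39/1000)/(k:ℝ)^2 < |qq (A ∪ B) 3 u - mu k p|
    · rw [if_pos h, if_pos]
      have h2 := h.2
      have := abs_sub_le (qq (A ∪ B) 3 u) (Ex (Out u) p (fun B => qq (A ∪ B) 3 u)) (mu k p)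
      have e1 : (39/1000)/(k:ℝ)^2 = (39/1000) * (1/(k:ℝ)^2) := by ring
      have e2 : (2/100)/(k:ℝ)^2 = (2/100) * (1/(k:ℝ)^2) := by ring
      have e3 : (1/100)/(k:ℝ)^2 = (1/100) * (1/(k:ℝ)^2) := by ring
      have e4 : 0 < 1/(k:ℝ)^2 := by positivity
      rw [e1] at h2; rw [e2] at hm; rw [e3]
      linarith
    · rw [if_neg h]; split_ifs <;> norm_num
  · rw [Ex_congr (ψ := fun _ => 0), Ex_const]
    · positivity
    · intro B hB
      rw [if_neg]
      rintro ⟨h, _⟩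
      exact hex ⟨B, hB, h⟩

end Conc


section Final
open Finset
variable {k : ℕ}
variable {H : Finset (Finset (Fin (2*k+1)))} {d : ℕ} {p : ℝ}

open Classical in
lemma tail_bound (h0 : 0 ≤ p) (h1 : p ≤ 1) (hp : 1 - Real.exp (-(10^6)) ≤ p)
    (hd : (k:ℝ)/10^5 ≤ (d:ℝ)+1)
    {N : Finset (Finset (Fin (2*k+1)))} (hN : N ⊆ Kn k) (hNc : N.card ≤ k+2) :
    Ex (Kn k) p (fun H => if d < (N \ H).card then 1 else 0) ≤ Real.exp (-(10*k)) * Real.exp (k+2) := by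
  set y : ℝ := Real.exp (10^6) with hy
  have hy1 : 1 ≤ y := Real.one_le_exp (by norm_num)
  have hy0 : 0 < y := by linarith
  have s1 : Ex (Kn k) p (fun H => if d < (N \ H).card then 1 else 0) ≤
      Ex (Kn k) p (fun H => Real.exp (-(10*k)) * (fun A => y ^ (N \ A).card) (H ∩ N)) := by
    refine Ex_mono h0 h1 fun H _ => ?_
    have e : N \ (H ∩ N) = N \ H := by
      ext x; simp only [Finset.mem_sdiff, mem_inter]; tauto
    simp only [e]
    split_ifs with h
    · have h2 : y ^ (d+1) ≤ y ^ (N \ H).card := pow_le_pow_right₀ hy1 h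
      have h3 : Real.exp (10*k) ≤ y ^ (d+1) := by
        rw [hy, ← Real.exp_nat_mul]
        refine Real.exp_le_exp.2 ?_
        push_cast
        linarith
      have h4 : Real.exp (-(10*k)) * Real.exp (10*k) = 1 := by rw [← Real.exp_add]; simp
      calc (1:ℝ) = Real.exp (-(10*k)) * Real.exp (10*k) := h4.symm
        _ ≤ _ := mul_le_mul_of_nonneg_left (h3.trans h2) (Real.exp_pos _).le
    · positivity
  refine s1.trans ?_
  rw [Ex_smul]
  refine mul_le_mul_of_nonneg_left ?_ (Real.exp_pos _).le
  refine (Ex_marg hN (fun A => y ^ (N \ A).card)).le.trans ?_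
  rw [Ex_missing]
  have hb : p + (1-p) * y ≤ 2 := by
    have : (1-p) * y ≤ Real.exp (-(10^6)) * y := mul_le_mul_of_nonneg_right (by linarith) hy0.le
    rw [hy, ← Real.exp_add] at this
    simp only [neg_add_cancel, Real.exp_zero] at this
    linarith
  have hb0 : 0 ≤ p + (1-p) * y := add_nonneg h0 (mul_nonneg (by linarith) hy0.le)
  have he : (2:ℝ) ≤ Real.exp 1 := by have := Real.add_one_le_exp (1:ℝ); linarith
  calc (p + (1-p)*y) ^ N.card ≤ (Real.exp 1) ^ N.card := pow_le_pow_left₀ hb0 (hb.trans he) _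
    _ ≤ (Real.exp 1) ^ (k+2) := pow_le_pow_right₀ (by linarith) hNc
    _ = Real.exp (k+2) := by rw [← Real.exp_nat_mul]; push_cast; ring_nf

/-- the neighbours of `v` -/
def N1 (v : Finset (Fin (2*k+1))) : Finset (Finset (Fin (2*k+1))) := (vᶜ).image (nb v)
/-- the extensions of `s` -/
def N2 (s : Finset (Fin (2*k+1))) : Finset (Finset (Fin (2*k+1))) := (sᶜ).image (fun b => insert b s)

/-- the sets of size `k-1` -/
def Km (k : ℕ) : Finset (Finset (Fin (2*k+1))) := univ.filter (fun s => s.card + 1 = k)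

lemma not_DD (hH : H ⊆ Kn k) (h : ¬ DD H d) :
    (∃ v ∈ Kn k, d < (N1 v \ H).card) ∨ (∃ s ∈ Km k, d < (N2 s \ H).card) := by
  by_contra hc
  push Not at hc
  refine h ⟨hH, fun v hv => ?_, fun s hs => ?_⟩
  · refine le_trans (card_le_card_of_injOn (nb v) ?_ ?_) (hc.1 v hv)
    · intro t ht
      simp only [coe_filter, Set.mem_ofPred_eq] at ht
      simp only [mem_coe, Finset.mem_sdiff, N1]
      exact ⟨mem_image_of_mem _ ht.1, ht.2⟩
    · refine (nb_inj_on v).mono ?_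
      intro t ht
      simp only [coe_filter, Set.mem_ofPred_eq] at ht
      exact_mod_cast ht.1
  · refine le_trans (card_le_card_of_injOn (fun b => insert b s) ?_ ?_) (hc.2 s (by simp [Km, hs]))
    · intro t ht
      simp only [coe_filter, Set.mem_ofPred_eq] at ht
      simp only [mem_coe, Finset.mem_sdiff, N2]
      exact ⟨mem_image_of_mem (fun b => insert b s) ht.1, ht.2⟩
    · intro x hx z hz e
      simp only [coe_filter, Set.mem_ofPred_eq, mem_compl] at hx hz
      have : x ∈ insert z s := by
        have : x ∈ insert x s := mem_insert_self _ _
        have e' : insert x s = insert z s := e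
        rwa [e'] at this
      exact (mem_insert.1 this).resolve_right hx.1

lemma N1_ok {v} (hv : v ∈ Kn k) : N1 v ⊆ Kn k ∧ (N1 v).card ≤ k+2 := by
  constructor
  · intro x hx
    obtain ⟨t, ht, rfl⟩ := mem_image.1 hx
    exact nb_mem hv ht
  · refine card_image_le.trans ?_
    rw [card_compl_Kn hv]; omega

lemma N2_ok {s} (hs : s ∈ Km k) : N2 s ⊆ Kn k ∧ (N2 s).card ≤ k+2 := by
  have hs' : s.card + 1 = k := by simpa [Km] using hs
  constructor
  · intro x hx
    obtain ⟨t, ht, rfl⟩ := mem_image.1 hx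
    rw [mem_Kn, card_insert_of_notMem (by simpa using ht)]; exact hs'
  · refine card_image_le.trans ?_
    rw [card_compl, Fintype.card_fin]; omega

lemma card_fam (F : Finset (Finset (Fin (2*k+1)))) : (F.card : ℝ) ≤ Real.exp (2*k+1) := by
  have h : F.card ≤ 2^(2*k+1) := by
    refine (card_le_univ F).trans ?_
    simp
  have he : (2:ℝ) ≤ Real.exp 1 := by have := Real.add_one_le_exp (1:ℝ); linarith
  calc (F.card : ℝ) ≤ (2:ℝ)^(2*k+1) := by exact_mod_cast h
    _ ≤ (Real.exp 1)^(2*k+1) := pow_le_pow_left₀ (by norm_num) he _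
    _ = _ := by rw [← Real.exp_nat_mul]; push_cast; ring_nf

open Classical in
lemma fail_bound (h0 : 0 ≤ p) (h1 : p ≤ 1) (hp : 1 - Real.exp (-(10^6)) ≤ p) (hk : (10:ℝ)^11 ≤ k) :
    Ex (Kn k) p (fun H => if EKR H then 0 else 1) ≤ 4 * Real.exp (-(k:ℝ)) := by
  have hk7 : (10:ℝ)^7 ≤ k := by linarith
  have hk0 : (0:ℝ) < k := by linarith
  have hp5 : 1 - 1/10^5 ≤ p := by
    have : Real.exp (-(10^6)) ≤ 1/10^5 := by
      rw [Real.exp_neg, ← one_div]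
      refine one_div_le_one_div_of_le (by norm_num) ?_
      have := Real.add_one_le_exp ((10:ℝ)^6)
      refine le_trans ?_ this
      norm_num
    exact (sub_le_sub_left this 1).trans hp
  set d : ℕ := ⌊(k:ℝ)/10^5⌋₊ with hdd
  have hd : (d:ℝ) ≤ k/10^5 := Nat.floor_le (by positivity)
  have hd' : (k:ℝ)/10^5 ≤ (d:ℝ)+1 := (Nat.lt_floor_add_one _).le
  have s1 : Ex (Kn k) p (fun H => if EKR H then 0 else 1) ≤
      Ex (Kn k) p (fun H => ((∑ v ∈ Kn k, if d < (N1 v \ H).card then (1:ℝ) else 0) +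
        ∑ s ∈ Km k, if d < (N2 s \ H).card then (1:ℝ) else 0) +
        ∑ u ∈ Kn k, if DD H d ∧ (39/1000)/(k:ℝ)^2 < |qq H 3 u - mu k p| then (1:ℝ) else 0) := by
    refine Ex_mono h0 h1 fun H hH => ?_
    have n1 : ∀ v ∈ Kn k, 0 ≤ (if d < (N1 v \ H).card then (1:ℝ) else 0) := by
      intro v _; split_ifs <;> norm_num
    have n2 : ∀ v ∈ Km k, 0 ≤ (if d < (N2 v \ H).card then (1:ℝ) else 0) := by
      intro v _; split_ifs <;> norm_num
    have n3 : ∀ u ∈ Kn k, 0 ≤ (if DD H d ∧ (39/1000)/(k:ℝ)^2 < |qq H 3 u - mu k p| then (1:ℝ) else 0) := by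
      intro v _; split_ifs <;> norm_num
    have m1 := sum_nonneg n1
    have m2 := sum_nonneg n2
    have m3 := sum_nonneg n3
    split_ifs with hE
    · linarith
    · by_cases hD : DD H d
      · have : ∃ u ∈ Kn k, (39/1000)/(k:ℝ)^2 < |qq H 3 u - mu k p| := by
          by_contra hc
          push Not at hc
          exact hE (determ2 hD hk7 hd _ hc)
        obtain ⟨u, hu, h⟩ := this
        have := single_le_sum n3 hu
        rw [if_pos ⟨hD, h⟩] at this
        linarith
      · rcases not_DD hH hD with ⟨v, hv, h⟩ | ⟨s, hs, h⟩
        · have := single_le_sum n1 hv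
          rw [if_pos h] at this
          linarith
        · have := single_le_sum n2 hs
          rw [if_pos h] at this
          linarith
  refine s1.trans ?_
  rw [Ex_add, Ex_add, Ex_sum, Ex_sum, Ex_sum]
  have t1 := sum_le_card_nsmul (Kn k) (fun v => Ex (Kn k) p (fun H => if d < (N1 v \ H).card then (1:ℝ) else 0)) _
    (fun v hv => tail_bound h0 h1 hp hd' (N1_ok hv).1 (N1_ok hv).2)
  have t2 := sum_le_card_nsmul (Km k) (fun v => Ex (Kn k) p (fun H => if d < (N2 v \ H).card then (1:ℝ) else 0)) _
    (fun v hv => tail_bound h0 h1 hp hd' (N2_ok hv).1 (N2_ok hv).2)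
  have t3 := sum_le_card_nsmul (Kn k) (fun u => Ex (Kn k) p
      (fun H => if DD H d ∧ (39/1000)/(k:ℝ)^2 < |qq H 3 u - mu k p| then (1:ℝ) else 0)) _
    (fun u hu => bad_u h0 h1 hp5 hk7 hd hu)
  rw [nsmul_eq_mul] at t1 t2 t3
  have w : ∀ F : Finset (Finset (Fin (2*k+1))), (F.card:ℝ) * (Real.exp (-(10*k)) * Real.exp (k+2)) ≤ Real.exp (-(k:ℝ)) := by
    intro F
    refine (mul_le_mul_of_nonneg_right (card_fam F) (by positivity)).trans ?_
    rw [← Real.exp_add, ← Real.exp_add]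
    exact Real.exp_le_exp.2 (by linarith)
  have w3 : ((Kn k).card:ℝ) * (2 * Real.exp (-((k:ℝ)^2/10^10))) ≤ 2 * Real.exp (-(k:ℝ)) := by
    refine (mul_le_mul_of_nonneg_right (card_fam _) (by positivity)).trans ?_
    rw [mul_left_comm, ← Real.exp_add]
    refine mul_le_mul_of_nonneg_left (Real.exp_le_exp.2 ?_) (by norm_num)
    have : 10 * (k:ℝ) ≤ (k:ℝ)^2/10^10 := by
      rw [le_div_iff₀ (by norm_num)]; nlinarith
    linarith
  have := w (Kn k)
  have := w (Km k)
  linarith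

open Classical in
lemma hprob_eq : hprob (2*k+1) k p (fun H => EKR H) = 1 - Ex (Kn k) p (fun H => if EKR H then 0 else 1) := by
  have e : (1:ℝ) = Ex (Kn k) p (fun _ => 1) := (Ex_const 1).symm
  nth_rewrite 1 [e]
  rw [← Ex_sub]
  unfold hprob Ex
  refine sum_congr rfl fun H _ => ?_
  by_cases h : EKR H
  · simp [h, Kn]
  · simp [h]

end Final

/-- **Theorem.** There is a fixed `ε > 0` such that if `n = 2k+1` and `p > 1 - ε`,
then `H_k(n,p)` satisfies EKR almost surely (as `k → ∞`). -/
theorem ekr_n_eq_two_k_plus_one :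
    ∃ ε : ℝ, 0 < ε ∧ ∀ p : ℕ → ℝ, (∀ k, 1 - ε < p k) → (∀ k, p k ≤ 1) →
      Tendsto (fun k => hprob (2 * k + 1) k (p k) (fun H => EKR H)) atTop (nhds 1) := by
  classical
  refine ⟨Real.exp (-(10^6)), Real.exp_pos _, fun p hp hp1 => ?_⟩
  have hε : Real.exp (-(10^6)) ≤ 1 := Real.exp_le_one_iff.2 (by norm_num)
  have h0 : ∀ k, 0 ≤ p k := fun k => by have := hp k; linarith
  have hlim : Tendsto (fun k : ℕ => 1 - 4 * Real.exp (-(k:ℝ))) atTop (nhds 1) := by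
    have h1 : Tendsto (fun k : ℕ => Real.exp (-(k:ℝ))) atTop (nhds 0) :=
      Real.tendsto_exp_neg_atTop_nhds_zero.comp tendsto_natCast_atTop_atTop
    have := (h1.const_mul 4).const_sub 1
    simpa using this
  refine tendsto_of_tendsto_of_tendsto_of_le_of_le' hlim tendsto_const_nhds ?_ ?_
  · filter_upwards [tendsto_natCast_atTop_atTop.eventually_ge_atTop ((10:ℝ)^11)] with k hk
    rw [hprob_eq]
    have := fail_bound (h0 k) (hp1 k) (hp k).le hk
    linarith
  · refine Eventually.of_forall fun k => ?_
    rw [hprob_eq]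
    have : 0 ≤ Ex (Kn k) (p k) (fun H => if EKR H then 0 else 1) := by
      refine (Ex_const (S := Kn k) (p := p k) 0).symm.le.trans ?_
      exact Ex_mono (h0 k) (hp1 k) fun H _ => by split_ifs <;> norm_num
    linarith
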